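/- There exists a constant C > 0, depending only on Ω, such that for every λ > 0 and every Neumann eigenfunction φ of Ω with eigenvalue λ², the set of boundary zeros {t ∈ [0, L) : φ(γ(t)) = 0} is finite and has cardinality at most C(1 + λ). -/

import Mathlib

open MeasureTheory

/-- The Euclidean Laplacian of a function on ℝ², as the sum of its second
partial derivatives. -/
noncomputable def lap2 (φ : EuclideanSpace ℝ (Fin 2) → ℝ) (x : EuclideanSpace ℝ (Fin 2)) : ℝ :=
  ∑ i, fderiv ℝ (fun y => fderiv ℝ φ y (EuclideanSpace.single i 1)) x (EuclideanSpace.single i 1)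

/-- φ is a Neumann eigenfunction of Ω (with boundary parametrized by γ) with
eigenvalue λ²: it is not identically zero, smooth on an open neighborhood of
the closure of Ω, satisfies Δφ = -λ²φ on Ω, and its gradient along the
boundary is tangent to the boundary (vanishing normal derivative). -/
def IsNeumannEigenfunction (Ω : Set (EuclideanSpace ℝ (Fin 2)))
    (γ : ℝ → EuclideanSpace ℝ (Fin 2)) (lam : ℝ)
    (φ : EuclideanSpace ℝ (Fin 2) → ℝ) : Prop :=
  (∃ U : Set (EuclideanSpace ℝ (Fin 2)), IsOpen U ∧ closure Ω ⊆ U ∧ ContDiffOn ℝ (⊤ : ℕ∞) φ U)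
  ∧ ¬ Set.EqOn φ 0 (closure Ω)
  ∧ (∀ x ∈ Ω, lap2 φ x = -lam ^ 2 * φ x)
  ∧ (∀ t : ℝ, ∃ c : ℝ, gradient φ (γ t) = c • deriv γ t)

section

open Complex Set Filter Topology

/-- The entire function `∑ (-X)^k / (k! (k+m)!)`, a normalized Bessel function of order `m`. -/
noncomputable def besselSeries (m : ℕ) (X : ℂ) : ℂ :=
  ∑' k : ℕ, (-X) ^ k / ((k.factorial : ℂ) * ((k + m).factorial : ℂ))

theorem norm_besselSeries_term_le (m : ℕ) (X : ℂ) (k : ℕ) :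
    ‖(-X) ^ k / ((k.factorial : ℂ) * ((k + m).factorial : ℂ))‖
      ≤ (Real.sqrt ‖X‖ ^ k / k.factorial) ^ 2 := by
  have h1 : (1 : ℝ) ≤ k.factorial := by
    exact_mod_cast Nat.one_le_iff_ne_zero.2 (Nat.factorial_ne_zero k)
  have h2 : (k.factorial : ℝ) ≤ (k + m).factorial := by
    exact_mod_cast Nat.factorial_le (Nat.le_add_right k m)
  rw [norm_div, norm_mul, norm_pow, norm_neg, norm_natCast, norm_natCast, div_pow, ← pow_mul,
    mul_comm k 2, pow_mul, Real.sq_sqrt (norm_nonneg X), sq]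
  gcongr

theorem summable_exp_series (x : ℝ) : Summable fun k : ℕ => x ^ k / (k.factorial : ℝ) :=
  Real.summable_pow_div_factorial x

theorem summable_sq_exp_series {x : ℝ} (hx : 0 ≤ x) :
    Summable fun k : ℕ => (x ^ k / (k.factorial : ℝ)) ^ 2 := by
  refine Summable.of_nonneg_of_le (fun k => sq_nonneg _) (fun k => ?_)
    ((summable_exp_series x).mul_left (Real.exp x))
  rw [sq]
  gcongr
  exact Real.pow_div_factorial_le_exp x hx k

theorem tsum_sq_exp_series_le {x : ℝ} (hx : 0 ≤ x) :
    ∑' k : ℕ, (x ^ k / (k.factorial : ℝ)) ^ 2 ≤ Real.exp (2 * x) := by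
  have h : ∑' k : ℕ, (x ^ k / (k.factorial : ℝ)) ^ 2
      ≤ ∑' k : ℕ, Real.exp x * (x ^ k / (k.factorial : ℝ)) := by
    refine Summable.tsum_le_tsum (fun k => ?_) (summable_sq_exp_series hx)
      ((summable_exp_series x).mul_left _)
    rw [sq]
    gcongr
    exact Real.pow_div_factorial_le_exp x hx k
  refine h.trans (le_of_eq ?_)
  rw [tsum_mul_left, two_mul, Real.exp_add]
  congr 1
  rw [Real.exp_eq_exp_ℝ, NormedSpace.exp_eq_tsum_div]

theorem summable_besselSeries (m : ℕ) (X : ℂ) :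
    Summable fun k : ℕ => (-X) ^ k / ((k.factorial : ℂ) * ((k + m).factorial : ℂ)) :=
  Summable.of_norm_bounded (summable_sq_exp_series (Real.sqrt_nonneg ‖X‖))
    (norm_besselSeries_term_le m X)

theorem norm_besselSeries_le (m : ℕ) (X : ℂ) :
    ‖besselSeries m X‖ ≤ Real.exp (2 * Real.sqrt ‖X‖) :=
  (tsum_of_norm_bounded (summable_sq_exp_series (Real.sqrt_nonneg ‖X‖)).hasSum
    (norm_besselSeries_term_le m X)).trans (tsum_sq_exp_series_le (Real.sqrt_nonneg _))

theorem hasDerivAt_besselSeries (m : ℕ) (X : ℂ) :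
    HasDerivAt (besselSeries m) (-besselSeries (m + 1) X) X := by
  have key : ∀ Y : ℂ, besselSeries m Y = 1 / (m.factorial : ℂ) +
      ∑' k : ℕ, (-Y) ^ (k + 1) / (((k + 1).factorial : ℂ) * ((k + 1 + m).factorial : ℂ)) := by
    intro Y
    unfold besselSeries
    rw [(summable_besselSeries m Y).tsum_eq_zero_add]
    simp
  have hd : HasDerivAt (fun Y : ℂ => ∑' k : ℕ,
      (-Y) ^ (k + 1) / (((k + 1).factorial : ℂ) * ((k + 1 + m).factorial : ℂ)))
      (∑' k : ℕ, -((-X) ^ k / ((k.factorial : ℂ) * ((k + (m + 1)).factorial : ℂ)))) X := by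
    refine hasDerivAt_tsum_of_isPreconnected
      (u := fun k => (Real.sqrt (‖X‖ + 1) ^ k / k.factorial) ^ 2)
      (t := Metric.ball 0 (‖X‖ + 1)) (y₀ := 0)
      (g := fun k Y => (-Y) ^ (k + 1) / (((k + 1).factorial : ℂ) * ((k + 1 + m).factorial : ℂ)))
      (g' := fun k Y => -((-Y) ^ k / ((k.factorial : ℂ) * ((k + (m + 1)).factorial : ℂ))))
      (summable_sq_exp_series (Real.sqrt_nonneg _)) Metric.isOpen_ball
      (convex_ball _ _).isPreconnected ?_ ?_ ?_ ?_ ?_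
    · intro k Y _
      have h1 : HasDerivAt (fun Y : ℂ => (-Y) ^ (k + 1))
          (((k + 1 : ℕ) : ℂ) * (-Y) ^ k * (-1)) Y := by
        simpa using (hasDerivAt_neg Y).fun_pow (k + 1)
      refine (h1.div_const _).congr_deriv ?_
      have e : k + 1 + m = k + (m + 1) := by omega
      rw [e, Nat.factorial_succ k]
      have h2 : (k.factorial : ℂ) ≠ 0 := by exact_mod_cast Nat.factorial_ne_zero k
      have h3 : ((k + (m + 1)).factorial : ℂ) ≠ 0 := by exact_mod_cast Nat.factorial_ne_zero _
      have h4 : ((k : ℂ) + 1) ≠ 0 := by exact_mod_cast Nat.succ_ne_zero k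
      push_cast
      field_simp
    · intro k Y hY
      rw [norm_neg]
      refine (norm_besselSeries_term_le (m + 1) Y k).trans ?_
      have : ‖Y‖ ≤ ‖X‖ + 1 := by simpa using (Metric.mem_ball.1 hY).le
      gcongr
    · simp; positivity
    · simp
    · simp
  have e2 : besselSeries m = fun Y : ℂ => 1 / (m.factorial : ℂ) + ∑' k : ℕ,
      (-Y) ^ (k + 1) / (((k + 1).factorial : ℂ) * ((k + 1 + m).factorial : ℂ)) := funext key
  rw [e2]
  refine (hd.const_add _).congr_deriv ?_
  rw [tsum_neg]
  rfl

theorem besselSeries_zero_apply_zero : besselSeries 0 0 = 1 := by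
  unfold besselSeries
  rw [tsum_eq_single 0]
  · simp
  · intro k hk
    simp [hk]

theorem besselSeries_zero_eq (X : ℂ) :
    besselSeries 0 X = besselSeries 1 X - X * besselSeries 2 X := by
  have h2 : HasSum (fun k : ℕ => (-X) ^ (k + 1) / ((k.factorial : ℂ) * ((k + 2).factorial : ℂ)))
      (-X * besselSeries 2 X) := by
    have h := (summable_besselSeries 2 X).hasSum.mul_left (-X)
    have e : (fun k : ℕ => (-X) ^ (k + 1) / ((k.factorial : ℂ) * ((k + 2).factorial : ℂ))) =
        fun k : ℕ => -X * ((-X) ^ k / ((k.factorial : ℂ) * ((k + 2).factorial : ℂ))) := by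
      ext k
      ring
    rw [e]
    exact h
  have h3 : HasSum (fun k : ℕ => (k : ℂ) * (-X) ^ k / ((k.factorial : ℂ) * ((k + 1).factorial : ℂ)))
      (-X * besselSeries 2 X) := by
    rw [← hasSum_nat_add_iff' 1]
    simp only [Finset.range_one, Finset.sum_singleton, Nat.cast_zero, zero_mul, zero_div, sub_zero]
    refine Eq.subst (motive := fun F : ℕ → ℂ => HasSum F (-X * besselSeries 2 X))
        (funext fun k => ?_) h2
    have e : k + 1 + 1 = k + 2 := by omega
    rw [e, Nat.factorial_succ k]
    have h2 : (k.factorial : ℂ) ≠ 0 := by exact_mod_cast Nat.factorial_ne_zero k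
    have h3 : ((k + 2).factorial : ℂ) ≠ 0 := by exact_mod_cast Nat.factorial_ne_zero _
    have h4 : ((k : ℂ) + 1) ≠ 0 := by exact_mod_cast Nat.succ_ne_zero k
    push_cast
    field_simp
  have h1 := (summable_besselSeries 1 X).hasSum
  rw [sub_eq_add_neg, ← neg_mul]
  refine HasSum.tsum_eq ?_
  refine Eq.subst (motive := fun F : ℕ → ℂ => HasSum F (besselSeries 1 X + -X * besselSeries 2 X))
    (funext fun k => ?_) (h1.add h3)
  rw [Nat.factorial_succ k]
  have h2 : (k.factorial : ℂ) ≠ 0 := by exact_mod_cast Nat.factorial_ne_zero k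
  have h4 : ((k : ℂ) + 1) ≠ 0 := by exact_mod_cast Nat.succ_ne_zero k
  simp only [add_zero]
  push_cast
  field_simp
  ring

theorem besselSeries_ofReal_im (m : ℕ) (x : ℝ) : (besselSeries m x).im = 0 := by
  have : besselSeries m x = ((∑' k : ℕ, (-x) ^ k / ((k.factorial : ℝ) * ((k + m).factorial : ℝ)) :
      ℝ) : ℂ) := by
    unfold besselSeries
    push_cast
    rfl
  rw [this, ofReal_im]

theorem differentiable_besselSeries (m : ℕ) : Differentiable ℂ (besselSeries m) :=
  fun X => (hasDerivAt_besselSeries m X).differentiableAt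

theorem continuous_besselSeries (m : ℕ) : Continuous (besselSeries m) :=
  (differentiable_besselSeries m).continuous

theorem continuousOn_intervalIntegral_param {X : Type*} [TopologicalSpace X]
    [FirstCountableTopology X] {F : X → ℝ → ℂ} {T : Set X}
    (hF : ContinuousOn (Function.uncurry F) (T ×ˢ Icc (0 : ℝ) 1)) :
    ContinuousOn (fun x => ∫ θ in (0 : ℝ)..1, F x θ) T := by
  rw [continuousOn_iff_continuous_domRestrict]
  have h1 : Continuous (Function.uncurry
      (fun (x : T) (θ : ℝ) => F x (projIcc (0 : ℝ) 1 zero_le_one θ))) := by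
    have : Continuous fun p : T × ℝ =>
        ((p.1 : X), ((projIcc (0 : ℝ) 1 zero_le_one p.2 : Icc (0 : ℝ) 1) : ℝ)) := by
      fun_prop
    exact hF.comp_continuous this fun p => ⟨p.1.2, (projIcc (0 : ℝ) 1 zero_le_one p.2).2⟩
  refine (intervalIntegral.continuous_parametric_intervalIntegral_of_continuous' (μ := volume)
    h1 0 1).congr fun x => ?_
  refine intervalIntegral.integral_congr fun θ hθ => ?_
  rw [uIcc_of_le zero_le_one] at hθ
  simp only [projIcc_of_mem zero_le_one hθ]

theorem continuousOn_slice {X : Type*} [TopologicalSpace X] {F : X → ℝ → ℂ} {T : Set X}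
    (hF : ContinuousOn (Function.uncurry F) (T ×ˢ Icc (0 : ℝ) 1)) {x : X} (hx : x ∈ T) :
    ContinuousOn (F x) (Icc (0 : ℝ) 1) :=
  hF.comp (f := fun θ : ℝ => (x, θ)) (by fun_prop) fun _ hθ => ⟨hx, hθ⟩

theorem differentiableOn_intervalIntegral_param {F : ℂ → ℝ → ℂ} {U : Set ℂ} (hU : IsOpen U)
    (hF : ContinuousOn (Function.uncurry F) (U ×ˢ Icc (0 : ℝ) 1))
    (hd : ∀ θ ∈ Icc (0 : ℝ) 1, DifferentiableOn ℂ (fun t => F t θ) U) :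
    DifferentiableOn ℂ (fun t => ∫ θ in (0 : ℝ)..1, F t θ) U := by
  intro t₀ ht₀
  refine DifferentiableAt.differentiableWithinAt ?_
  obtain ⟨ε, hε, hball⟩ := Metric.isOpen_iff.1 hU t₀ ht₀
  set r := ε / 3 with hr
  have hr0 : 0 < r := by positivity
  have hK : IsCompact (Metric.closedBall t₀ (2 * r) ×ˢ Icc (0 : ℝ) 1) :=
    (isCompact_closedBall _ _).prod isCompact_Icc
  have hsub : Metric.closedBall t₀ (2 * r) ⊆ U := fun z hz =>
    hball (Metric.mem_ball.2 (lt_of_le_of_lt (Metric.mem_closedBall.1 hz) (by linarith)))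
  obtain ⟨M, hM⟩ := hK.exists_bound_of_continuousOn (hF.mono (prod_mono_left hsub))
  have hderiv : ∀ θ ∈ Icc (0 : ℝ) 1, ∀ t ∈ Metric.ball t₀ r,
      HasDerivAt (fun t => F t θ) (deriv (fun t => F t θ) t) t ∧
        ‖deriv (fun t => F t θ) t‖ ≤ M / r := by
    intro θ hθ t ht
    have hcl : Metric.closedBall t r ⊆ Metric.closedBall t₀ (2 * r) := by
      refine Metric.closedBall_subset_closedBall' ?_
      linarith [Metric.mem_ball.1 ht]
    have htU : t ∈ U := hsub (hcl (Metric.mem_closedBall_self hr0.le))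
    refine ⟨((hd θ hθ).differentiableAt (hU.mem_nhds htU)).hasDerivAt, ?_⟩
    refine Complex.norm_deriv_le_of_forall_mem_sphere_norm_le hr0
      (DifferentiableOn.diffContOnCl_ball ((hd θ hθ).mono hsub) hcl) ?_
    intro z hz
    exact hM (z, θ) ⟨hcl (Metric.sphere_subset_closedBall hz), hθ⟩
  have hmeas : ∀ t ∈ U, AEStronglyMeasurable (F t) (volume.restrict (uIoc (0 : ℝ) 1)) := by
    intro t ht
    rw [uIoc_of_le zero_le_one]
    exact ((continuousOn_slice hF ht).mono Ioc_subset_Icc_self).aestronglyMeasurable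
      measurableSet_Ioc
  have hlim : AEStronglyMeasurable (fun θ => deriv (fun t => F t θ) t₀)
      (volume.restrict (uIoc (0 : ℝ) 1)) := by
    have hseq : Tendsto (fun n : ℕ => (r / ((n : ℂ) + 2) : ℂ)) atTop (𝓝[≠] 0) := by
      rw [tendsto_nhdsWithin_iff]
      constructor
      · have h1 : Tendsto (fun n : ℕ => r / ((n : ℝ) + 2)) atTop (𝓝 0) :=
          tendsto_const_nhds.div_atTop (tendsto_natCast_atTop_atTop.atTop_add tendsto_const_nhds)
        have h2 := (continuous_ofReal.tendsto 0).comp h1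
        simpa [Function.comp_def] using h2
      · refine Eventually.of_forall fun n => ?_
        have : ((n : ℂ) + 2) ≠ 0 := by exact_mod_cast (by omega : n + 2 ≠ 0)
        simpa [hr0.ne'] using this
    refine aestronglyMeasurable_of_tendsto_ae (u := atTop) (f := fun (n : ℕ) θ =>
      (r / ((n : ℂ) + 2) : ℂ)⁻¹ • (F (t₀ + (r / ((n : ℂ) + 2) : ℂ)) θ - F t₀ θ)) (fun n => ?_) ?_
    · have hmem : t₀ + (r / ((n : ℂ) + 2) : ℂ) ∈ Metric.closedBall t₀ (2 * r) := ?_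
      · exact ((hmeas _ (hsub hmem)).sub (hmeas _ ht₀)).const_smul (r / ((n : ℂ) + 2) : ℂ)⁻¹
      rw [Metric.mem_closedBall, dist_eq_norm, add_sub_cancel_left, norm_div, norm_real,
        Real.norm_of_nonneg hr0.le]
      have : ‖(n : ℂ) + 2‖ = n + 2 := by
        have : (n : ℂ) + 2 = ((n + 2 : ℕ) : ℂ) := by push_cast; rfl
        rw [this, norm_natCast]; push_cast; rfl
      rw [this]
      refine (div_le_self hr0.le (by linarith [(Nat.cast_nonneg n : (0 : ℝ) ≤ n)])).trans
          (by linarith)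
    · refine (ae_restrict_iff' measurableSet_uIoc).2 (Eventually.of_forall fun θ hθ => ?_)
      rw [uIoc_of_le zero_le_one] at hθ
      have h := (hderiv θ (Ioc_subset_Icc_self hθ) t₀ (Metric.mem_ball_self hr0)).1
      exact (hasDerivAt_iff_tendsto_slope_zero.1 h).comp hseq
  refine (intervalIntegral.hasDerivAt_integral_of_dominated_loc_of_deriv_le (μ := volume)
    (F := F) (F' := fun t θ => deriv (fun t => F t θ) t) (bound := fun _ => M / r)
    (Metric.ball_mem_nhds t₀ hr0) ?_ ?_ hlim ?_ ?_ ?_).2.differentiableAt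
  · filter_upwards [hU.mem_nhds ht₀] with t ht using hmeas t ht
  · refine ContinuousOn.intervalIntegrable ?_
    rw [uIcc_of_le zero_le_one]
    exact continuousOn_slice hF ht₀
  · refine Eventually.of_forall fun θ hθ t ht => ?_
    rw [uIoc_of_le zero_le_one] at hθ
    exact (hderiv θ (Ioc_subset_Icc_self hθ) t ht).2
  · exact intervalIntegrable_const
  · refine Eventually.of_forall fun θ hθ t ht => ?_
    rw [uIoc_of_le zero_le_one] at hθ
    exact (hderiv θ (Ioc_subset_Icc_self hθ) t ht).1

/-- Neumann iterates of the Volterra equation `g t = Φ t - ∫₀¹ κ t θ * g (θ t) dθ`. -/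
noncomputable def volterraIter (κ : ℂ → ℝ → ℂ) (Φ : ℂ → ℂ) : ℕ → ℂ → ℂ
  | 0 => Φ
  | n + 1 => fun t => -∫ θ in (0 : ℝ)..1, κ t θ * volterraIter κ Φ n (θ * t)

section Volterra

variable {κ : ℂ → ℝ → ℂ} {Φ g : ℂ → ℂ} {T : Set ℂ} {a b N ρ : ℝ}

theorem continuousOn_volterra_integrand
    (hT : ∀ t ∈ T, ∀ θ ∈ Icc (0 : ℝ) 1, (θ : ℂ) * t ∈ T)
    (hκ : ContinuousOn (Function.uncurry κ) (T ×ˢ Icc (0 : ℝ) 1)) (hg : ContinuousOn g T) :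
    ContinuousOn (Function.uncurry fun t (θ : ℝ) => κ t θ * g (θ * t)) (T ×ˢ Icc (0 : ℝ) 1) := by
  refine hκ.mul (hg.comp (f := fun p : ℂ × ℝ => (p.2 : ℂ) * p.1) (by fun_prop) ?_)
  rintro ⟨t, θ⟩ ⟨ht, hθ⟩
  exact hT t ht θ hθ

theorem norm_volterra_integral_le (hb : 0 ≤ b) {n : ℕ}
    (hT : ∀ t ∈ T, ∀ θ ∈ Icc (0 : ℝ) 1, (θ : ℂ) * t ∈ T)
    (hκb : ∀ t ∈ T, ∀ θ ∈ Icc (0 : ℝ) 1, ‖κ t θ‖ ≤ b * ‖t‖ * Real.exp (a * (1 - θ) * ‖t‖))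
    (hgb : ∀ t ∈ T, ‖g t‖ ≤ N * Real.exp (a * ‖t‖) * ((b * ‖t‖) ^ n / n.factorial))
    {t : ℂ} (ht : t ∈ T) :
    ‖∫ θ in (0 : ℝ)..1, κ t θ * g (θ * t)‖
      ≤ N * Real.exp (a * ‖t‖) * ((b * ‖t‖) ^ (n + 1) / (n + 1).factorial) := by
  have hbound : ∀ θ ∈ Icc (0 : ℝ) 1, ‖κ t θ * g (θ * t)‖ ≤
      (N * Real.exp (a * ‖t‖) * (b * ‖t‖) ^ (n + 1) / n.factorial) * θ ^ n := by
    intro θ hθ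
    rw [norm_mul]
    refine (mul_le_mul (hκb t ht θ hθ) (hgb _ (hT t ht θ hθ)) (norm_nonneg _)
      (by positivity)).trans (le_of_eq ?_)
    rw [norm_mul, norm_real, Real.norm_of_nonneg hθ.1]
    have : Real.exp (a * ‖t‖) = Real.exp (a * (1 - θ) * ‖t‖) * Real.exp (a * (θ * ‖t‖)) := by
      rw [← Real.exp_add]; congr 1; ring
    rw [this]
    ring
  have hint : ∫ θ in (0 : ℝ)..1,
      (N * Real.exp (a * ‖t‖) * (b * ‖t‖) ^ (n + 1) / n.factorial) * θ ^ n =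
      N * Real.exp (a * ‖t‖) * ((b * ‖t‖) ^ (n + 1) / (n + 1).factorial) := by
    rw [intervalIntegral.integral_const_mul, integral_pow, Nat.factorial_succ]
    have h2 : (n.factorial : ℝ) ≠ 0 := by exact_mod_cast Nat.factorial_ne_zero n
    have h4 : ((n : ℝ) + 1) ≠ 0 := by exact_mod_cast Nat.succ_ne_zero n
    push_cast
    field_simp
    simp
  rw [← hint]
  refine intervalIntegral.norm_integral_le_of_norm_le zero_le_one
    (Eventually.of_forall fun θ hθ => hbound θ (Ioc_subset_Icc_self hθ)) ?_
  exact Continuous.intervalIntegrable (by fun_prop) _ _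

theorem continuousOn_volterraIter
    (hT : ∀ t ∈ T, ∀ θ ∈ Icc (0 : ℝ) 1, (θ : ℂ) * t ∈ T)
    (hκ : ContinuousOn (Function.uncurry κ) (T ×ˢ Icc (0 : ℝ) 1)) (hΦ : ContinuousOn Φ T) (n : ℕ) :
    ContinuousOn (volterraIter κ Φ n) T := by
  induction n with
  | zero => exact hΦ
  | succ n ih =>
    exact (continuousOn_intervalIntegral_param (continuousOn_volterra_integrand hT hκ ih)).neg

theorem norm_volterraIter_le (hb : 0 ≤ b)
    (hT : ∀ t ∈ T, ∀ θ ∈ Icc (0 : ℝ) 1, (θ : ℂ) * t ∈ T)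
    (hκb : ∀ t ∈ T, ∀ θ ∈ Icc (0 : ℝ) 1, ‖κ t θ‖ ≤ b * ‖t‖ * Real.exp (a * (1 - θ) * ‖t‖))
    (ha : 0 ≤ a) (hN : 0 ≤ N) (hΦb : ∀ t ∈ T, ‖Φ t‖ ≤ N) (n : ℕ) :
    ∀ t ∈ T, ‖volterraIter κ Φ n t‖ ≤
      N * Real.exp (a * ‖t‖) * ((b * ‖t‖) ^ n / n.factorial) := by
  induction n with
  | zero =>
    intro t ht
    refine (hΦb t ht).trans ?_
    simp only [pow_zero, Nat.factorial_zero, Nat.cast_one, div_one, mul_one]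
    exact le_mul_of_one_le_right hN (Real.one_le_exp (by positivity))
  | succ n ih =>
    intro t ht
    show ‖-∫ θ in (0 : ℝ)..1, κ t θ * volterraIter κ Φ n (θ * t)‖ ≤ _
    rw [norm_neg]
    exact norm_volterra_integral_le hb hT hκb ih ht

theorem differentiableOn_volterra_integral {U : Set ℂ} (hU : IsOpen U) (hUT : U ⊆ T)
    (hT : ∀ t ∈ T, ∀ θ ∈ Icc (0 : ℝ) 1, (θ : ℂ) * t ∈ T)
    (hUs : ∀ t ∈ U, ∀ θ ∈ Ioc (0 : ℝ) 1, (θ : ℂ) * t ∈ U)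
    (hκ : ContinuousOn (Function.uncurry κ) (T ×ˢ Icc (0 : ℝ) 1)) (hg : ContinuousOn g T)
    (hκd : ∀ θ ∈ Icc (0 : ℝ) 1, DifferentiableOn ℂ (fun t => κ t θ) U)
    (hgd : DifferentiableOn ℂ g U) :
    DifferentiableOn ℂ (fun t => ∫ θ in (0 : ℝ)..1, κ t θ * g (θ * t)) U := by
  refine differentiableOn_intervalIntegral_param hU
    ((continuousOn_volterra_integrand hT hκ hg).mono (prod_mono_left hUT)) fun θ hθ => ?_
  refine (hκd θ hθ).mul ?_
  rcases hθ.1.eq_or_lt with h0 | h0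
  · simp [← h0]
  · exact hgd.comp (f := fun t => (θ : ℂ) * t) (by fun_prop) fun t ht => hUs t ht θ ⟨h0, hθ.2⟩

theorem exists_volterra_solution (hb : 0 ≤ b) (ha : 0 ≤ a) (hN : 0 ≤ N)
    (hTρ : ∀ t ∈ T, ‖t‖ ≤ ρ)
    (hT : ∀ t ∈ T, ∀ θ ∈ Icc (0 : ℝ) 1, (θ : ℂ) * t ∈ T)
    (hκ : ContinuousOn (Function.uncurry κ) (T ×ˢ Icc (0 : ℝ) 1))
    (hκb : ∀ t ∈ T, ∀ θ ∈ Icc (0 : ℝ) 1, ‖κ t θ‖ ≤ b * ‖t‖ * Real.exp (a * (1 - θ) * ‖t‖))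
    (hΦ : ContinuousOn Φ T) (hΦb : ∀ t ∈ T, ‖Φ t‖ ≤ N)
    {U : Set ℂ} (hU : IsOpen U) (hUT : U ⊆ T)
    (hUs : ∀ t ∈ U, ∀ θ ∈ Ioc (0 : ℝ) 1, (θ : ℂ) * t ∈ U)
    (hκd : ∀ θ ∈ Icc (0 : ℝ) 1, DifferentiableOn ℂ (fun t => κ t θ) U)
    (hΦd : DifferentiableOn ℂ Φ U) :
    ∃ g : ℂ → ℂ, ContinuousOn g T ∧ DifferentiableOn ℂ g U ∧
      (∀ t ∈ T, ‖g t‖ ≤ N * Real.exp ((a + b) * ρ)) ∧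
      ∀ t ∈ T, g t = Φ t - ∫ θ in (0 : ℝ)..1, κ t θ * g (θ * t) := by
  set w : ℕ → ℝ := fun n => N * Real.exp (a * ρ) * ((b * ρ) ^ n / n.factorial) with hw
  have hwsum : Summable w := (Real.summable_pow_div_factorial _).mul_left _
  have hwt : ∑' n, w n = N * Real.exp ((a + b) * ρ) := by
    rw [hw, tsum_mul_left, mul_assoc, add_mul, Real.exp_add]
    congr 2
    rw [Real.exp_eq_exp_ℝ, NormedSpace.exp_eq_tsum_div]
  have hle : ∀ n, ∀ t ∈ T, ‖volterraIter κ Φ n t‖ ≤ w n := by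
    intro n t ht
    refine (norm_volterraIter_le hb hT hκb ha hN hΦb n t ht).trans ?_
    have := hTρ t ht
    simp only [hw]
    gcongr
  have hcont := continuousOn_volterraIter hT hκ hΦ
  have hd : ∀ n, DifferentiableOn ℂ (volterraIter κ Φ n) U := by
    intro n
    induction n with
    | zero => exact hΦd
    | succ n ih =>
      exact (differentiableOn_volterra_integral hU hUT hT hUs hκ (hcont n) hκd ih).neg
  refine ⟨fun t => ∑' n, volterraIter κ Φ n t, continuousOn_tsum hcont hwsum hle,
    differentiableOn_tsum_of_summable_norm hwsum hd hU fun n t ht => hle n t (hUT ht), ?_, ?_⟩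
  · intro t ht
    rw [← hwt]
    exact tsum_of_norm_bounded hwsum.hasSum fun n => hle n t ht
  · intro t ht
    have hs : ∀ t ∈ T, Summable fun n => volterraIter κ Φ n t := fun t ht =>
      Summable.of_norm_bounded hwsum fun n => hle n t ht
    beta_reduce
    rw [(hs t ht).tsum_eq_zero_add]
    have key : HasSum (fun n => ∫ θ in (0 : ℝ)..1, κ t θ * volterraIter κ Φ n (θ * t))
        (∫ θ in (0 : ℝ)..1, κ t θ * ∑' n, volterraIter κ Φ n (θ * t)) := by
      refine intervalIntegral.hasSum_integral_of_dominated_convergence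
        (fun n θ => b * ‖t‖ * Real.exp (a * ‖t‖) * w n) (fun n => ?_) (fun n => ?_) ?_ ?_ ?_
      · rw [uIoc_of_le zero_le_one]
        exact ((continuousOn_slice (continuousOn_volterra_integrand hT hκ (hcont n)) ht).mono
          Ioc_subset_Icc_self).aestronglyMeasurable measurableSet_Ioc
      · refine Eventually.of_forall fun θ hθ => ?_
        rw [uIoc_of_le zero_le_one] at hθ
        have hθ' := Ioc_subset_Icc_self hθ
        rw [norm_mul]
        refine mul_le_mul ((hκb t ht θ hθ').trans ?_) (hle n _ (hT t ht θ hθ')) (norm_nonneg _)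
          (by positivity)
        have : a * (1 - θ) * ‖t‖ ≤ a * ‖t‖ := by
          have : 0 ≤ a * ‖t‖ * θ := mul_nonneg (by positivity) hθ'.1
          nlinarith
        gcongr
      · exact Eventually.of_forall fun θ _ => hwsum.mul_left _
      · exact intervalIntegrable_const
      · refine Eventually.of_forall fun θ hθ => ?_
        rw [uIoc_of_le zero_le_one] at hθ
        exact (hs _ (hT t ht θ (Ioc_subset_Icc_self hθ))).hasSum.mul_left _
    have h2 : ∑' n, volterraIter κ Φ (n + 1) t =
        -∫ θ in (0 : ℝ)..1, κ t θ * ∑' n, volterraIter κ Φ n (θ * t) := key.neg.tsum_eq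
    rw [h2, ← sub_eq_add_neg]
    rfl

theorem volterra_eq_zero (hb : 0 ≤ b) (ha : 0 ≤ a) (hN : 0 ≤ N)
    (hT : ∀ t ∈ T, ∀ θ ∈ Icc (0 : ℝ) 1, (θ : ℂ) * t ∈ T)
    (hκb : ∀ t ∈ T, ∀ θ ∈ Icc (0 : ℝ) 1, ‖κ t θ‖ ≤ b * ‖t‖ * Real.exp (a * (1 - θ) * ‖t‖))
    (hgb : ∀ t ∈ T, ‖g t‖ ≤ N)
    (hg : ∀ t ∈ T, g t = -∫ θ in (0 : ℝ)..1, κ t θ * g (θ * t)) :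
    ∀ t ∈ T, g t = 0 := by
  have h : ∀ n : ℕ, ∀ t ∈ T, ‖g t‖ ≤ N * Real.exp (a * ‖t‖) * ((b * ‖t‖) ^ n / n.factorial) := by
    intro n
    induction n with
    | zero =>
      intro t ht
      refine (hgb t ht).trans ?_
      simp only [pow_zero, Nat.factorial_zero, Nat.cast_one, div_one, mul_one]
      exact le_mul_of_one_le_right hN (Real.one_le_exp (by positivity))
    | succ n ih =>
      intro t ht
      rw [hg t ht, norm_neg]
      exact norm_volterra_integral_le hb hT hκb ih ht
  intro t ht
  have hlim : Tendsto (fun n : ℕ => N * Real.exp (a * ‖t‖) * ((b * ‖t‖) ^ n / n.factorial))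
      atTop (𝓝 0) := by
    simpa using (FloorSemiring.tendsto_pow_div_factorial_atTop (b * ‖t‖)).const_mul
      (N * Real.exp (a * ‖t‖))
  exact norm_le_zero_iff.1 (ge_of_tendsto' hlim fun n => h n t ht)

end Volterra

/-- A continuous function on an open set that is holomorphic off the real axis is holomorphic. -/
theorem differentiableOn_of_off_real {f : ℂ → ℂ} {U : Set ℂ} (hU : IsOpen U)
    (hc : ContinuousOn f U) (hd : ∀ z ∈ U, z.im ≠ 0 → DifferentiableAt ℂ f z) :
    DifferentiableOn ℂ f U := by
  refine (isConservativeOn_and_continuousOn_iff_isDifferentiableOn hU).1 ⟨?_, hc⟩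
  have main : ∀ z w : ℂ, Rectangle z w ⊆ U → (0 : ℝ) ∉ Ioo (min z.im w.im) (max z.im w.im) →
      wedgeIntegral z w f = - wedgeIntegral w z f := by
    intro z w hzw h0
    rw [← add_eq_zero_iff_eq_neg, wedgeIntegral_add_wedgeIntegral_eq]
    refine integral_boundary_rect_eq_zero_of_continuousOn_of_differentiableOn f z w
      (hc.mono hzw) fun p hp => (hd p (hzw ?_) ?_).differentiableWithinAt
    · exact ⟨Ioo_subset_Icc_self hp.1, Ioo_subset_Icc_self hp.2⟩
    · intro h
      exact h0 (h ▸ hp.2)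
  intro z w hzw
  by_cases h0 : (0 : ℝ) ∈ Ioo (min z.im w.im) (max z.im w.im)
  swap
  · exact main z w hzw h0
  have h0' : (0 : ℝ) ∈ uIcc z.im w.im := Ioo_subset_Icc_self h0
  have s1 : uIcc z.im 0 ⊆ uIcc z.im w.im := uIcc_subset_uIcc left_mem_uIcc h0'
  have s2 : uIcc 0 w.im ⊆ uIcc z.im w.im := uIcc_subset_uIcc h0' right_mem_uIcc
  have hint : ∀ x ∈ uIcc z.re w.re, ∀ a b : ℝ, uIcc a b ⊆ uIcc z.im w.im →
      IntervalIntegrable (fun y : ℝ => f (x + y * I)) volume a b := by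
    intro x hx a b hab
    refine ContinuousOn.intervalIntegrable (hc.comp (by fun_prop) fun y hy => hzw ?_)
    exact ⟨by simpa using hx, by simpa using hab hy⟩
  have e1 := main z (w.re : ℂ) (fun p hp => hzw ⟨by simpa using hp.1, s1 (by simpa using hp.2)⟩)
    (fun h => by
      rcases le_total z.im 0 with h' | h' <;> simp [h'] at h)
  have e2 := main (z.re : ℂ) w (fun p hp => hzw ⟨by simpa using hp.1, s2 (by simpa using hp.2)⟩)
    (fun h => by
      rcases le_total w.im 0 with h' | h' <;> simp [h'] at h)
  rw [← add_eq_zero_iff_eq_neg, wedgeIntegral_add_wedgeIntegral_eq] at e1 e2 ⊢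
  rw [← intervalIntegral.integral_add_adjacent_intervals
      (hint w.re right_mem_uIcc z.im 0 s1) (hint w.re right_mem_uIcc 0 w.im s2),
    ← intervalIntegral.integral_add_adjacent_intervals
      (hint z.re left_mem_uIcc z.im 0 s1) (hint z.re left_mem_uIcc 0 w.im s2)]
  simp only [ofReal_re, ofReal_im, smul_add] at e1 e2 ⊢
  linear_combination e1 + e2

/-- Schwarz reflection. -/
theorem exists_schwarz_reflection {f : ℂ → ℂ} {U : Set ℂ} (hU : IsOpen U)
    (hsymm : ∀ z ∈ U, (starRingEnd ℂ) z ∈ U)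
    (hc : ContinuousOn f (U ∩ {z | 0 ≤ z.im})) (hd : ∀ z ∈ U, 0 < z.im → DifferentiableAt ℂ f z)
    (hr : ∀ z ∈ U, z.im = 0 → (f z).im = 0) :
    ∃ g : ℂ → ℂ, DifferentiableOn ℂ g U ∧ (∀ z, 0 ≤ z.im → g z = f z) ∧
      ∀ z, z.im < 0 → g z = (starRingEnd ℂ) (f ((starRingEnd ℂ) z)) := by
  classical
  refine ⟨fun z => if 0 ≤ z.im then f z else (starRingEnd ℂ) (f ((starRingEnd ℂ) z)), ?_,
    fun z hz => if_pos hz, fun z hz => if_neg (not_le.2 hz)⟩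
  refine differentiableOn_of_off_real hU ?_ ?_
  · have hfr : frontier {z : ℂ | 0 ≤ z.im} = {z | z.im = 0} := frontier_setOfPred_le_im 0
    have hcl : closure {z : ℂ | 0 ≤ z.im} = {z | 0 ≤ z.im} :=
      (isClosed_le continuous_const continuous_im).closure_eq
    have hcl' : closure {z : ℂ | ¬ 0 ≤ z.im} = {z | z.im ≤ 0} := by
      simp only [not_le]; exact closure_setOfPred_im_lt 0
    refine ContinuousOn.if ?_ ?_ ?_
    · rintro z ⟨hz, hz'⟩
      rw [hfr] at hz'
      have hz0 : z.im = 0 := hz'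
      have e : (starRingEnd ℂ) z = z := conj_eq_iff_im.2 hz0
      rw [e]
      exact (conj_eq_iff_im.2 (hr z hz hz0)).symm
    · rw [hcl]; exact hc
    · rw [hcl']
      refine continuous_conj.comp_continuousOn (hc.comp continuous_conj.continuousOn ?_)
      rintro z ⟨hz, hz'⟩
      exact ⟨hsymm z hz, by simpa using hz'⟩
  · intro z hz hz0
    rcases lt_or_gt_of_ne hz0 with h | h
    · have hev : (fun z => if 0 ≤ z.im then f z else (starRingEnd ℂ) (f ((starRingEnd ℂ) z)))
          =ᶠ[𝓝 z] fun z => (starRingEnd ℂ) (f ((starRingEnd ℂ) z)) := by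
        filter_upwards [continuous_im.continuousAt.eventually_lt continuousAt_const h] with y hy
        exact if_neg (not_le.2 hy)
      refine DifferentiableAt.congr_of_eventuallyEq ?_ hev
      have := (hd _ (hsymm z hz) (by simpa using h)).conj_conj
      simpa [Function.comp_def] using this
    · have hev : (fun z => if 0 ≤ z.im then f z else (starRingEnd ℂ) (f ((starRingEnd ℂ) z)))
          =ᶠ[𝓝 z] f := by
        filter_upwards [continuousAt_const.eventually_lt continuous_im.continuousAt h] with y hy
        exact if_pos hy.le
      exact (hd z hz h).congr_of_eventuallyEq hev

/-- Closed rectangle symmetric about both axes. -/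
def symmRect (a b : ℝ) : Set ℂ := {z | |z.re| ≤ a ∧ |z.im| ≤ b}

/-- Open rectangle symmetric about both axes. -/
def openSymmRect (a b : ℝ) : Set ℂ := {z | |z.re| < a ∧ |z.im| < b}

/-- Closed upper half of `symmRect`. -/
def upperRect (a b : ℝ) : Set ℂ := {z | |z.re| ≤ a ∧ 0 ≤ z.im ∧ z.im ≤ b}

/-- Open upper half of `symmRect`. -/
def openUpperRect (a b : ℝ) : Set ℂ := {z | |z.re| < a ∧ 0 < z.im ∧ z.im < b}

section Rectangles

variable {a b : ℝ}

theorem symmRect_eq : symmRect a b = Icc (-a) a ×ℂ Icc (-b) b := by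
  ext z; simp [symmRect, mem_reProdIm, abs_le]

theorem upperRect_eq : upperRect a b = Icc (-a) a ×ℂ Icc 0 b := by
  ext z; simp [upperRect, mem_reProdIm, abs_le]

theorem openSymmRect_eq : openSymmRect a b = Ioo (-a) a ×ℂ Ioo (-b) b := by
  ext z; simp [openSymmRect, mem_reProdIm, abs_lt]

theorem openUpperRect_eq : openUpperRect a b = Ioo (-a) a ×ℂ Ioo 0 b := by
  ext z; simp [openUpperRect, mem_reProdIm, abs_lt]

theorem isCompact_upperRect : IsCompact (upperRect a b) := by
  rw [upperRect_eq]; exact isCompact_Icc.reProdIm isCompact_Icc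

theorem isOpen_openSymmRect : IsOpen (openSymmRect a b) := by
  rw [openSymmRect_eq]; exact isOpen_Ioo.reProdIm isOpen_Ioo

theorem isOpen_openUpperRect : IsOpen (openUpperRect a b) := by
  rw [openUpperRect_eq]; exact isOpen_Ioo.reProdIm isOpen_Ioo

theorem convex_symmRect : Convex ℝ (symmRect a b) := by
  rw [symmRect_eq]
  exact ((convex_Icc _ _).linear_preimage reLm).inter ((convex_Icc _ _).linear_preimage imLm)

theorem convex_upperRect : Convex ℝ (upperRect a b) := by
  rw [upperRect_eq]
  exact ((convex_Icc _ _).linear_preimage reLm).inter ((convex_Icc _ _).linear_preimage imLm)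

theorem convex_openSymmRect : Convex ℝ (openSymmRect a b) := by
  rw [openSymmRect_eq]
  exact ((convex_Ioo _ _).linear_preimage reLm).inter ((convex_Ioo _ _).linear_preimage imLm)

theorem convex_openUpperRect : Convex ℝ (openUpperRect a b) := by
  rw [openUpperRect_eq]
  exact ((convex_Ioo _ _).linear_preimage reLm).inter ((convex_Ioo _ _).linear_preimage imLm)

theorem openUpperRect_subset : openUpperRect a b ⊆ upperRect a b :=
  fun _ hz => ⟨hz.1.le, hz.2.1.le, hz.2.2.le⟩

theorem openSymmRect_subset : openSymmRect a b ⊆ symmRect a b :=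
  fun _ hz => ⟨hz.1.le, hz.2.le⟩

theorem upperRect_subset : upperRect a b ⊆ symmRect a b :=
  fun _ hz => ⟨hz.1, by rw [abs_of_nonneg hz.2.1]; exact hz.2.2⟩

theorem closure_openUpperRect (ha : 0 < a) (hb : 0 < b) :
    closure (openUpperRect a b) = upperRect a b := by
  rw [openUpperRect_eq, upperRect_eq, closure_reProdIm, closure_Ioo (by linarith),
    closure_Ioo hb.ne]

theorem conj_mem_symmRect {z : ℂ} (hz : z ∈ symmRect a b) : (starRingEnd ℂ) z ∈ symmRect a b := by
  simpa [symmRect] using hz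

theorem conj_mem_openSymmRect {z : ℂ} (hz : z ∈ openSymmRect a b) :
    (starRingEnd ℂ) z ∈ openSymmRect a b := by
  simpa [openSymmRect] using hz

theorem ofReal_mul_mem_symmRect {z : ℂ} (hz : z ∈ symmRect a b) {θ : ℝ} (hθ : θ ∈ Icc (0 : ℝ) 1) :
    (θ : ℂ) * z ∈ symmRect a b := by
  refine ⟨?_, ?_⟩
  · rw [re_ofReal_mul, abs_mul, abs_of_nonneg hθ.1]
    exact (mul_le_of_le_one_left (abs_nonneg _) hθ.2).trans hz.1
  · rw [im_ofReal_mul, abs_mul, abs_of_nonneg hθ.1]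
    exact (mul_le_of_le_one_left (abs_nonneg _) hθ.2).trans hz.2

theorem ofReal_mul_mem_openSymmRect {z : ℂ} (hz : z ∈ openSymmRect a b) {θ : ℝ}
    (hθ : θ ∈ Icc (0 : ℝ) 1) : (θ : ℂ) * z ∈ openSymmRect a b := by
  refine ⟨?_, ?_⟩
  · rw [re_ofReal_mul, abs_mul, abs_of_nonneg hθ.1]
    exact (mul_le_of_le_one_left (abs_nonneg _) hθ.2).trans_lt hz.1
  · rw [im_ofReal_mul, abs_mul, abs_of_nonneg hθ.1]
    exact (mul_le_of_le_one_left (abs_nonneg _) hθ.2).trans_lt hz.2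

theorem ofReal_mul_mem_upperRect {z : ℂ} (hz : z ∈ upperRect a b) {θ : ℝ}
    (hθ : θ ∈ Icc (0 : ℝ) 1) : (θ : ℂ) * z ∈ upperRect a b := by
  refine ⟨(ofReal_mul_mem_symmRect (upperRect_subset hz) hθ).1, ?_, ?_⟩
  · rw [im_ofReal_mul]; exact mul_nonneg hθ.1 hz.2.1
  · rw [im_ofReal_mul]; exact (mul_le_of_le_one_left hz.2.1 hθ.2).trans hz.2.2

theorem ofReal_mul_mem_openUpperRect {z : ℂ} (hz : z ∈ openUpperRect a b) {θ : ℝ}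
    (hθ : θ ∈ Ioc (0 : ℝ) 1) : (θ : ℂ) * z ∈ openUpperRect a b := by
  refine ⟨?_, ?_, ?_⟩
  · rw [re_ofReal_mul, abs_mul, abs_of_nonneg hθ.1.le]
    exact (mul_le_of_le_one_left (abs_nonneg _) hθ.2).trans_lt hz.1
  · rw [im_ofReal_mul]; exact mul_pos hθ.1 hz.2.1
  · rw [im_ofReal_mul]; exact (mul_le_of_le_one_left hz.2.1.le hθ.2).trans_lt hz.2.2

theorem norm_le_of_mem_symmRect {z : ℂ} (hz : z ∈ symmRect a b) : ‖z‖ ≤ a + b :=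
  (norm_le_abs_re_add_abs_im z).trans (add_le_add hz.1 hz.2)

end Rectangles

/-- Two-constants estimate in a rectangle: a function bounded by `M`, and by `m` on the bottom
side, is bounded by `√(m M)` near the middle of the bottom side. -/
theorem sq_norm_le_of_bottom {f : ℂ → ℂ} {l h m M : ℝ} (hh : 0 < h) (hl : h ≤ l)
    (hm : 0 < m) (hmM : m ≤ M) (hc : ContinuousOn f (upperRect l h))
    (hd : DifferentiableOn ℂ f (openUpperRect l h))
    (hM : ∀ z ∈ upperRect l h, ‖f z‖ ≤ M)
    (hb : ∀ z ∈ upperRect l h, z.im = 0 → ‖f z‖ ≤ m)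
    {z : ℂ} (hz : z ∈ upperRect (l / 2) (h / 8)) : ‖f z‖ ^ 2 ≤ m * M := by
  have hl0 : 0 < l := hh.trans_le hl
  set Λ := Real.log (M / m) with hΛ
  have hMm : 1 ≤ M / m := by rwa [one_le_div hm]
  have hΛ0 : 0 ≤ Λ := Real.log_nonneg hMm
  have hexp : Real.exp Λ = M / m := Real.exp_log (by positivity)
  set E : ℂ → ℂ := fun t => exp (Λ * (2 * I * t / h - t ^ 2 / l ^ 2)) with hE
  have hre : ∀ t : ℂ, ((Λ : ℂ) * (2 * I * t / h - t ^ 2 / l ^ 2)).re =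
      Λ * (-(2 * t.im / h) - (t.re ^ 2 - t.im ^ 2) / l ^ 2) := by
    intro t
    rw [re_ofReal_mul, sub_re, div_ofReal_re]
    have : (l : ℂ) ^ 2 = ((l ^ 2 : ℝ) : ℂ) := by push_cast; rfl
    rw [this, div_ofReal_re]
    simp [sq, neg_div]
  have hEn : ∀ t, ‖E t‖ = Real.exp (Λ * (-(2 * t.im / h) - (t.re ^ 2 - t.im ^ 2) / l ^ 2)) := by
    intro t; rw [hE, norm_exp, hre]
  have hU : Bornology.IsBounded (openUpperRect l h) :=
    isCompact_upperRect.isBounded.subset openUpperRect_subset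
  have hcl := closure_openUpperRect hl0 hh
  have hdE : Differentiable ℂ E := by
    intro t
    simp only [hE]
    fun_prop
  have hdc : DiffContOnCl ℂ (fun t => f t * E t) (openUpperRect l h) := by
    refine ⟨hd.mul hdE.differentiableOn, ?_⟩
    rw [hcl]
    exact hc.mul hdE.continuous.continuousOn
  have hfr : ∀ t ∈ frontier (openUpperRect l h), ‖f t * E t‖ ≤ m := by
    intro t ht
    rw [isOpen_openUpperRect.frontier_eq, hcl] at ht
    obtain ⟨htc, hto⟩ := ht
    have hx : t.re ^ 2 ≤ l ^ 2 := by rw [← sq_abs t.re]; gcongr; exact htc.1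
    have hy0 := htc.2.1
    have hy1 := htc.2.2
    rw [norm_mul, hEn]
    by_cases hy : t.im = 0
    · refine (mul_le_of_le_one_right (norm_nonneg _) ?_).trans (hb t htc hy)
      rw [Real.exp_le_one_iff, hy]
      refine mul_nonpos_of_nonneg_of_nonpos hΛ0 ?_
      have : 0 ≤ t.re ^ 2 / l ^ 2 := by positivity
      simpa using this
    · have hy' : 0 < t.im := lt_of_le_of_ne hy0 (Ne.symm hy)
      have key : -(2 * t.im / h) - (t.re ^ 2 - t.im ^ 2) / l ^ 2 ≤ -1 := by
        have hq : t.im ^ 2 / l ^ 2 ≤ t.im / h := by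
          rw [div_le_div_iff₀ (by positivity) hh]
          have : t.im * h ≤ l ^ 2 := by nlinarith
          nlinarith
        have hq1 : t.im / h ≤ 1 := by rwa [div_le_one hh]
        have e2 : 2 * t.im / h = t.im / h + t.im / h := by ring
        rw [sub_div, e2]
        by_cases hx' : |t.re| < l
        · have hyh : t.im = h := by
            by_contra hne
            exact hto ⟨hx', hy', lt_of_le_of_ne hy1 hne⟩
          have : t.im / h = 1 := by rw [hyh, div_self hh.ne']
          have : 0 ≤ t.re ^ 2 / l ^ 2 := by positivity
          linarith
        · have hxl : |t.re| = l := le_antisymm htc.1 (not_lt.1 hx')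
          have : t.re ^ 2 / l ^ 2 = 1 := by
            rw [← sq_abs t.re, hxl, div_self (by positivity)]
          have : 0 ≤ t.im / h := by positivity
          linarith
      calc ‖f t‖ * Real.exp (Λ * (-(2 * t.im / h) - (t.re ^ 2 - t.im ^ 2) / l ^ 2))
          ≤ M * Real.exp (Λ * (-1)) := by
            gcongr
            · exact hm.le.trans hmM
            · exact hM t htc
        _ = m := by
            rw [mul_neg_one, Real.exp_neg, hexp]
            have : M ≠ 0 := (hm.trans_le hmM).ne'
            field_simp
  have hzU : z ∈ closure (openUpperRect l h) := by
    rw [hcl]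
    exact ⟨hz.1.trans (by linarith), hz.2.1, hz.2.2.trans (by linarith)⟩
  have hmain := Complex.norm_le_of_forall_mem_frontier_norm_le hU hdc hfr hzU
  rw [norm_mul, hEn] at hmain
  have key : -(1 / 2) ≤ -(2 * z.im / h) - (z.re ^ 2 - z.im ^ 2) / l ^ 2 := by
    have h1 : z.im / h ≤ 1 / 8 := by rw [div_le_iff₀ hh]; linarith [hz.2.2]
    have h2 : z.re ^ 2 / l ^ 2 ≤ 1 / 4 := by
      rw [div_le_iff₀ (by positivity), ← sq_abs z.re]
      have := hz.1
      nlinarith [abs_nonneg z.re]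
    have h3 : 0 ≤ z.im ^ 2 / l ^ 2 := by positivity
    have e2 : 2 * z.im / h = z.im / h + z.im / h := by ring
    rw [sub_div, e2]
    linarith
  have h5 : ‖f z‖ * Real.exp (Λ * (-(1 / 2))) ≤ m := by
    refine le_trans ?_ hmain
    gcongr
  have h6 : Real.exp (Λ * (-(1 / 2))) ^ 2 = m / M := by
    rw [← Real.exp_nat_mul]
    have : ((2 : ℕ) : ℝ) * (Λ * (-(1 / 2))) = -Λ := by push_cast; ring
    rw [this, Real.exp_neg, hexp, inv_div]
  have h7 : (‖f z‖ * Real.exp (Λ * (-(1 / 2)))) ^ 2 ≤ m ^ 2 := by gcongr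
  rw [mul_pow, h6] at h7
  have hM0 : 0 < M := hm.trans_le hmM
  rw [mul_div_assoc', div_le_iff₀ hM0] at h7
  nlinarith

/-- The real-linear map `h ↦ p h + q h̄`. -/
noncomputable def wirt (p q : ℂ) : ℂ →L[ℝ] ℂ :=
  p • (ContinuousLinearMap.id ℝ ℂ) + q • (conjCLE : ℂ →L[ℝ] ℂ)

@[simp] theorem wirt_apply (p q h : ℂ) : wirt p q h = p * h + q * (starRingEnd ℂ) h := by
  simp [wirt]

theorem norm_wirt_le (p q : ℂ) : ‖wirt p q‖ ≤ ‖p‖ + ‖q‖ := by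
  refine ContinuousLinearMap.opNorm_le_bound _ (by positivity) fun h => ?_
  rw [wirt_apply]
  refine (norm_add_le _ _).trans ?_
  rw [norm_mul, norm_mul, norm_conj, add_mul]

theorem wirt_sub (p q p' q' : ℂ) : wirt p q - wirt p' q' = wirt (p - p') (q - q') := by
  ext h; simp; ring

/-- `f` has Wirtinger derivatives `p`, `q` at `t` within `s`. -/
def HasWirt (f : ℂ → ℂ) (p q : ℂ) (s : Set ℂ) (t : ℂ) : Prop := HasFDerivWithinAt f (wirt p q) s t

namespace HasWirt

variable {f g : ℂ → ℂ} {p q p' q' t : ℂ} {s : Set ℂ}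

theorem congr_wirt (h : HasWirt f p q s t) (hp : p = p') (hq : q = q') : HasWirt f p' q' s t :=
  hp ▸ hq ▸ h

theorem continuousWithinAt (h : HasWirt f p q s t) : ContinuousWithinAt f s t :=
  HasFDerivWithinAt.continuousWithinAt h

theorem mul (hf : HasWirt f p q s t) (hg : HasWirt g p' q' s t) :
    HasWirt (fun z => f z * g z) (p * g t + f t * p') (q * g t + f t * q') s t := by
  refine (HasFDerivWithinAt.mul hf hg).congr_fderiv ?_
  ext h; simp; ring

theorem sub_const (hf : HasWirt f p q s t) (c : ℂ) : HasWirt (fun z => f z - c) p q s t :=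
  HasFDerivWithinAt.sub_const c hf

theorem const_mul (hf : HasWirt f p q s t) (c : ℂ) :
    HasWirt (fun z => c * f z) (c * p) (c * q) s t := by
  refine (HasFDerivWithinAt.const_mul hf c).congr_fderiv ?_
  ext h; simp; ring

theorem add (hf : HasWirt f p q s t) (hg : HasWirt g p' q' s t) :
    HasWirt (fun z => f z + g z) (p + p') (q + q') s t := by
  refine (HasFDerivWithinAt.add hf hg).congr_fderiv ?_
  ext h; simp; ring

theorem conj (hf : HasWirt f p q s t) :
    HasWirt (fun z => (starRingEnd ℂ) (f z)) ((starRingEnd ℂ) q) ((starRingEnd ℂ) p) s t := by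
  refine ((conjCLE : ℂ →L[ℝ] ℂ).hasFDerivAt.comp_hasFDerivWithinAt t hf).congr_fderiv ?_
  ext h; simp; ring

theorem of_hasDerivAt (hf : HasDerivAt f p t) : HasWirt f p 0 s t := by
  refine (hf.hasFDerivAt.restrictScalars ℝ).hasFDerivWithinAt.congr_fderiv ?_
  ext h; simp [mul_comm]

theorem comp_hasDerivAt {F : ℂ → ℂ} {F' : ℂ} (hF : HasDerivAt F F' (f t))
    (hf : HasWirt f p q s t) : HasWirt (fun z => F (f z)) (F' * p) (F' * q) s t := by
  refine ((hF.hasFDerivAt.restrictScalars ℝ).comp_hasFDerivWithinAt t hf).congr_fderiv ?_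
  ext h; simp; ring

end HasWirt

/-- The form `h ↦ P h + S h̄` is exact on a convex set when `∂P/∂z̄ = ∂S/∂z`. -/
theorem exists_hasWirt_of_closed {P S p1 p2 s2 : ℂ → ℂ} {T : Set ℂ} (hT : Convex ℝ T)
    (hP : ∀ t ∈ T, HasWirt P (p1 t) (p2 t) T t) (hS : ∀ t ∈ T, HasWirt S (p2 t) (s2 t) T t) :
    ∃ f : ℂ → ℂ, ∀ t ∈ T, HasWirt f (P t) (S t) T t := by
  set i1 : ℂ →L[ℝ] (ℂ →L[ℝ] ℂ) :=
    (ContinuousLinearMap.lsmul ℝ ℂ).flip (ContinuousLinearMap.id ℝ ℂ) with hi1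
  set i2 : ℂ →L[ℝ] (ℂ →L[ℝ] ℂ) :=
    (ContinuousLinearMap.lsmul ℝ ℂ).flip (conjCLE : ℂ →L[ℝ] ℂ) with hi2
  refine hT.exists_forall_hasFDerivWithinAt_of_hasFDerivWithinAt_symmetric
    (ω := fun t => wirt (P t) (S t))
    (dω := fun t => i1.comp (wirt (p1 t) (p2 t)) + i2.comp (wirt (p2 t) (s2 t))) ?_ ?_
  · intro t ht
    exact (i1.hasFDerivAt.comp_hasFDerivWithinAt t (hP t ht)).add
      (i2.hasFDerivAt.comp_hasFDerivWithinAt t (hS t ht))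
  · intro t _ x _ y _
    simp [hi1, hi2]
    ring

theorem integral_ray_eq_sub {P S f : ℂ → ℂ} {T : Set ℂ}
    (hTs : ∀ t ∈ T, ∀ θ ∈ Icc (0 : ℝ) 1, (θ : ℂ) * t ∈ T)
    (hf : ∀ t ∈ T, HasWirt f (P t) (S t) T t) (hP : ContinuousOn P T) (hS : ContinuousOn S T)
    {t : ℂ} (ht : t ∈ T) :
    ∫ θ in (0 : ℝ)..1, (P (θ * t) * t + S (θ * t) * (starRingEnd ℂ) t) = f t - f 0 := by
  have hmaps : MapsTo (fun θ : ℝ => (θ : ℂ) * t) (Icc (0 : ℝ) 1) T := fun θ hθ => hTs t ht θ hθ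
  have hray : ∀ θ : ℝ, HasDerivWithinAt (fun θ : ℝ => (θ : ℂ) * t) t (Icc (0 : ℝ) 1) θ := by
    intro θ
    simpa using ((hasDerivAt_id θ).ofReal_comp.mul_const t).hasDerivWithinAt
  have hcont : ContinuousOn (fun θ : ℝ => f (θ * t)) (Icc (0 : ℝ) 1) := fun θ hθ =>
    ContinuousWithinAt.comp (f := fun θ : ℝ => (θ : ℂ) * t) (g := f)
      (hf _ (hmaps hθ)).continuousWithinAt (hray θ).continuousWithinAt hmaps
  have hd : ∀ θ ∈ Ioo (0 : ℝ) 1, HasDerivAt (fun θ : ℝ => f (θ * t))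
      (P (θ * t) * t + S (θ * t) * (starRingEnd ℂ) t) θ := by
    intro θ hθ
    have := HasFDerivWithinAt.comp_hasDerivWithinAt (f := fun θ : ℝ => (θ : ℂ) * t) θ
        (hf _ (hmaps (Ioo_subset_Icc_self hθ)))
      (hray θ) hmaps
    rw [wirt_apply] at this
    exact this.hasDerivAt (Icc_mem_nhds hθ.1 hθ.2)
  have hint : ContinuousOn (fun θ : ℝ => P (θ * t) * t + S (θ * t) * (starRingEnd ℂ) t)
      (Icc (0 : ℝ) 1) := by
    have hr : ContinuousOn (fun θ : ℝ => (θ : ℂ) * t) (Icc (0 : ℝ) 1) := by fun_prop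
    exact ((hP.comp hr hmaps).mul continuousOn_const).add
        ((hS.comp hr hmaps).mul continuousOn_const)
  rw [intervalIntegral.integral_eq_sub_of_hasDeriv_right_of_le zero_le_one hcont
    (fun θ hθ => (hd θ hθ).hasDerivWithinAt)
    (ContinuousOn.intervalIntegrable (by rwa [uIcc_of_le zero_le_one]))]
  simp

/-- Holomorphy of the diagonal values `∫_{[0,τ]} (P(·,τ) dz + S(·,τ) dz̄)` for a family of exact
forms depending holomorphically on the parameter `τ`, with `S` vanishing on the diagonal. -/
theorem differentiableOn_diagonal_integral {P S : ℂ → ℂ → ℂ} {f : ℂ → ℂ → ℂ} {T U : Set ℂ}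
    (hTs : ∀ t ∈ T, ∀ θ ∈ Icc (0 : ℝ) 1, (θ : ℂ) * t ∈ T) (hU : IsOpen U) (hUT : U ⊆ T)
    (hf : ∀ τ ∈ T, ∀ t ∈ T, HasWirt (f τ) (P t τ) (S t τ) T t)
    (hP : ContinuousOn (Function.uncurry P) (T ×ˢ T))
    (hS : ContinuousOn (Function.uncurry S) (T ×ˢ T))
    (hPd : ∀ t ∈ T, DifferentiableOn ℂ (P t) U) (hSd : ∀ t ∈ T, DifferentiableOn ℂ (S t) U)
    (hdiag : ∀ t ∈ U, S t t = 0) :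
    DifferentiableOn ℂ (fun τ => ∫ θ in (0 : ℝ)..1,
      (P (θ * τ) τ * τ + S (θ * τ) τ * (starRingEnd ℂ) τ)) U := by
  have hPτ : ∀ τ ∈ T, ContinuousOn (fun t => P t τ) T := fun τ hτ =>
    hP.comp (f := fun t => (t, τ)) (by fun_prop) fun t ht => ⟨ht, hτ⟩
  have hSτ : ∀ τ ∈ T, ContinuousOn (fun t => S t τ) T := fun τ hτ =>
    hS.comp (f := fun t => (t, τ)) (by fun_prop) fun t ht => ⟨ht, hτ⟩
  intro t₀ ht₀
  refine DifferentiableAt.differentiableWithinAt ?_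
  have hfrozen : DifferentiableOn ℂ (fun τ => ∫ θ in (0 : ℝ)..1,
      (P (θ * t₀) τ * t₀ + S (θ * t₀) τ * (starRingEnd ℂ) t₀)) U := by
    refine differentiableOn_intervalIntegral_param hU ?_ ?_
    · have hm : ContinuousOn (fun p : ℂ × ℝ => ((p.2 : ℂ) * t₀, p.1)) (U ×ˢ Icc (0 : ℝ) 1) := by
        fun_prop
      have hmt : MapsTo (fun p : ℂ × ℝ => ((p.2 : ℂ) * t₀, p.1)) (U ×ˢ Icc (0 : ℝ) 1) (T ×ˢ T) :=
        fun p hp => ⟨hTs _ (hUT ht₀) _ hp.2, hUT hp.1⟩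
      exact ((hP.comp hm hmt).mul continuousOn_const).add ((hS.comp hm hmt).mul continuousOn_const)
    · intro θ hθ
      have := hTs _ (hUT ht₀) θ hθ
      exact ((hPd _ this).mul_const _).add ((hSd _ this).mul_const _)
  have hsplit : (fun τ => ∫ θ in (0 : ℝ)..1,
      (P (θ * τ) τ * τ + S (θ * τ) τ * (starRingEnd ℂ) τ)) =ᶠ[𝓝 t₀] fun τ =>
      (∫ θ in (0 : ℝ)..1, (P (θ * t₀) τ * t₀ + S (θ * t₀) τ * (starRingEnd ℂ) t₀)) +
      (f τ τ - f τ t₀) := by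
    filter_upwards [hU.mem_nhds ht₀] with τ hτ
    have hτ' := hUT hτ
    rw [integral_ray_eq_sub (P := fun t => P t τ) (S := fun t => S t τ) hTs (hf τ hτ')
        (hPτ τ hτ') (hSτ τ hτ') hτ',
      integral_ray_eq_sub (P := fun t => P t τ) (S := fun t => S t τ) hTs (hf τ hτ')
        (hPτ τ hτ') (hSτ τ hτ') (hUT ht₀)]
    ring
  have hdiff : HasDerivAt (fun τ => f τ τ - f τ t₀) (P t₀ t₀) t₀ := by
    rw [hasDerivAt_iff_isLittleO, Asymptotics.isLittleO_iff]
    intro ε hε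
    have hTU : T ×ˢ T ∈ 𝓝 (t₀, t₀) :=
      mem_of_superset ((hU.prod hU).mem_nhds ⟨ht₀, ht₀⟩) (prod_mono hUT hUT)
    have hPc := (hP.continuousAt hTU).sub (continuousAt_const (y := P t₀ t₀))
    have hSc := hS.continuousAt hTU
    have hsum : ContinuousAt (fun p : ℂ × ℂ =>
        ‖Function.uncurry P p - P t₀ t₀‖ + ‖Function.uncurry S p‖) (t₀, t₀) := hPc.norm.add hSc.norm
    have hlt : ∀ᶠ p in 𝓝 (t₀, t₀),
        ‖Function.uncurry P p - P t₀ t₀‖ + ‖Function.uncurry S p‖ < ε := by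
      refine hsum.eventually_lt continuousAt_const ?_
      simpa [Function.uncurry, hdiag t₀ ht₀] using hε
    obtain ⟨δ, hδ, hball⟩ := Metric.eventually_nhds_iff_ball.1
      (hlt.and ((hU.prod hU).mem_nhds ⟨ht₀, ht₀⟩))
    filter_upwards [Metric.ball_mem_nhds t₀ hδ] with τ hτ
    have hx : ∀ x ∈ Metric.ball t₀ δ, (x, τ) ∈ Metric.ball (t₀, t₀) δ := by
      intro x hx
      rw [← ball_prod_same]
      exact ⟨hx, hτ⟩
    have hsubT : Metric.ball t₀ δ ⊆ T := fun x hx' => hUT (hball _ (hx x hx')).2.1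
    have hτT : τ ∈ T := hsubT hτ
    have hmv := Convex.norm_image_sub_le_of_norm_hasFDerivWithin_le' (𝕜 := ℝ) (C := ε)
      (f := f τ) (f' := fun x => wirt (P x τ) (S x τ)) (φ := wirt (P t₀ t₀) 0)
      (s := Metric.ball t₀ δ) (x := t₀) (y := τ)
      (fun x hx' => HasFDerivWithinAt.mono (hf τ hτT x (hsubT hx')) hsubT)
      (fun x hx' => by
        rw [wirt_sub, sub_zero]
        exact (norm_wirt_le _ _).trans (hball _ (hx x hx')).1.le)
      (convex_ball _ _) (Metric.mem_ball_self hδ) hτ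
    simpa [mul_comm] using hmv
  exact ((hfrozen.differentiableAt (hU.mem_nhds ht₀)).add
      hdiff.differentiableAt).congr_of_eventuallyEq
    hsplit

/-- A holomorphic coordinate `Z` on a symmetric rectangle, with quantitative bounds on its first two
derivatives `Z1`, `Z2`. -/
structure CollarMap (Z Z1 Z2 : ℂ → ℂ) (l h C : ℝ) : Prop where
  h_pos : 0 < h
  h_le : h ≤ l
  one_le : 1 ≤ C
  size_le : l + h ≤ C
  inv_le : h⁻¹ ≤ C
  deriv1 : ∀ t ∈ symmRect l h, HasDerivAt Z (Z1 t) t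
  deriv2 : ∀ t ∈ symmRect l h, HasDerivAt Z1 (Z2 t) t
  norm_le1 : ∀ t ∈ symmRect l h, ‖Z1 t‖ ≤ C
  le_norm1 : ∀ t ∈ symmRect l h, C⁻¹ ≤ ‖Z1 t‖
  norm_le2 : ∀ t ∈ symmRect l h, ‖Z2 t‖ ≤ C

/-- A real solution `v` of the Helmholtz equation in the coordinate of a `CollarMap`, with Neumann
condition on the real axis, together with `A = ∂v` and `B = ∂A`. -/
structure WaveData (Z1 v A B : ℂ → ℂ) (lam l h N : ℝ) : Prop where
  lam_pos : 0 < lam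
  im_eq : ∀ t ∈ upperRect l h, (v t).im = 0
  wirt_v : ∀ t ∈ upperRect l h, HasWirt v (A t) ((starRingEnd ℂ) (A t)) (upperRect l h) t
  wirt_A : ∀ t ∈ upperRect l h,
    HasWirt A (B t) (-(lam ^ 2 / 4) * (Z1 t * (starRingEnd ℂ) (Z1 t)) * v t) (upperRect l h) t
  neumann : ∀ t ∈ upperRect l h, t.im = 0 → (A t).im = 0
  norm_v : ∀ t ∈ upperRect l h, ‖v t‖ ≤ N
  norm_A : ∀ t ∈ upperRect l h, ‖A t‖ ≤ N

/-- The argument of the Riemann function. -/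
noncomputable def riemannArg (Z : ℂ → ℂ) (lam : ℝ) (c : ℂ → ℂ) (t τ : ℂ) : ℂ :=
  lam ^ 2 / 4 * ((Z t - Z τ) * ((starRingEnd ℂ) (Z t) - c τ))

/-- The `dt` coefficient of the closed form of Vekua's representation. -/
noncomputable def vekuaP (Z A : ℂ → ℂ) (lam : ℝ) (c : ℂ → ℂ) (t τ : ℂ) : ℂ :=
  besselSeries 0 (riemannArg Z lam c t τ) * A t

/-- The `dt̄` coefficient of the closed form of Vekua's representation. -/
noncomputable def vekuaS (Z Z1 v : ℂ → ℂ) (lam : ℝ) (c : ℂ → ℂ) (t τ : ℂ) : ℂ :=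
  -(lam ^ 2 / 4) * (v t * (Z t - Z τ) * (starRingEnd ℂ) (Z1 t)) *
    besselSeries 1 (riemannArg Z lam c t τ)

/-- Vekua's holomorphic function associated with `v`. -/
noncomputable def vekuaPhi (Z Z1 v A : ℂ → ℂ) (lam : ℝ) (c : ℂ → ℂ) (τ : ℂ) : ℂ :=
  2 * (∫ θ in (0 : ℝ)..1, (vekuaP Z A lam c (θ * τ) τ * τ +
    vekuaS Z Z1 v lam c (θ * τ) τ * (starRingEnd ℂ) τ)) +
  v 0 * besselSeries 0 (riemannArg Z lam c 0 τ)

/-- Admissible antiholomorphic parameters. -/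
structure VekuaParam (Z c : ℂ → ℂ) (l h C : ℝ) : Prop where
  cont : ContinuousOn c (upperRect l h)
  diff : DifferentiableOn ℂ c (openUpperRect l h)
  bound : ∀ t ∈ upperRect l h, ∀ τ ∈ upperRect l h, ‖(starRingEnd ℂ) (Z t) - c τ‖ ≤ 2 * C ^ 2

section

variable {Z Z1 Z2 v A B c : ℂ → ℂ} {lam l h C N : ℝ}

namespace CollarMap

theorem C_pos (hZ : CollarMap Z Z1 Z2 l h C) : 0 < C := zero_lt_one.trans_le hZ.one_le

theorem l_pos (hZ : CollarMap Z Z1 Z2 l h C) : 0 < l := hZ.h_pos.trans_le hZ.h_le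

theorem zero_mem (hZ : CollarMap Z Z1 Z2 l h C) : (0 : ℂ) ∈ upperRect l h := by
  simp [upperRect, hZ.l_pos.le, hZ.h_pos.le]

theorem norm_le (hZ : CollarMap Z Z1 Z2 l h C) {t : ℂ} (ht : t ∈ symmRect l h) : ‖t‖ ≤ C :=
  (norm_le_of_mem_symmRect ht).trans hZ.size_le

theorem norm_sub_le (hZ : CollarMap Z Z1 Z2 l h C) {t τ : ℂ} (ht : t ∈ symmRect l h)
    (hτ : τ ∈ symmRect l h) : ‖Z t - Z τ‖ ≤ C * ‖t - τ‖ :=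
  convex_symmRect.norm_image_sub_le_of_norm_hasDerivWithin_le
    (fun x hx => (hZ.deriv1 x hx).hasDerivWithinAt) hZ.norm_le1 hτ ht

theorem norm_sub_le' (hZ : CollarMap Z Z1 Z2 l h C) {t τ : ℂ} (ht : t ∈ symmRect l h)
    (hτ : τ ∈ symmRect l h) : ‖Z t - Z τ‖ ≤ 2 * C ^ 2 := by
  refine (hZ.norm_sub_le ht hτ).trans ?_
  have := (_root_.norm_sub_le t τ).trans (add_le_add (hZ.norm_le ht) (hZ.norm_le hτ))
  nlinarith [hZ.C_pos]

theorem continuousOn (hZ : CollarMap Z Z1 Z2 l h C) : ContinuousOn Z (symmRect l h) :=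
  fun t ht => (hZ.deriv1 t ht).continuousAt.continuousWithinAt

theorem continuousOn1 (hZ : CollarMap Z Z1 Z2 l h C) : ContinuousOn Z1 (symmRect l h) :=
  fun t ht => (hZ.deriv2 t ht).continuousAt.continuousWithinAt

theorem differentiableOn (hZ : CollarMap Z Z1 Z2 l h C) : DifferentiableOn ℂ Z (symmRect l h) :=
  fun t ht => (hZ.deriv1 t ht).differentiableAt.differentiableWithinAt

theorem differentiableOn1 (hZ : CollarMap Z Z1 Z2 l h C) : DifferentiableOn ℂ Z1 (symmRect l h) :=
  fun t ht => (hZ.deriv2 t ht).differentiableAt.differentiableWithinAt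

end CollarMap

theorem WaveData.continuousOn_v (hv : WaveData Z1 v A B lam l h N) :
    ContinuousOn v (upperRect l h) := fun t ht => (hv.wirt_v t ht).continuousWithinAt

theorem WaveData.continuousOn_A (hv : WaveData Z1 v A B lam l h N) :
    ContinuousOn A (upperRect l h) := fun t ht => (hv.wirt_A t ht).continuousWithinAt

theorem CollarMap.hasWirt_riemannArg (hZ : CollarMap Z Z1 Z2 l h C) (c : ℂ → ℂ) (lam : ℝ) (τ : ℂ)
    {t : ℂ} (ht : t ∈ upperRect l h) :
    HasWirt (fun t => riemannArg Z lam c t τ)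
      (lam ^ 2 / 4 * (Z1 t * ((starRingEnd ℂ) (Z t) - c τ)))
      (lam ^ 2 / 4 * ((Z t - Z τ) * (starRingEnd ℂ) (Z1 t))) (upperRect l h) t := by
  have h1 : HasWirt Z (Z1 t) 0 (upperRect l h) t :=
    HasWirt.of_hasDerivAt (hZ.deriv1 t (upperRect_subset ht))
  refine (((h1.sub_const (Z τ)).mul (h1.conj.sub_const (c τ))).const_mul (lam ^ 2 / 4)).congr_wirt
    ?_ ?_ <;> simp

theorem continuousOn_riemannArg (hZ : CollarMap Z Z1 Z2 l h C) (hc : VekuaParam Z c l h C) :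
    ContinuousOn (Function.uncurry (riemannArg Z lam c)) (upperRect l h ×ˢ upperRect l h) := by
  have hZc := hZ.continuousOn.mono upperRect_subset
  have h1 : ContinuousOn (fun p : ℂ × ℂ => Z p.1) (upperRect l h ×ˢ upperRect l h) :=
    hZc.comp continuousOn_fst fun p hp => hp.1
  have h2 : ContinuousOn (fun p : ℂ × ℂ => Z p.2) (upperRect l h ×ˢ upperRect l h) :=
    hZc.comp continuousOn_snd fun p hp => hp.2
  have h3 : ContinuousOn (fun p : ℂ × ℂ => c p.2) (upperRect l h ×ˢ upperRect l h) :=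
    hc.cont.comp continuousOn_snd fun p hp => hp.2
  exact continuousOn_const.mul ((h1.sub h2).mul ((continuous_conj.comp_continuousOn h1).sub h3))

theorem continuousOn_vekuaP (hZ : CollarMap Z Z1 Z2 l h C) (hv : WaveData Z1 v A B lam l h N)
    (hc : VekuaParam Z c l h C) :
    ContinuousOn (Function.uncurry (vekuaP Z A lam c)) (upperRect l h ×ˢ upperRect l h) :=
  ((continuous_besselSeries 0).comp_continuousOn (continuousOn_riemannArg hZ hc)).mul
    (hv.continuousOn_A.comp continuousOn_fst fun _ hp => hp.1)

theorem continuousOn_vekuaS (hZ : CollarMap Z Z1 Z2 l h C) (hv : WaveData Z1 v A B lam l h N)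
    (hc : VekuaParam Z c l h C) :
    ContinuousOn (Function.uncurry (vekuaS Z Z1 v lam c)) (upperRect l h ×ˢ upperRect l h) := by
  have hZc := hZ.continuousOn.mono upperRect_subset
  have h1 : ContinuousOn (fun p : ℂ × ℂ => Z p.1) (upperRect l h ×ˢ upperRect l h) :=
    hZc.comp continuousOn_fst fun p hp => hp.1
  have h2 : ContinuousOn (fun p : ℂ × ℂ => Z p.2) (upperRect l h ×ˢ upperRect l h) :=
    hZc.comp continuousOn_snd fun p hp => hp.2
  have h3 : ContinuousOn (fun p : ℂ × ℂ => Z1 p.1) (upperRect l h ×ˢ upperRect l h) :=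
    (hZ.continuousOn1.mono upperRect_subset).comp continuousOn_fst fun p hp => hp.1
  have h4 : ContinuousOn (fun p : ℂ × ℂ => v p.1) (upperRect l h ×ˢ upperRect l h) :=
    hv.continuousOn_v.comp continuousOn_fst fun _ hp => hp.1
  exact (continuousOn_const.mul ((h4.mul (h1.sub h2)).mul
      (continuous_conj.comp_continuousOn h3))).mul
    ((continuous_besselSeries 1).comp_continuousOn (continuousOn_riemannArg hZ hc))

theorem exists_vekua_potential (hZ : CollarMap Z Z1 Z2 l h C) (hv : WaveData Z1 v A B lam l h N)
    (τ : ℂ) :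
    ∃ f : ℂ → ℂ, ∀ t ∈ upperRect l h,
      HasWirt f (vekuaP Z A lam c t τ) (vekuaS Z Z1 v lam c t τ) (upperRect l h) t := by
  refine exists_hasWirt_of_closed (p1 := fun t =>
      -besselSeries 1 (riemannArg Z lam c t τ) *
        (lam ^ 2 / 4 * (Z1 t * ((starRingEnd ℂ) (Z t) - c τ))) * A t +
      besselSeries 0 (riemannArg Z lam c t τ) * B t)
    (p2 := fun t => -besselSeries 1 (riemannArg Z lam c t τ) *
        (lam ^ 2 / 4 * ((Z t - Z τ) * (starRingEnd ℂ) (Z1 t))) * A t +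
      besselSeries 0 (riemannArg Z lam c t τ) *
        (-(lam ^ 2 / 4) * (Z1 t * (starRingEnd ℂ) (Z1 t)) * v t))
    (s2 := fun t => -(lam ^ 2 / 4) *
        (((starRingEnd ℂ) (A t) * (Z t - Z τ)) * (starRingEnd ℂ) (Z1 t) +
        v t * (Z t - Z τ) * (starRingEnd ℂ) (Z2 t)) * besselSeries 1 (riemannArg Z lam c t τ) +
      -(lam ^ 2 / 4) * (v t * (Z t - Z τ) * (starRingEnd ℂ) (Z1 t)) *
        (-besselSeries 2 (riemannArg Z lam c t τ) *
        (lam ^ 2 / 4 * ((Z t - Z τ) * (starRingEnd ℂ) (Z1 t))))) convex_upperRect ?_ ?_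
  · intro t ht
    have hX := hZ.hasWirt_riemannArg c lam τ ht
    exact (HasWirt.comp_hasDerivAt (hasDerivAt_besselSeries 0 _) hX).mul (hv.wirt_A t ht)
  · intro t ht
    have hX := hZ.hasWirt_riemannArg c lam τ ht
    have h1 : HasWirt Z (Z1 t) 0 (upperRect l h) t :=
      HasWirt.of_hasDerivAt (hZ.deriv1 t (upperRect_subset ht))
    have h2 : HasWirt Z1 (Z2 t) 0 (upperRect l h) t :=
      HasWirt.of_hasDerivAt (hZ.deriv2 t (upperRect_subset ht))
    refine (((((hv.wirt_v t ht).mul (h1.sub_const (Z τ))).mul h2.conj).const_mul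
      (-(lam ^ 2 / 4))).mul
      (HasWirt.comp_hasDerivAt (hasDerivAt_besselSeries 1 _) hX)).congr_wirt ?_ ?_
    · rw [besselSeries_zero_eq]
      simp only [riemannArg, map_zero]
      ring
    · simp only [mul_zero, add_zero]

theorem differentiableOn_riemannArg (hZ : CollarMap Z Z1 Z2 l h C) (hc : VekuaParam Z c l h C)
    (t : ℂ) : DifferentiableOn ℂ (riemannArg Z lam c t) (openUpperRect l h) := by
  have hZd := hZ.differentiableOn.mono (openUpperRect_subset.trans upperRect_subset)
  exact (((differentiableOn_const _).sub hZd).mul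
      ((differentiableOn_const _).sub hc.diff)).const_mul _

theorem continuousOn_vekuaPhi (hZ : CollarMap Z Z1 Z2 l h C) (hv : WaveData Z1 v A B lam l h N)
    (hc : VekuaParam Z c l h C) : ContinuousOn (vekuaPhi Z Z1 v A lam c) (upperRect l h) := by
  have hm : ContinuousOn (fun p : ℂ × ℝ => ((p.2 : ℂ) * p.1, p.1))
      (upperRect l h ×ˢ Icc (0 : ℝ) 1) := by
    fun_prop
  have hmt : MapsTo (fun p : ℂ × ℝ => ((p.2 : ℂ) * p.1, p.1)) (upperRect l h ×ˢ Icc (0 : ℝ) 1)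
      (upperRect l h ×ˢ upperRect l h) :=
    fun p hp => ⟨ofReal_mul_mem_upperRect hp.1 hp.2, hp.1⟩
  have h0 : ContinuousOn (fun τ : ℂ => ((0 : ℂ), τ)) (upperRect l h) := by fun_prop
  have h1 : ContinuousOn (fun τ => riemannArg Z lam c 0 τ) (upperRect l h) :=
    ContinuousOn.comp (g := Function.uncurry (riemannArg Z lam c)) (f := fun τ : ℂ => ((0 : ℂ), τ))
      (continuousOn_riemannArg hZ hc) h0 fun τ hτ => mk_mem_prod hZ.zero_mem hτ
  have h2 : ContinuousOn (fun p : ℂ × ℝ => p.1) (upperRect l h ×ˢ Icc (0 : ℝ) 1) := continuousOn_fst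
  have h3 : ContinuousOn (fun p : ℂ × ℝ => vekuaP Z A lam c (p.2 * p.1) p.1)
      (upperRect l h ×ˢ Icc (0 : ℝ) 1) :=
    ContinuousOn.comp (g := Function.uncurry (vekuaP Z A lam c))
      (f := fun p : ℂ × ℝ => ((p.2 : ℂ) * p.1, p.1)) (continuousOn_vekuaP hZ hv hc) hm hmt
  have h4 : ContinuousOn (fun p : ℂ × ℝ => vekuaS Z Z1 v lam c (p.2 * p.1) p.1)
      (upperRect l h ×ˢ Icc (0 : ℝ) 1) :=
    ContinuousOn.comp (g := Function.uncurry (vekuaS Z Z1 v lam c))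
      (f := fun p : ℂ × ℝ => ((p.2 : ℂ) * p.1, p.1)) (continuousOn_vekuaS hZ hv hc) hm hmt
  have h5 := continuousOn_intervalIntegral_param
    (F := fun τ θ => vekuaP Z A lam c (θ * τ) τ * τ +
      vekuaS Z Z1 v lam c (θ * τ) τ * (starRingEnd ℂ) τ)
    ((h3.mul h2).add (h4.mul (continuous_conj.comp_continuousOn h2)))
  have h6 : ContinuousOn (fun τ => besselSeries 0 (riemannArg Z lam c 0 τ)) (upperRect l h) :=
    (continuous_besselSeries 0).comp_continuousOn h1
  exact (continuousOn_const.mul h5).add (continuousOn_const.mul h6)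

theorem differentiableOn_vekuaPhi (hZ : CollarMap Z Z1 Z2 l h C)
    (hv : WaveData Z1 v A B lam l h N) (hc : VekuaParam Z c l h C) :
    DifferentiableOn ℂ (vekuaPhi Z Z1 v A lam c) (openUpperRect l h) := by
  choose f hf using fun τ => exists_vekua_potential (c := c) hZ hv τ
  have hZd := hZ.differentiableOn.mono (openUpperRect_subset.trans upperRect_subset)
  refine DifferentiableOn.add (DifferentiableOn.const_mul ?_ _) (DifferentiableOn.const_mul
    ((differentiable_besselSeries 0).comp_differentiableOn (differentiableOn_riemannArg hZ hc 0)) _)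
  refine differentiableOn_diagonal_integral (f := f)
    (fun t ht θ hθ => ofReal_mul_mem_upperRect ht hθ) isOpen_openUpperRect openUpperRect_subset
    (fun τ _ t ht => hf τ t ht) (continuousOn_vekuaP hZ hv hc)
    (continuousOn_vekuaS hZ hv hc) ?_ ?_ ?_
  · intro t _
    exact ((differentiable_besselSeries 0).comp_differentiableOn
      (differentiableOn_riemannArg hZ hc t)).mul_const _
  · intro t _
    exact (((((differentiableOn_const _).sub hZd).const_mul (v t)).mul_const _).const_mul _).mul
      ((differentiable_besselSeries 1).comp_differentiableOn (differentiableOn_riemannArg hZ hc t))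
  · intro t _
    simp [vekuaS]

end

/-- The reflected function `t ↦ conj (Z (conj t))`. -/
noncomputable def conjFun (Z : ℂ → ℂ) (t : ℂ) : ℂ := (starRingEnd ℂ) (Z ((starRingEnd ℂ) t))

/-- The kernel of the Volterra equation satisfied by the boundary values. -/
noncomputable def vekuaKernel (Z Z1 : ℂ → ℂ) (lam : ℝ) (σ t w : ℂ) : ℂ :=
  -(lam ^ 2 / 4) * ((Z σ - Z t) * conjFun Z1 σ - (conjFun Z σ - w) * Z1 σ) *
    besselSeries 1 (lam ^ 2 / 4 * ((Z σ - Z t) * (conjFun Z σ - w)))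

section

variable {Z Z1 Z2 v A B c : ℂ → ℂ} {lam l h C N : ℝ}

theorem conjFun_apply_of_im_eq_zero {t : ℂ} (ht : t.im = 0) :
    conjFun Z t = (starRingEnd ℂ) (Z t) := by
  rw [conjFun, conj_eq_iff_im.2 ht]

theorem CollarMap.hasDerivAt_conjFun (hZ : CollarMap Z Z1 Z2 l h C) {t : ℂ}
    (ht : t ∈ symmRect l h) : HasDerivAt (conjFun Z) (conjFun Z1 t) t := by
  have h1 := (hZ.deriv1 _ (conj_mem_symmRect ht)).conj_conj
  rw [conj_conj] at h1
  exact h1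

theorem CollarMap.hasDerivAt_conjFun1 (hZ : CollarMap Z Z1 Z2 l h C) {t : ℂ}
    (ht : t ∈ symmRect l h) : HasDerivAt (conjFun Z1) (conjFun Z2 t) t := by
  have h1 := (hZ.deriv2 _ (conj_mem_symmRect ht)).conj_conj
  rw [conj_conj] at h1
  exact h1

theorem CollarMap.continuousOn_vekuaKernel (hZ : CollarMap Z Z1 Z2 l h C) (lam : ℝ) {X : Type*}
    [TopologicalSpace X] {s : Set X} {a b d : X → ℂ} (ha : ContinuousOn a s) (hb : ContinuousOn b s)
    (hd : ContinuousOn d s) (has : MapsTo a s (symmRect l h)) (hbs : MapsTo b s (symmRect l h)) :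
    ContinuousOn (fun x => vekuaKernel Z Z1 lam (a x) (b x) (d x)) s := by
  have h1 : ContinuousOn (fun x => Z (a x)) s := hZ.continuousOn.comp ha has
  have h2 : ContinuousOn (fun x => Z (b x)) s := hZ.continuousOn.comp hb hbs
  have h3 : ContinuousOn (fun x => Z1 (a x)) s := hZ.continuousOn1.comp ha has
  have h4 : ContinuousOn (fun x => conjFun Z (a x)) s := ContinuousOn.comp (g := conjFun Z)
    (fun t ht => (hZ.hasDerivAt_conjFun ht).continuousAt.continuousWithinAt) ha has
  have h5 : ContinuousOn (fun x => conjFun Z1 (a x)) s := ContinuousOn.comp (g := conjFun Z1)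
    (fun t ht => (hZ.hasDerivAt_conjFun1 ht).continuousAt.continuousWithinAt) ha has
  have h6 : ContinuousOn (fun x => (Z (a x) - Z (b x)) * (conjFun Z (a x) - d x)) s :=
    (h1.sub h2).mul (h4.sub hd)
  exact (continuousOn_const.mul (((h1.sub h2).mul h5).sub ((h4.sub hd).mul h3))).mul
    ((continuous_besselSeries 1).comp_continuousOn (continuousOn_const.mul h6))

theorem CollarMap.differentiableOn_vekuaKernel (hZ : CollarMap Z Z1 Z2 l h C) (lam : ℝ) {s : Set ℂ}
    {a b d : ℂ → ℂ} (ha : DifferentiableOn ℂ a s) (hb : DifferentiableOn ℂ b s)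
    (hd : DifferentiableOn ℂ d s) (has : MapsTo a s (symmRect l h))
    (hbs : MapsTo b s (symmRect l h)) :
    DifferentiableOn ℂ (fun x => vekuaKernel Z Z1 lam (a x) (b x) (d x)) s := by
  have h1 : DifferentiableOn ℂ (fun x => Z (a x)) s := hZ.differentiableOn.comp ha has
  have h2 : DifferentiableOn ℂ (fun x => Z (b x)) s := hZ.differentiableOn.comp hb hbs
  have h3 : DifferentiableOn ℂ (fun x => Z1 (a x)) s := hZ.differentiableOn1.comp ha has
  have h4 : DifferentiableOn ℂ (fun x => conjFun Z (a x)) s := DifferentiableOn.comp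
      (g := conjFun Z)
    (fun t ht => (hZ.hasDerivAt_conjFun ht).differentiableAt.differentiableWithinAt) ha has
  have h5 : DifferentiableOn ℂ (fun x => conjFun Z1 (a x)) s :=
    DifferentiableOn.comp (g := conjFun Z1)
    (fun t ht => (hZ.hasDerivAt_conjFun1 ht).differentiableAt.differentiableWithinAt) ha has
  have h6 : DifferentiableOn ℂ (fun x => (Z (a x) - Z (b x)) * (conjFun Z (a x) - d x)) s :=
    (h1.sub h2).mul (h4.sub hd)
  exact ((((h1.sub h2).mul h5).sub ((h4.sub hd).mul h3)).const_mul _).mul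
    ((differentiable_besselSeries 1).comp_differentiableOn (h6.const_mul _))

theorem CollarMap.vekuaParam_conjFun (hZ : CollarMap Z Z1 Z2 l h C) :
    VekuaParam Z (conjFun Z) l h C where
  cont t ht := (hZ.hasDerivAt_conjFun (upperRect_subset ht)).continuousAt.continuousWithinAt
  diff t ht := (hZ.hasDerivAt_conjFun
    (upperRect_subset (openUpperRect_subset ht))).differentiableAt.differentiableWithinAt
  bound t ht τ hτ := by
    rw [conjFun, ← map_sub, norm_conj]
    exact hZ.norm_sub_le' (upperRect_subset ht) (conj_mem_symmRect (upperRect_subset hτ))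

theorem CollarMap.vekuaParam_const (hZ : CollarMap Z Z1 Z2 l h C) {t₀ : ℂ}
    (ht₀ : t₀ ∈ symmRect l h) : VekuaParam Z (fun _ => (starRingEnd ℂ) (Z t₀)) l h C where
  cont := continuousOn_const
  diff := differentiableOn_const _
  bound t ht τ hτ := by
    rw [← map_sub, norm_conj]
    exact hZ.norm_sub_le' (upperRect_subset ht) ht₀

theorem hasWirt_riemann_mul (hZ : CollarMap Z Z1 Z2 l h C) (hv : WaveData Z1 v A B lam l h N)
    (c : ℂ → ℂ) (τ : ℂ) {t : ℂ} (ht : t ∈ upperRect l h) :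
    HasWirt (fun t => besselSeries 0 (riemannArg Z lam c t τ) * v t)
      (-besselSeries 1 (riemannArg Z lam c t τ) *
        (lam ^ 2 / 4 * (Z1 t * ((starRingEnd ℂ) (Z t) - c τ))) * v t + vekuaP Z A lam c t τ)
      (vekuaS Z Z1 v lam c t τ +
        besselSeries 0 (riemannArg Z lam c t τ) * (starRingEnd ℂ) (A t)) (upperRect l h) t := by
  refine ((HasWirt.comp_hasDerivAt (hasDerivAt_besselSeries 0 _)
    (hZ.hasWirt_riemannArg c lam τ ht)).mul (hv.wirt_v t ht)).congr_wirt rfl ?_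
  simp only [vekuaS]
  ring

theorem integral_riemann_mul (hZ : CollarMap Z Z1 Z2 l h C) (hv : WaveData Z1 v A B lam l h N)
    (hc : VekuaParam Z c l h C) {τ : ℂ} (hτ : τ ∈ upperRect l h) :
    IntervalIntegrable (fun θ : ℝ =>
      (-besselSeries 1 (riemannArg Z lam c (θ * τ) τ) *
        (lam ^ 2 / 4 * (Z1 (θ * τ) * ((starRingEnd ℂ) (Z (θ * τ)) - c τ))) * v (θ * τ) +
          vekuaP Z A lam c (θ * τ) τ) * τ +
      (vekuaS Z Z1 v lam c (θ * τ) τ +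
        besselSeries 0 (riemannArg Z lam c (θ * τ) τ) * (starRingEnd ℂ) (A (θ * τ))) *
          (starRingEnd ℂ) τ) volume 0 1 ∧
    ∫ θ in (0 : ℝ)..1,
      ((-besselSeries 1 (riemannArg Z lam c (θ * τ) τ) *
        (lam ^ 2 / 4 * (Z1 (θ * τ) * ((starRingEnd ℂ) (Z (θ * τ)) - c τ))) * v (θ * τ) +
          vekuaP Z A lam c (θ * τ) τ) * τ +
      (vekuaS Z Z1 v lam c (θ * τ) τ +
        besselSeries 0 (riemannArg Z lam c (θ * τ) τ) * (starRingEnd ℂ) (A (θ * τ))) *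
          (starRingEnd ℂ) τ) =
      v τ - besselSeries 0 (riemannArg Z lam c 0 τ) * v 0 := by
  have hpair : ContinuousOn (fun t : ℂ => (t, τ)) (upperRect l h) := by fun_prop
  have hmaps : MapsTo (fun t : ℂ => (t, τ)) (upperRect l h) (upperRect l h ×ˢ upperRect l h) :=
    fun t ht => mk_mem_prod ht hτ
  have hX : ContinuousOn (fun t => riemannArg Z lam c t τ) (upperRect l h) :=
    ContinuousOn.comp (g := Function.uncurry (riemannArg Z lam c)) (f := fun t : ℂ => (t, τ))
      (continuousOn_riemannArg hZ hc) hpair hmaps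
  have hP : ContinuousOn (fun t => vekuaP Z A lam c t τ) (upperRect l h) :=
    ContinuousOn.comp (g := Function.uncurry (vekuaP Z A lam c)) (f := fun t : ℂ => (t, τ))
      (continuousOn_vekuaP hZ hv hc) hpair hmaps
  have hS : ContinuousOn (fun t => vekuaS Z Z1 v lam c t τ) (upperRect l h) :=
    ContinuousOn.comp (g := Function.uncurry (vekuaS Z Z1 v lam c)) (f := fun t : ℂ => (t, τ))
      (continuousOn_vekuaS hZ hv hc) hpair hmaps
  have hZc := hZ.continuousOn.mono upperRect_subset
  have hZ1c := hZ.continuousOn1.mono upperRect_subset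
  have hb0 := (continuous_besselSeries 0).comp_continuousOn hX
  have hb1 := (continuous_besselSeries 1).comp_continuousOn hX
  have hp := ((hb1.neg.mul (continuousOn_const (c := (lam : ℂ) ^ 2 / 4) |>.mul (hZ1c.mul
    ((continuous_conj.comp_continuousOn hZc).sub (continuousOn_const (c := c τ)))))).mul
    hv.continuousOn_v).add hP
  have hq := hS.add (hb0.mul (continuous_conj.comp_continuousOn hv.continuousOn_A))
  have hmap2 : MapsTo (fun θ : ℝ => (θ : ℂ) * τ) (Icc (0 : ℝ) 1) (upperRect l h) :=
    fun θ hθ => ofReal_mul_mem_upperRect hτ hθ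
  have hray : ContinuousOn (fun θ : ℝ => (θ : ℂ) * τ) (Icc (0 : ℝ) 1) := by fun_prop
  constructor
  · refine ContinuousOn.intervalIntegrable ?_
    rw [uIcc_of_le zero_le_one]
    exact ((hp.comp hray hmap2).mul continuousOn_const).add
      ((hq.comp hray hmap2).mul continuousOn_const)
  · rw [integral_ray_eq_sub (P := fun t => _) (S := fun t => _)
      (fun t ht θ hθ => ofReal_mul_mem_upperRect ht hθ)
      (fun t ht => hasWirt_riemann_mul hZ hv c τ ht) hp hq hτ]
    simp [riemannArg, besselSeries_zero_apply_zero]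

theorem vekuaPhi_boundary (hZ : CollarMap Z Z1 Z2 l h C) (hv : WaveData Z1 v A B lam l h N)
    (hc : VekuaParam Z c l h C) {s : ℂ} (hs : s ∈ upperRect l h) (hs0 : s.im = 0) :
    vekuaPhi Z Z1 v A lam c s =
      v s + ∫ θ in (0 : ℝ)..1, s * vekuaKernel Z Z1 lam (θ * s) s (c s) * v (θ * s) := by
  obtain ⟨hi, he⟩ := integral_riemann_mul hZ hv hc hs
  have hmap : MapsTo (fun θ : ℝ => (θ : ℂ) * s) (Icc (0 : ℝ) 1) (upperRect l h) :=
    fun θ hθ => ofReal_mul_mem_upperRect hs hθ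
  have hray : ContinuousOn (fun θ : ℝ => (θ : ℂ) * s) (Icc (0 : ℝ) 1) := by fun_prop
  have hk : IntervalIntegrable (fun θ : ℝ => s * vekuaKernel Z Z1 lam (θ * s) s (c s) * v (θ * s))
      volume 0 1 := by
    refine ContinuousOn.intervalIntegrable ?_
    rw [uIcc_of_le zero_le_one]
    exact (continuousOn_const.mul (hZ.continuousOn_vekuaKernel lam hray continuousOn_const
      continuousOn_const (hmap.mono_right upperRect_subset) fun _ _ => upperRect_subset hs)).mul
      (hv.continuousOn_v.comp hray hmap)
  have hsum := intervalIntegral.integral_add hi hk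
  rw [he] at hsum
  rw [vekuaPhi, ← intervalIntegral.integral_const_mul]
  have hint : ∫ θ in (0 : ℝ)..1, 2 * (vekuaP Z A lam c (θ * s) s * s +
      vekuaS Z Z1 v lam c (θ * s) s * (starRingEnd ℂ) s) =
      v s - besselSeries 0 (riemannArg Z lam c 0 s) * v 0 +
        ∫ θ in (0 : ℝ)..1, s * vekuaKernel Z Z1 lam (θ * s) s (c s) * v (θ * s) := by
    refine (intervalIntegral.integral_congr fun θ hθ => ?_).trans hsum
    rw [uIcc_of_le zero_le_one] at hθ
    have hσ : ((θ : ℂ) * s).im = 0 := by simp [hs0]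
    have hA : (starRingEnd ℂ) (A (θ * s)) = A (θ * s) :=
      conj_eq_iff_im.2 (hv.neumann _ (hmap hθ) hσ)
    rw [hA, conj_eq_iff_im.2 hs0]
    simp only [vekuaKernel, conjFun_apply_of_im_eq_zero hσ, vekuaP, vekuaS, riemannArg]
    ring
  rw [hint]
  ring

theorem re_vekuaPhi_self (hZ : CollarMap Z Z1 Z2 l h C) (hv : WaveData Z1 v A B lam l h N)
    {t₀ : ℂ} (ht₀ : t₀ ∈ upperRect l h) :
    (vekuaPhi Z Z1 v A lam (fun _ => (starRingEnd ℂ) (Z t₀)) t₀).re = (v t₀).re := by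
  set c : ℂ → ℂ := fun _ => (starRingEnd ℂ) (Z t₀) with hcdef
  have hc : VekuaParam Z c l h C := hZ.vekuaParam_const (upperRect_subset ht₀)
  have hct : c t₀ = (starRingEnd ℂ) (Z t₀) := rfl
  obtain ⟨hi, he⟩ := integral_riemann_mul hZ hv hc ht₀
  have hreal : ∀ t, riemannArg Z lam c t t₀ = ((lam ^ 2 / 4 * normSq (Z t - Z t₀) : ℝ) : ℂ) := by
    intro t
    rw [riemannArg, hcdef, ← map_sub, mul_conj]
    push_cast
    ring
  have hbess : ∀ m t, (starRingEnd ℂ) (besselSeries m (riemannArg Z lam c t t₀)) =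
      besselSeries m (riemannArg Z lam c t t₀) := fun m t => by
    rw [hreal]; exact conj_eq_iff_im.2 (besselSeries_ofReal_im m _)
  have hcommon : ∀ θ ∈ Icc (0 : ℝ) 1,
      ((-besselSeries 1 (riemannArg Z lam c (θ * t₀) t₀) *
        (lam ^ 2 / 4 * (Z1 (θ * t₀) * ((starRingEnd ℂ) (Z (θ * t₀)) - c t₀))) * v (θ * t₀) +
          vekuaP Z A lam c (θ * t₀) t₀) * t₀ +
      (vekuaS Z Z1 v lam c (θ * t₀) t₀ +
        besselSeries 0 (riemannArg Z lam c (θ * t₀) t₀) * (starRingEnd ℂ) (A (θ * t₀))) *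
          (starRingEnd ℂ) t₀) =
      (vekuaP Z A lam c (θ * t₀) t₀ * t₀ + vekuaS Z Z1 v lam c (θ * t₀) t₀ * (starRingEnd ℂ) t₀) +
      (starRingEnd ℂ) (vekuaP Z A lam c (θ * t₀) t₀ * t₀ +
        vekuaS Z Z1 v lam c (θ * t₀) t₀ * (starRingEnd ℂ) t₀) := by
    intro θ hθ
    have hvr : (starRingEnd ℂ) (v (θ * t₀)) = v (θ * t₀) :=
      conj_eq_iff_im.2 (hv.im_eq _ (ofReal_mul_mem_upperRect ht₀ hθ))
    simp only [vekuaP, vekuaS, map_add, map_mul, map_sub, map_neg, map_div₀, map_pow, conj_conj,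
      hbess, hvr, conj_ofReal, hct, map_ofNat]
    ring
  have hPS : IntervalIntegrable (fun θ : ℝ => vekuaP Z A lam c (θ * t₀) t₀ * t₀ +
      vekuaS Z Z1 v lam c (θ * t₀) t₀ * (starRingEnd ℂ) t₀) volume 0 1 := by
    have hray : ContinuousOn (fun θ : ℝ => ((θ : ℂ) * t₀, t₀)) (Icc (0 : ℝ) 1) := by fun_prop
    have hmap : MapsTo (fun θ : ℝ => ((θ : ℂ) * t₀, t₀)) (Icc (0 : ℝ) 1)
        (upperRect l h ×ˢ upperRect l h) :=
      fun θ hθ => mk_mem_prod (ofReal_mul_mem_upperRect ht₀ hθ) ht₀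
    refine ContinuousOn.intervalIntegrable ?_
    rw [uIcc_of_le zero_le_one]
    have h1 : ContinuousOn (fun θ : ℝ => vekuaP Z A lam c (θ * t₀) t₀) (Icc (0 : ℝ) 1) :=
      ContinuousOn.comp (g := Function.uncurry (vekuaP Z A lam c))
          (f := fun θ : ℝ => ((θ : ℂ) * t₀, t₀))
        (continuousOn_vekuaP hZ hv hc) hray hmap
    have h2 : ContinuousOn (fun θ : ℝ => vekuaS Z Z1 v lam c (θ * t₀) t₀) (Icc (0 : ℝ) 1) :=
      ContinuousOn.comp (g := Function.uncurry (vekuaS Z Z1 v lam c))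
          (f := fun θ : ℝ => ((θ : ℂ) * t₀, t₀))
        (continuousOn_vekuaS hZ hv hc) hray hmap
    exact (h1.mul continuousOn_const).add (h2.mul continuousOn_const)
  have hconj : IntervalIntegrable (fun θ : ℝ => (starRingEnd ℂ) (vekuaP Z A lam c (θ * t₀) t₀ * t₀ +
      vekuaS Z Z1 v lam c (θ * t₀) t₀ * (starRingEnd ℂ) t₀)) volume 0 1 :=
    ⟨(conjLIE.toContinuousLinearEquiv : ℂ →L[ℝ] ℂ).integrable_comp hPS.1,
      (conjLIE.toContinuousLinearEquiv : ℂ →L[ℝ] ℂ).integrable_comp hPS.2⟩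
  rw [intervalIntegral.integral_congr (g := fun θ : ℝ =>
    (vekuaP Z A lam c (θ * t₀) t₀ * t₀ + vekuaS Z Z1 v lam c (θ * t₀) t₀ * (starRingEnd ℂ) t₀) +
      (starRingEnd ℂ) (vekuaP Z A lam c (θ * t₀) t₀ * t₀ +
        vekuaS Z Z1 v lam c (θ * t₀) t₀ * (starRingEnd ℂ) t₀))
    (fun θ hθ => hcommon θ (by rwa [uIcc_of_le zero_le_one] at hθ)),
    intervalIntegral.integral_add hPS hconj] at he
  have hcc : ∫ θ in (0 : ℝ)..1, (starRingEnd ℂ) (vekuaP Z A lam c (θ * t₀) t₀ * t₀ +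
        vekuaS Z Z1 v lam c (θ * t₀) t₀ * (starRingEnd ℂ) t₀) = (starRingEnd ℂ) (∫ θ in (0 : ℝ)..1,
        (vekuaP Z A lam c (θ * t₀) t₀ * t₀ +
        vekuaS Z Z1 v lam c (θ * t₀) t₀ * (starRingEnd ℂ) t₀)) := by
    rw [intervalIntegral.integral_of_le zero_le_one, intervalIntegral.integral_of_le zero_le_one,
      integral_conj]
  rw [hcc] at he
  have hre := congrArg Complex.re he
  simp only [add_re, conj_re, sub_re] at hre
  simp only [vekuaPhi, add_re]
  rw [mul_comm (v 0)]
  have : ∀ z : ℂ, (2 * z).re = z.re + z.re := fun z => by simp [two_mul]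
  rw [this]
  linarith

end

theorem norm_besselSeries_scaled_le (m : ℕ) {lam r : ℝ} (hl : 0 ≤ lam) (hr : 0 ≤ r) {X : ℂ}
    (hX : ‖X‖ ≤ r ^ 2) : ‖besselSeries m ((lam : ℂ) ^ 2 / 4 * X)‖ ≤ Real.exp (lam * r) := by
  refine (norm_besselSeries_le m _).trans (Real.exp_le_exp.2 ?_)
  have h1 : ‖(lam : ℂ) ^ 2 / 4 * X‖ ≤ (lam * r / 2) ^ 2 := by
    rw [norm_mul, norm_div, norm_pow, norm_real, Real.norm_of_nonneg hl]
    have : ‖(4 : ℂ)‖ = 4 := by norm_num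
    rw [this]
    nlinarith [sq_nonneg lam]
  have := Real.sqrt_le_sqrt h1
  rw [Real.sqrt_sq (by positivity)] at this
  linarith

section

variable {Z Z1 Z2 v A B c : ℂ → ℂ} {lam l h C N : ℝ}

theorem WaveData.N_nonneg (hv : WaveData Z1 v A B lam l h N) (hZ : CollarMap Z Z1 Z2 l h C) :
    0 ≤ N := (norm_nonneg _).trans (hv.norm_v 0 hZ.zero_mem)

theorem norm_vekuaPhi_le (hZ : CollarMap Z Z1 Z2 l h C) (hv : WaveData Z1 v A B lam l h N)
    (hc : VekuaParam Z c l h C) {τ : ℂ} (hτ : τ ∈ upperRect l h) :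
    ‖vekuaPhi Z Z1 v A lam c τ‖ ≤ N * Real.exp (4 * C ^ 2 * (1 + lam)) := by
  have hN := hv.N_nonneg hZ
  have hC := hZ.one_le
  have hl := hv.lam_pos
  set E := Real.exp (lam * (2 * C ^ 2)) with hE
  have hbess : ∀ m, ∀ t ∈ upperRect l h, ‖besselSeries m (riemannArg Z lam c t τ)‖ ≤ E := by
    intro m t ht
    refine norm_besselSeries_scaled_le m hl.le (by positivity) ?_
    rw [norm_mul, sq]
    exact mul_le_mul (hZ.norm_sub_le' (upperRect_subset ht) (upperRect_subset hτ))
      (hc.bound t ht τ hτ) (norm_nonneg _) (by positivity)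
  have hP : ∀ t ∈ upperRect l h, ‖vekuaP Z A lam c t τ‖ ≤ E * N := by
    intro t ht
    rw [vekuaP, norm_mul]
    exact mul_le_mul (hbess 0 t ht) (hv.norm_A t ht) (norm_nonneg _) (by positivity)
  have hS : ∀ t ∈ upperRect l h, ‖vekuaS Z Z1 v lam c t τ‖ ≤
      lam ^ 2 / 4 * (N * (2 * C ^ 2) * C) * E := by
    intro t ht
    have h4 : ‖-((lam : ℂ) ^ 2 / 4)‖ = lam ^ 2 / 4 := by
      rw [norm_neg, norm_div, norm_pow, norm_real, Real.norm_of_nonneg hl.le]; norm_num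
    rw [vekuaS, norm_mul, norm_mul, h4, norm_mul, norm_mul, norm_conj]
    gcongr
    · exact hv.norm_v t ht
    · exact hZ.norm_sub_le' (upperRect_subset ht) (upperRect_subset hτ)
    · exact hZ.norm_le1 t (upperRect_subset ht)
    · exact hbess 1 t ht
  have hτC : ‖τ‖ ≤ C := hZ.norm_le (upperRect_subset hτ)
  have hint : ‖∫ θ in (0 : ℝ)..1, (vekuaP Z A lam c (θ * τ) τ * τ +
      vekuaS Z Z1 v lam c (θ * τ) τ * (starRingEnd ℂ) τ)‖ ≤
      ((E * N) * C + (lam ^ 2 / 4 * (N * (2 * C ^ 2) * C) * E) * C) * |1 - 0| := by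
    refine intervalIntegral.norm_integral_le_of_norm_le_const fun θ hθ => ?_
    rw [uIoc_of_le zero_le_one] at hθ
    have hm := ofReal_mul_mem_upperRect hτ (Ioc_subset_Icc_self hθ)
    refine (norm_add_le _ _).trans ?_
    rw [norm_mul, norm_mul, norm_conj]
    gcongr
    · exact hP _ hm
    · exact hS _ hm
  have h0 : ‖v 0 * besselSeries 0 (riemannArg Z lam c 0 τ)‖ ≤ N * E := by
    rw [norm_mul]
    exact mul_le_mul (hv.norm_v 0 hZ.zero_mem) (hbess 0 0 hZ.zero_mem) (norm_nonneg _) hN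
  have htot : ‖vekuaPhi Z Z1 v A lam c τ‖ ≤ N * E * (1 + 2 * C + lam ^ 2 * C ^ 4) := by
    refine (norm_add_le _ _).trans ?_
    rw [norm_mul]
    have : ‖(2 : ℂ)‖ = 2 := by norm_num
    rw [this]
    rw [sub_zero, abs_one, mul_one] at hint
    linarith
  refine htot.trans ?_
  rw [mul_assoc]
  refine mul_le_mul_of_nonneg_left ?_ hN
  have h1 : 1 + 2 * C ≤ Real.exp (2 * C ^ 2) := by
    have := Real.add_one_le_exp (2 * C ^ 2)
    nlinarith
  have h2 : 1 + lam ^ 2 * C ^ 4 ≤ Real.exp (lam * (2 * C ^ 2)) := by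
    have := Real.quadratic_le_exp_of_nonneg (x := lam * (2 * C ^ 2)) (by positivity)
    have h3 : 0 ≤ lam * (2 * C ^ 2) := by positivity
    nlinarith [sq_nonneg (lam * C ^ 2)]
  have h3 : 1 + 2 * C + lam ^ 2 * C ^ 4 ≤ (1 + 2 * C) * (1 + lam ^ 2 * C ^ 4) := by
    have : 0 ≤ 2 * C * (lam ^ 2 * C ^ 4) := by positivity
    linarith
  have h4 : (1 + 2 * C) * (1 + lam ^ 2 * C ^ 4) ≤
      Real.exp (2 * C ^ 2) * Real.exp (lam * (2 * C ^ 2)) := by gcongr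
  calc E * (1 + 2 * C + lam ^ 2 * C ^ 4)
      ≤ E * (Real.exp (2 * C ^ 2) * Real.exp (lam * (2 * C ^ 2))) := by
        gcongr; exact h3.trans h4
    _ = Real.exp (lam * (2 * C ^ 2) + (2 * C ^ 2 + lam * (2 * C ^ 2))) := by
        rw [hE, Real.exp_add, Real.exp_add]
    _ ≤ _ := Real.exp_le_exp.2 (by nlinarith [sq_nonneg C])

theorem norm_vekuaKernel_le {σ t w : ℂ} {r : ℝ} (hl : 0 ≤ lam) (hr : 0 ≤ r)
    (h1 : ‖Z σ - Z t‖ ≤ r) (h2 : ‖conjFun Z σ - w‖ ≤ r) (h3 : ‖Z1 σ‖ ≤ C)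
    (h4 : ‖conjFun Z1 σ‖ ≤ C) :
    ‖vekuaKernel Z Z1 lam σ t w‖ ≤ lam ^ 2 / 2 * C * r * Real.exp (lam * r) := by
  have hq : ‖-((lam : ℂ) ^ 2 / 4)‖ = lam ^ 2 / 4 := by
    rw [norm_neg, norm_div, norm_pow, norm_real, Real.norm_of_nonneg hl]; norm_num
  have hb : ‖besselSeries 1 ((lam : ℂ) ^ 2 / 4 * ((Z σ - Z t) * (conjFun Z σ - w)))‖ ≤
      Real.exp (lam * r) := by
    refine norm_besselSeries_scaled_le 1 hl hr ?_
    rw [norm_mul, sq]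
    gcongr
  have hd : ‖(Z σ - Z t) * conjFun Z1 σ - (conjFun Z σ - w) * Z1 σ‖ ≤ r * C + r * C := by
    refine (norm_sub_le _ _).trans ?_
    rw [norm_mul, norm_mul]
    gcongr
  have hC : 0 ≤ C := (norm_nonneg _).trans h3
  rw [vekuaKernel, norm_mul, norm_mul, hq]
  calc _ ≤ lam ^ 2 / 4 * (r * C + r * C) * Real.exp (lam * r) := by gcongr
    _ = _ := by ring

theorem CollarMap.norm_conjFun1_le (hZ : CollarMap Z Z1 Z2 l h C) {t : ℂ} (ht : t ∈ symmRect l h) :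
    ‖conjFun Z1 t‖ ≤ C := by
  rw [conjFun, norm_conj]; exact hZ.norm_le1 _ (conj_mem_symmRect ht)

theorem CollarMap.norm_ray_kernel_le (hZ : CollarMap Z Z1 Z2 l h C) (hl : 0 ≤ lam) {t : ℂ}
    (ht : t ∈ symmRect l h) {θ : ℝ} (hθ : θ ∈ Icc (0 : ℝ) 1) :
    ‖t * vekuaKernel Z Z1 lam (θ * t) t (conjFun Z t)‖ ≤
      lam * C ^ 2 * ‖t‖ * Real.exp (lam * (C + 1) * (1 - θ) * ‖t‖) := by
  have hσ := ofReal_mul_mem_symmRect ht hθ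
  have hx : ‖(θ : ℂ) * t - t‖ = (1 - θ) * ‖t‖ := by
    rw [show (θ : ℂ) * t - t = ((θ - 1 : ℝ) : ℂ) * t by push_cast; ring, norm_mul, norm_real,
      Real.norm_of_nonpos (by linarith [hθ.2])]
    ring
  set x := (1 - θ) * ‖t‖ with hxd
  have hx0 : 0 ≤ x := mul_nonneg (by linarith [hθ.2]) (norm_nonneg _)
  have hC := hZ.C_pos
  have h1 : ‖Z (θ * t) - Z t‖ ≤ C * x := by rw [← hx]; exact hZ.norm_sub_le hσ ht
  have h2 : ‖conjFun Z (θ * t) - conjFun Z t‖ ≤ C * x := by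
    have he : ‖(starRingEnd ℂ) ((θ : ℂ) * t) - (starRingEnd ℂ) t‖ = x := by
      rw [← map_sub, norm_conj, hx]
    rw [conjFun, conjFun, ← map_sub, norm_conj, ← he]
    exact hZ.norm_sub_le (conj_mem_symmRect hσ) (conj_mem_symmRect ht)
  have hk := norm_vekuaKernel_le (lam := lam) hl (by positivity) h1 h2 (hZ.norm_le1 _ hσ)
    (hZ.norm_conjFun1_le hσ)
  rw [norm_mul]
  have he : lam * x ≤ Real.exp (lam * x) := (by linarith [Real.add_one_le_exp (lam * x)])
  have he2 : Real.exp (lam * (C + 1) * (1 - θ) * ‖t‖) =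
      Real.exp (lam * x) * Real.exp (lam * (C * x)) := by
    rw [← Real.exp_add]; congr 1; rw [hxd]; ring
  rw [he2]
  calc ‖t‖ * _ ≤ ‖t‖ * (lam ^ 2 / 2 * C * (C * x) * Real.exp (lam * (C * x))) := by gcongr
    _ = lam * C ^ 2 * ‖t‖ * ((lam * x / 2) * Real.exp (lam * (C * x))) := by ring
    _ ≤ _ := by
      gcongr
      have : 0 ≤ lam * x := by positivity
      linarith

/-- Holomorphic extension of the boundary values of `v`. -/
theorem exists_boundary_extension (hZ : CollarMap Z Z1 Z2 l h C)
    (hv : WaveData Z1 v A B lam l h N) :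
    ∃ g : ℂ → ℂ, ContinuousOn g (upperRect l h) ∧ DifferentiableOn ℂ g (openSymmRect l h) ∧
      (∀ z ∈ symmRect l h, ‖g z‖ ≤ N * Real.exp (7 * C ^ 3 * (1 + lam))) ∧
      (∀ z, ‖g ((starRingEnd ℂ) z)‖ = ‖g z‖) ∧
      ∀ z ∈ upperRect l h, z.im = 0 → g z = v z := by
  have hl := hv.lam_pos.le
  have hC1 := hZ.one_le
  have hN := hv.N_nonneg hZ
  have hc := hZ.vekuaParam_conjFun
  set κ : ℂ → ℝ → ℂ := fun t θ => t * vekuaKernel Z Z1 lam (θ * t) t (conjFun Z t) with hκ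
  have hb : 0 ≤ lam * C ^ 2 := by positivity
  have ha : 0 ≤ lam * (C + 1) := by positivity
  have hT : ∀ t ∈ upperRect l h, ∀ θ ∈ Icc (0 : ℝ) 1, (θ : ℂ) * t ∈ upperRect l h :=
    fun t ht θ hθ => ofReal_mul_mem_upperRect ht hθ
  have hκb : ∀ t ∈ upperRect l h, ∀ θ ∈ Icc (0 : ℝ) 1, ‖κ t θ‖ ≤
      lam * C ^ 2 * ‖t‖ * Real.exp (lam * (C + 1) * (1 - θ) * ‖t‖) :=
    fun t ht θ hθ => hZ.norm_ray_kernel_le hl (upperRect_subset ht) hθ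
  have hκc : ContinuousOn (Function.uncurry κ) (upperRect l h ×ˢ Icc (0 : ℝ) 1) := by
    have h1 : ContinuousOn (fun p : ℂ × ℝ => p.1) (upperRect l h ×ˢ Icc (0 : ℝ) 1) :=
        continuousOn_fst
    have h2 : ContinuousOn (fun p : ℂ × ℝ => (p.2 : ℂ) * p.1) (upperRect l h ×ˢ Icc (0 : ℝ) 1) := by
      fun_prop
    have h3 : ContinuousOn (fun p : ℂ × ℝ => conjFun Z p.1) (upperRect l h ×ˢ Icc (0 : ℝ) 1) :=
      hc.cont.comp h1 fun p hp => hp.1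
    exact h1.mul (hZ.continuousOn_vekuaKernel lam h2 h1 h3
      (fun p hp => upperRect_subset (hT _ hp.1 _ hp.2)) fun p hp => upperRect_subset hp.1)
  have hκd : ∀ θ ∈ Icc (0 : ℝ) 1, DifferentiableOn ℂ (fun t => κ t θ) (openUpperRect l h) := by
    intro θ hθ
    exact differentiableOn_id.mul (hZ.differentiableOn_vekuaKernel lam
      (differentiableOn_id.const_mul (θ : ℂ)) differentiableOn_id hc.diff
      (fun t ht => upperRect_subset (hT _ (openUpperRect_subset ht) _ hθ))
      fun t ht => upperRect_subset (openUpperRect_subset ht))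
  obtain ⟨u, huc, hud, hub, hueq⟩ := exists_volterra_solution (T := upperRect l h) (κ := κ)
    (Φ := vekuaPhi Z Z1 v A lam (conjFun Z)) (ρ := C) hb ha (by positivity)
    (fun t ht => hZ.norm_le (upperRect_subset ht)) hT hκc hκb (continuousOn_vekuaPhi hZ hv hc)
    (fun t ht => norm_vekuaPhi_le hZ hv hc ht) isOpen_openUpperRect openUpperRect_subset
    (fun t ht θ hθ => ofReal_mul_mem_openUpperRect ht hθ) hκd (differentiableOn_vekuaPhi hZ hv hc)
  have hubd : ∀ z ∈ upperRect l h, ‖u z‖ ≤ N * Real.exp (7 * C ^ 3 * (1 + lam)) := by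
    intro z hz
    refine (hub z hz).trans ?_
    rw [mul_assoc, ← Real.exp_add]
    refine mul_le_mul_of_nonneg_left (Real.exp_le_exp.2 ?_) hN
    have h1 : C ≤ C ^ 3 := le_self_pow₀ hC1 (by norm_num)
    have h2 : C ^ 2 ≤ C ^ 3 := pow_le_pow_right₀ hC1 (by norm_num)
    have h3 : 0 ≤ C ^ 3 := by positivity
    nlinarith
  have hreal : ∀ z ∈ upperRect l h, z.im = 0 → u z = v z := by
    have hTr : ∀ t ∈ {z ∈ upperRect l h | z.im = 0}, ∀ θ ∈ Icc (0 : ℝ) 1,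
        (θ : ℂ) * t ∈ {z ∈ upperRect l h | z.im = 0} :=
      fun t ht θ hθ => ⟨hT t ht.1 θ hθ, by simp [ht.2]⟩
    have := volterra_eq_zero (T := {z ∈ upperRect l h | z.im = 0}) (κ := κ)
      (g := fun z => u z - v z) (N := N * Real.exp (7 * C ^ 3 * (1 + lam)) + N) hb ha
      (by positivity) hTr (fun t ht => hκb t ht.1)
      (fun t ht => (norm_sub_le _ _).trans (add_le_add (hubd t ht.1) (hv.norm_v t ht.1))) ?_
    · exact fun z hz hz0 => sub_eq_zero.1 (this z ⟨hz, hz0⟩)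
    · intro t ht
      have hslice := continuousOn_slice hκc ht.1
      have hray : ContinuousOn (fun θ : ℝ => (θ : ℂ) * t) (Icc (0 : ℝ) 1) := by fun_prop
      have hmap : MapsTo (fun θ : ℝ => (θ : ℂ) * t) (Icc (0 : ℝ) 1) (upperRect l h) :=
        fun θ hθ => hT t ht.1 θ hθ
      have hi1 : IntervalIntegrable (fun θ : ℝ => κ t θ * u (θ * t)) volume 0 1 := by
        refine ContinuousOn.intervalIntegrable ?_
        rw [uIcc_of_le zero_le_one]
        exact hslice.mul (huc.comp hray hmap)
      have hi2 : IntervalIntegrable (fun θ : ℝ => κ t θ * v (θ * t)) volume 0 1 := by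
        refine ContinuousOn.intervalIntegrable ?_
        rw [uIcc_of_le zero_le_one]
        exact hslice.mul (hv.continuousOn_v.comp hray hmap)
      have hphi := vekuaPhi_boundary hZ hv hc ht.1 ht.2
      rw [hueq t ht.1, hphi]
      simp only [mul_sub]
      rw [intervalIntegral.integral_sub hi1 hi2]
      simp only [hκ]
      ring
  obtain ⟨g, hgd, hgu, hgl⟩ := exists_schwarz_reflection (f := u) (U := openSymmRect l h)
    isOpen_openSymmRect (fun z hz => conj_mem_openSymmRect hz)
    (huc.mono fun z hz => ⟨hz.1.1.le, hz.2, (abs_lt.1 hz.1.2).2.le⟩)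
    (fun z hz hz0 => hud.differentiableAt
      (isOpen_openUpperRect.mem_nhds ⟨hz.1, hz0, (abs_lt.1 hz.2).2⟩))
    (fun z hz hz0 => by
      have hzm : z ∈ upperRect l h := ⟨hz.1.le, hz0.ge, (abs_lt.1 hz.2).2.le⟩
      rw [hreal z hzm hz0]
      exact hv.im_eq z hzm)
  have hgc : ∀ z, ‖g ((starRingEnd ℂ) z)‖ = ‖g z‖ := by
    intro z
    rcases lt_trichotomy z.im 0 with hz | hz | hz
    · rw [hgl z hz, norm_conj, hgu _ (by simpa using hz.le)]
    · rw [conj_eq_iff_im.2 hz]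
    · rw [hgl ((starRingEnd ℂ) z) (by simpa using hz), conj_conj, norm_conj, hgu z hz.le]
  refine ⟨g, huc.congr fun z hz => hgu z hz.2.1, hgd, fun z hz => ?_, hgc, fun z hz hz0 => ?_⟩
  · rcases le_or_gt 0 z.im with hz0 | hz0
    · rw [hgu z hz0]; exact hubd z ⟨hz.1, hz0, (abs_le.1 hz.2).2⟩
    · rw [hgl z hz0, norm_conj]
      exact hubd _ ⟨by simpa using hz.1, by simpa using hz0.le, by
        have := (abs_le.1 hz.2).1
        simp only [conj_im]; linarith⟩
  · rw [hgu z hz0.ge, hreal z hz hz0]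

end

theorem exists_unit_mul_sq_eq_norm (w : ℂ) : ∃ e : ℂ, ‖e‖ = 1 ∧ w * e ^ 2 = ‖w‖ := by
  refine ⟨exp ((-(arg w / 2) : ℝ) * I), norm_exp_ofReal_mul_I _, ?_⟩
  have h1 : (arg w : ℂ) * I + ((2 : ℕ) : ℂ) * ((-(arg w / 2) : ℝ) * I) = 0 := by push_cast; ring
  calc (w * exp ((-(arg w / 2) : ℝ) * I) ^ 2 : ℂ)
      = ‖w‖ * exp (arg w * I) * exp ((-(arg w / 2) : ℝ) * I) ^ 2 := by
        rw [norm_mul_exp_arg_mul_I w]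
    _ = (‖w‖ : ℂ) := by rw [mul_assoc, ← exp_nat_mul, ← exp_add, h1, exp_zero, mul_one]

section

variable {Z Z1 Z2 v A B c g : ℂ → ℂ} {lam l h C N : ℝ}

/-- Vekua's representation of `v` through the holomorphic extension of its boundary values. -/
theorem re_boundary_representation (hZ : CollarMap Z Z1 Z2 l h C)
    (hv : WaveData Z1 v A B lam l h N) (hgc : ContinuousOn g (upperRect l h))
    (hgd : DifferentiableOn ℂ g (openSymmRect l h))
    (hgv : ∀ z ∈ upperRect l h, z.im = 0 → g z = v z) {t₀ : ℂ} (ht₀ : t₀ ∈ openUpperRect l h) :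
    (v t₀).re = (g t₀ + ∫ θ in (0 : ℝ)..1,
      t₀ * vekuaKernel Z Z1 lam (θ * t₀) t₀ ((starRingEnd ℂ) (Z t₀)) * g (θ * t₀)).re := by
  have ht₀' := openUpperRect_subset ht₀
  set w := (starRingEnd ℂ) (Z t₀) with hw
  have hc := hZ.vekuaParam_const (upperRect_subset ht₀')
  rw [← hw] at hc
  have hFc : ContinuousOn (Function.uncurry fun (t : ℂ) (θ : ℝ) =>
      t * vekuaKernel Z Z1 lam (θ * t) t w * g (θ * t)) (upperRect l h ×ˢ Icc (0 : ℝ) 1) := by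
    have h1 : ContinuousOn (fun p : ℂ × ℝ => p.1) (upperRect l h ×ˢ Icc (0 : ℝ) 1) :=
        continuousOn_fst
    have h2 : ContinuousOn (fun p : ℂ × ℝ => (p.2 : ℂ) * p.1) (upperRect l h ×ˢ Icc (0 : ℝ) 1) := by
      fun_prop
    have hm : MapsTo (fun p : ℂ × ℝ => (p.2 : ℂ) * p.1) (upperRect l h ×ˢ Icc (0 : ℝ) 1)
      (upperRect l h) := fun p hp => ofReal_mul_mem_upperRect hp.1 hp.2
    exact (h1.mul (hZ.continuousOn_vekuaKernel lam h2 h1 continuousOn_const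
      (fun p hp => upperRect_subset (hm hp)) fun p hp => upperRect_subset hp.1)).mul
      (hgc.comp h2 hm)
  have hcont := ((continuousOn_vekuaPhi hZ hv hc).sub hgc).sub
    (continuousOn_intervalIntegral_param hFc)
  have hopen : openUpperRect l h ⊆ openSymmRect l h :=
    fun z hz => ⟨hz.1, abs_lt.2 ⟨by linarith [hz.2.1, hz.2.2], hz.2.2⟩⟩
  have hdiff := ((differentiableOn_vekuaPhi hZ hv hc).sub (hgd.mono hopen)).sub
    (differentiableOn_intervalIntegral_param (F := fun (t : ℂ) (θ : ℝ) =>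
      t * vekuaKernel Z Z1 lam (θ * t) t w * g (θ * t)) isOpen_openUpperRect
      (hFc.mono (prod_mono openUpperRect_subset Subset.rfl)) fun θ hθ =>
        (differentiableOn_id.mul (hZ.differentiableOn_vekuaKernel lam
          (differentiableOn_id.const_mul (θ : ℂ)) differentiableOn_id (differentiableOn_const w)
          (fun t ht => upperRect_subset (ofReal_mul_mem_upperRect (openUpperRect_subset ht) hθ))
          fun t ht => upperRect_subset (openUpperRect_subset ht))).mul
        (hgd.comp (differentiableOn_id.const_mul (θ : ℂ))
          fun t ht => ofReal_mul_mem_openSymmRect (hopen ht) hθ))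
  have hbot : ∀ s ∈ upperRect l h, s.im = 0 → vekuaPhi Z Z1 v A lam (fun _ => w) s - g s -
      (∫ θ in (0 : ℝ)..1, s * vekuaKernel Z Z1 lam (θ * s) s w * g (θ * s)) = 0 := by
    intro s hs hs0
    rw [vekuaPhi_boundary hZ hv hc hs hs0, hgv s hs hs0]
    rw [intervalIntegral.integral_congr (g := fun θ : ℝ =>
      s * vekuaKernel Z Z1 lam (θ * s) s w * v (θ * s))
      (f := fun θ : ℝ => s * vekuaKernel Z Z1 lam (θ * s) s w * g (θ * s))]
    · ring
    · intro θ hθ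
      rw [uIcc_of_le zero_le_one] at hθ
      beta_reduce
      rw [hgv _ (ofReal_mul_mem_upperRect hs hθ) (by simp [hs0])]
  have hsub : openSymmRect l h ∩ {z | 0 ≤ z.im} ⊆ upperRect l h :=
    fun z hz => ⟨hz.1.1.le, hz.2, (abs_lt.1 hz.1.2).2.le⟩
  obtain ⟨D, hDd, hDu, -⟩ := exists_schwarz_reflection (U := openSymmRect l h)
    isOpen_openSymmRect (fun z hz => conj_mem_openSymmRect hz) (hcont.mono hsub)
    (fun z hz hz0 => hdiff.differentiableAt
      (isOpen_openUpperRect.mem_nhds ⟨hz.1, hz0, (abs_lt.1 hz.2).2⟩))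
    (fun z hz hz0 => by
      have := hbot z (hsub ⟨hz, hz0.ge⟩) hz0
      exact (congrArg Complex.im this).trans zero_im)
  have hzero : EqOn D 0 (openSymmRect l h) := by
    have h0m : (0 : ℂ) ∈ openSymmRect l h := by simp [openSymmRect, hZ.l_pos, hZ.h_pos]
    refine AnalyticOnNhd.eqOn_zero_of_preconnected_of_frequently_eq_zero
      (hDd.analyticOnNhd isOpen_openSymmRect) convex_openSymmRect.isPreconnected h0m ?_
    have htend : Tendsto (fun n : ℕ => (((1 / ((n : ℝ) + 1) : ℝ) : ℂ))) atTop (𝓝[≠] 0) := by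
      refine tendsto_nhdsWithin_iff.2 ⟨?_, Eventually.of_forall fun n => ?_⟩
      · have := (continuous_ofReal.tendsto 0).comp
          (tendsto_one_div_add_atTop_nhds_zero_nat (𝕜 := ℝ))
        rw [ofReal_zero] at this
        exact this
      · have : (1 / ((n : ℝ) + 1)) ≠ 0 := by positivity
        exact Complex.ofReal_ne_zero.2 this
    refine htend.frequently (Eventually.frequently ?_)
    have hev := (htend.mono_right nhdsWithin_le_nhds).eventually
      (isOpen_openSymmRect.mem_nhds h0m)
    filter_upwards [hev] with n hn
    rw [hDu _ (by simp)]
    exact hbot _ (hsub ⟨hn, by simp⟩) (by simp)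
  have := hzero (hopen ht₀)
  rw [hDu _ ht₀.2.1.le] at this
  have hre := congrArg Complex.re this
  rw [← re_vekuaPhi_self hZ hv ht₀', ← hw]
  simp only [Pi.sub_apply, sub_re, Pi.zero_apply, zero_re] at hre
  rw [add_re]
  linarith


theorem hasDerivAt_re_line {f : ℂ → ℂ} {p q t e : ℂ} {s : ℝ} (hs : upperRect l h ∈ 𝓝 (t + s * e))
    (hf : HasWirt f p q (upperRect l h) (t + s * e)) :
    HasDerivAt (fun s : ℝ => f (t + s * e)) (p * e + q * (starRingEnd ℂ) e) s := by
  have h1 : HasDerivAt (fun s : ℝ => t + (s : ℂ) * e) e s := by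
    simpa using ((hasDerivAt_id s).ofReal_comp.mul_const e).const_add t
  have h2 := (HasFDerivWithinAt.hasFDerivAt hf hs).comp_hasDerivAt s h1
  rw [wirt_apply] at h2
  exact h2

theorem HasDerivAt.re_real {f : ℝ → ℂ} {f' : ℂ} {s : ℝ} (hf : HasDerivAt f f' s) :
    HasDerivAt (fun s => (f s).re) f'.re s :=
  reCLM.hasFDerivAt.comp_hasDerivAt s hf

/-- Cauchy estimates for a holomorphic function whose real part is `v` along a line. -/
theorem collar_bounds_of_line {G : ℂ → ℂ} {t e : ℂ} {R G₀ : ℝ} (hZ : CollarMap Z Z1 Z2 l h C)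
    (hv : WaveData Z1 v A B lam l h N) (ht : t ∈ openUpperRect l h) (hR : 0 < R)
    (hGd : DifferentiableOn ℂ G (Metric.closedBall 0 R))
    (hGb : ∀ s ∈ Metric.closedBall (0 : ℂ) R, ‖G s‖ ≤ G₀)
    (hGv : ∀ᶠ s : ℝ in 𝓝 0, (v (t + s * e)).re = (G s).re) :
    ‖v t‖ ≤ G₀ ∧ (A t * e).re ≤ G₀ / R ∧
      (B t * e ^ 2).re ≤ G₀ / R ^ 2 + lam ^ 2 / 4 * C ^ 2 * ‖e‖ ^ 2 * G₀ := by
  have hRm : Metric.closedBall (0 : ℂ) R ∈ 𝓝 (0 : ℂ) := Metric.closedBall_mem_nhds _ hR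
  have h0m := Metric.mem_closedBall_self (x := (0 : ℂ)) hR.le
  have ht' := openUpperRect_subset ht
  have hG0 : 0 ≤ G₀ := (norm_nonneg _).trans (hGb 0 h0m)
  have hvt : ‖v t‖ ≤ G₀ := by
    have h0 := hGv.self_of_nhds
    simp only [ofReal_zero, zero_mul, add_zero] at h0
    have hvr : v t = ((v t).re : ℂ) := Complex.ext rfl (by simpa using hv.im_eq t ht')
    rw [hvr, norm_real, h0]
    exact (abs_re_le_norm _).trans (hGb 0 h0m)
  have hcl : DiffContOnCl ℂ G (Metric.ball 0 R) := by
    refine DifferentiableOn.diffContOnCl ?_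
    rwa [closure_ball _ hR.ne']
  have hsph : ∀ z ∈ Metric.sphere (0 : ℂ) R, ‖G z‖ ≤ G₀ := fun z hz =>
    hGb z (Metric.sphere_subset_closedBall hz)
  have hd1 := Complex.norm_deriv_le_of_forall_mem_sphere_norm_le hR hcl hsph
  have hd2 := Complex.norm_iteratedDeriv_le_of_forall_mem_sphere_norm_le 2 hR hcl hsph
  have hid : iteratedDeriv 2 G 0 = deriv (deriv G) 0 := by
    rw [iteratedDeriv_succ, iteratedDeriv_one]
  rw [hid] at hd2
  have hline : Tendsto (fun s : ℝ => t + (s : ℂ) * e) (𝓝 0) (𝓝 t) := by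
    have : Continuous fun s : ℝ => t + (s : ℂ) * e := by fun_prop
    simpa using this.tendsto 0
  have hmem : ∀ᶠ s : ℝ in 𝓝 0, t + (s : ℂ) * e ∈ openUpperRect l h :=
    hline.eventually (isOpen_openUpperRect.mem_nhds ht)
  have hball : ∀ᶠ s : ℝ in 𝓝 0, (s : ℂ) ∈ Metric.ball (0 : ℂ) R := by
    have : Tendsto (fun s : ℝ => (s : ℂ)) (𝓝 0) (𝓝 0) := by
      simpa using continuous_ofReal.tendsto 0
    exact this.eventually (Metric.ball_mem_nhds 0 hR)
  have hGan : AnalyticOnNhd ℂ G (Metric.ball 0 R) :=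
    (hGd.mono Metric.ball_subset_closedBall).analyticOnNhd Metric.isOpen_ball
  have hfirst : ∀ᶠ s : ℝ in 𝓝 0, 2 * (A (t + s * e) * e).re = (deriv G s).re := by
    filter_upwards [hGv.eventually_nhds, hmem, hball] with s hs hsm hsb
    have h1 := (hasDerivAt_re_line (e := e) (mem_of_superset (isOpen_openUpperRect.mem_nhds hsm)
      openUpperRect_subset) (hv.wirt_v _ (openUpperRect_subset hsm))).re_real
    have h2 := ((hGan _ hsb).differentiableAt.hasDerivAt.comp_ofReal).re_real
    have h3 := h1.unique (h2.congr_of_eventuallyEq hs)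
    rw [← h3, ← map_mul, add_re, conj_re, two_mul]
  have hsecond : 2 * (B t * e ^ 2).re - 2 * (lam ^ 2 / 4 * ‖Z1 t‖ ^ 2 * ‖e‖ ^ 2) * (v t).re =
      (deriv (deriv G) 0).re := by
    have h0 : t + ((0 : ℝ) : ℂ) * e = t := by simp
    have hA : HasWirt A (B t) (-(lam ^ 2 / 4) * (Z1 t * (starRingEnd ℂ) (Z1 t)) * v t)
        (upperRect l h) (t + ((0 : ℝ) : ℂ) * e) := by
      rw [h0]; exact hv.wirt_A t ht'
    have h1 := (hasDerivAt_re_line (f := A) (s := 0) (t := t) (e := e)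
      (by rw [h0]; exact mem_of_superset (isOpen_openUpperRect.mem_nhds ht) openUpperRect_subset)
      hA).mul_const (2 * e)
    have h2 := h1.re_real
    have h3 : HasDerivAt (fun s : ℝ => (deriv G s).re) (deriv (deriv G) 0).re 0 := by
      have : HasDerivAt (deriv G) (deriv (deriv G) 0) ((0 : ℝ) : ℂ) := by
        simpa using (hGan.deriv 0 (Metric.mem_ball_self hR)).differentiableAt.hasDerivAt
      exact this.comp_ofReal.re_real
    have h4 := h2.unique (h3.congr_of_eventuallyEq (hfirst.mono fun s hs => by
      beta_reduce
      rw [← hs]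
      simp only [mul_re, mul_im, re_ofNat, im_ofNat]
      ring))
    rw [← h4]
    have hvr : v t = ((v t).re : ℂ) := Complex.ext rfl (by simpa using hv.im_eq t ht')
    have h5 : (B t * e + -((lam : ℂ) ^ 2 / 4) * (Z1 t * (starRingEnd ℂ) (Z1 t)) * v t *
        (starRingEnd ℂ) e) * (2 * e) = 2 * (B t * e ^ 2) -
        ((2 * (lam ^ 2 / 4 * ‖Z1 t‖ ^ 2 * ‖e‖ ^ 2) * (v t).re : ℝ) : ℂ) := by
      push_cast
      rw [← mul_conj', ← mul_conj', ← hvr]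
      ring
    rw [h5, sub_re, ofReal_re]
    simp
  refine ⟨hvt, ?_, ?_⟩
  · have h1 := hfirst.self_of_nhds
    simp only [ofReal_zero, zero_mul, add_zero] at h1
    have h2 := (le_abs_self _).trans ((abs_re_le_norm (deriv G 0)).trans hd1)
    have h3 : 0 ≤ G₀ / R := by positivity
    linarith
  · have h2 := (le_abs_self _).trans ((abs_re_le_norm (deriv (deriv G) 0)).trans hd2)
    have h3 : (v t).re ≤ G₀ := (le_abs_self _).trans ((abs_re_le_norm _).trans hvt)
    have h4 : lam ^ 2 / 4 * ‖Z1 t‖ ^ 2 * ‖e‖ ^ 2 * (v t).re ≤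
        lam ^ 2 / 4 * C ^ 2 * ‖e‖ ^ 2 * G₀ := by
      refine (mul_le_mul_of_nonneg_left h3 (by positivity)).trans ?_
      gcongr
      exact hZ.norm_le1 t (upperRect_subset ht')
    have h5 : ((2 : ℕ).factorial : ℝ) * G₀ / R ^ 2 = 2 * (G₀ / R ^ 2) := by
      norm_num [Nat.factorial]; ring
    rw [h5] at h2
    linarith

end

section

variable {Z Z1 Z2 v A B c g : ℂ → ℂ} {lam l h C N : ℝ}

theorem ofReal_mul_norm_le_of_unit {s e : ℂ} {r : ℝ} (hs : ‖s‖ < r) (he : ‖e‖ = 1) :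
    ‖s * e‖ < r := by
  rwa [norm_mul, he, mul_one]

theorem add_mem_openSymmRect {t z : ℂ} (hlh : h ≤ l) (ht : t ∈ openUpperRect (l / 4) (h / 16))
    (hz : ‖z‖ < h / 16) : t + z ∈ openSymmRect (l / 2) (h / 8) := by
  have h1 := abs_re_le_norm z
  have h2 := abs_im_le_norm z
  have h3 : 0 < h := by linarith [norm_nonneg z]
  constructor
  · rw [add_re]; linarith [abs_add_le t.re z.re, ht.1]
  · rw [add_im, abs_lt]
    have := abs_le.1 (h2.trans hz.le)
    have := abs_lt.1 (h2.trans_lt hz)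
    constructor <;> linarith [ht.2.1, ht.2.2]

theorem symmRect_mono {a b a' b' : ℝ} (ha : a ≤ a') (hb : b ≤ b') : symmRect a b ⊆ symmRect a' b' :=
  fun _ hz => ⟨hz.1.trans ha, hz.2.trans hb⟩

/-- Along each line in the collar, `v` is the real part of a holomorphic function controlled by the
extension `g` of the boundary values. -/
theorem exists_line_extension {t e : ℂ} {g₀ : ℝ} (hZ : CollarMap Z Z1 Z2 l h C)
    (hv : WaveData Z1 v A B lam l h N) (hgc : ContinuousOn g (upperRect l h))
    (hgd : DifferentiableOn ℂ g (openSymmRect l h))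
    (hgb : ∀ z ∈ symmRect (l / 2) (h / 8), ‖g z‖ ≤ g₀)
    (hgv : ∀ z ∈ upperRect l h, z.im = 0 → g z = v z)
    (ht : t ∈ openUpperRect (l / 4) (h / 16)) (he : ‖e‖ = 1) :
    ∃ G : ℂ → ℂ, DifferentiableOn ℂ G (Metric.closedBall 0 (h / 32)) ∧
      (∀ s ∈ Metric.closedBall (0 : ℂ) (h / 32), ‖G s‖ ≤
        g₀ * (1 + lam ^ 2 * C ^ 4 * Real.exp (lam * (2 * C ^ 2)))) ∧
      ∀ᶠ s : ℝ in 𝓝 0, (v (t + s * e)).re = (G s).re := by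
  have hh := hZ.h_pos
  have hlh := hZ.h_le
  have hl := hZ.l_pos
  set U : Set ℂ := Metric.ball 0 (h / 16) with hU
  set p : ℂ → ℂ := fun s => t + s * e with hp
  set w : ℂ → ℂ := fun s => conjFun Z ((starRingEnd ℂ) t + s * (starRingEnd ℂ) e) with hw
  have hpd : Differentiable ℂ p := by fun_prop
  have hsub : symmRect (l / 2) (h / 8) ⊆ openSymmRect l h := fun z hz =>
    ⟨hz.1.trans_lt (by linarith), hz.2.trans_lt (by linarith)⟩
  have hpo : ∀ s ∈ U, p s ∈ openSymmRect (l / 2) (h / 8) := fun s hs =>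
    add_mem_openSymmRect hlh ht (ofReal_mul_norm_le_of_unit (mem_ball_zero_iff.1 hs) he)
  have hpm : ∀ s ∈ U, p s ∈ symmRect (l / 2) (h / 8) := fun s hs => openSymmRect_subset (hpo s hs)
  have hcs : ∀ s : ℂ, (starRingEnd ℂ) t + s * (starRingEnd ℂ) e =
      (starRingEnd ℂ) (p ((starRingEnd ℂ) s)) := fun s => by simp [hp]
  have hcU : ∀ s ∈ U, (starRingEnd ℂ) s ∈ U := fun s hs => by
    rw [hU, mem_ball_zero_iff, norm_conj]; exact mem_ball_zero_iff.1 hs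
  have hqm : ∀ s ∈ U, (starRingEnd ℂ) t + s * (starRingEnd ℂ) e ∈ symmRect l h := fun s hs => by
    rw [hcs]
    exact conj_mem_symmRect (openSymmRect_subset (hsub (hpm _ (hcU s hs))))
  have hwd : DifferentiableOn ℂ w U := fun s hs => by
    have h1 := (hZ.hasDerivAt_conjFun (hqm s hs)).differentiableAt
    refine DifferentiableAt.differentiableWithinAt ?_
    exact DifferentiableAt.comp (f := fun s => (starRingEnd ℂ) t + s * (starRingEnd ℂ) e) s h1
      (by fun_prop)
  have hθm : ∀ s ∈ U, ∀ θ ∈ Icc (0 : ℝ) 1, (θ : ℂ) * p s ∈ symmRect (l / 2) (h / 8) :=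
    fun s hs θ hθ => ofReal_mul_mem_symmRect (hpm s hs) hθ
  have hS : symmRect (l / 2) (h / 8) ⊆ symmRect l h := hsub.trans openSymmRect_subset
  have hFc : ContinuousOn (Function.uncurry fun (s : ℂ) (θ : ℝ) =>
      p s * vekuaKernel Z Z1 lam (θ * p s) (p s) (w s) * g (θ * p s)) (U ×ˢ Icc (0 : ℝ) 1) := by
    have h1 : ContinuousOn (fun q : ℂ × ℝ => p q.1) (U ×ˢ Icc (0 : ℝ) 1) :=
      (hpd.continuous.comp continuous_fst).continuousOn
    have h2 : ContinuousOn (fun q : ℂ × ℝ => (q.2 : ℂ) * p q.1) (U ×ˢ Icc (0 : ℝ) 1) :=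
      ((continuous_ofReal.comp continuous_snd).mul
          (hpd.continuous.comp continuous_fst)).continuousOn
    have h3 : ContinuousOn (fun q : ℂ × ℝ => w q.1) (U ×ˢ Icc (0 : ℝ) 1) :=
      ContinuousOn.comp (g := w) (f := fun q : ℂ × ℝ => q.1) hwd.continuousOn continuousOn_fst
        fun q hq => hq.1
    have h4 := hZ.continuousOn_vekuaKernel lam h2 h1 h3 (fun q hq => hS (hθm _ hq.1 _ hq.2))
      fun q hq => hS (hpm _ hq.1)
    have h5 : ContinuousOn (fun q : ℂ × ℝ => g ((q.2 : ℂ) * p q.1)) (U ×ˢ Icc (0 : ℝ) 1) :=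
      ContinuousOn.comp (g := g) (f := fun q : ℂ × ℝ => (q.2 : ℂ) * p q.1)
        hgd.continuousOn h2 fun q hq => hsub (hθm _ hq.1 _ hq.2)
    exact (h1.mul h4).mul h5
  have hId := differentiableOn_intervalIntegral_param Metric.isOpen_ball hFc fun θ hθ => by
    have hθp : DifferentiableOn ℂ (fun s => (θ : ℂ) * p s) U := (hpd.const_mul _).differentiableOn
    have h4 := hZ.differentiableOn_vekuaKernel lam hθp hpd.differentiableOn hwd
      (fun s hs => hS (hθm s hs θ hθ)) fun s hs => hS (hpm s hs)
    have h5 : DifferentiableOn ℂ (fun s => g ((θ : ℂ) * p s)) U :=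
      DifferentiableOn.comp (g := g) (f := fun s => (θ : ℂ) * p s) hgd hθp
        fun s hs => hsub (hθm s hs θ hθ)
    exact (hpd.differentiableOn.mul h4).mul h5
  have hgp : DifferentiableOn ℂ (fun s => g (p s)) U :=
    DifferentiableOn.comp (g := g) (f := p) hgd hpd.differentiableOn fun s hs => hsub (hpm s hs)
  have hBU : Metric.closedBall (0 : ℂ) (h / 32) ⊆ U :=
    Metric.closedBall_subset_ball (by linarith)
  refine ⟨fun s => g (p s) + ∫ θ in (0 : ℝ)..1,
    p s * vekuaKernel Z Z1 lam (θ * p s) (p s) (w s) * g (θ * p s),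
    (hgp.add hId).mono hBU, fun s hs => ?_, ?_⟩
  · have hs := hBU hs
    have hl0 := hv.lam_pos.le
    have hC := hZ.C_pos
    have hg0 : 0 ≤ g₀ := (norm_nonneg _).trans (hgb _ (hpm s hs))
    refine (norm_add_le _ _).trans ?_
    rw [mul_add, mul_one]
    refine add_le_add (hgb _ (hpm s hs)) ?_
    refine (intervalIntegral.norm_integral_le_of_norm_le_const
      (C := g₀ * (lam ^ 2 * C ^ 4 * Real.exp (lam * (2 * C ^ 2)))) fun θ hθ => ?_).trans (by simp)
    rw [uIoc_of_le zero_le_one] at hθ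
    have hθ := Ioc_subset_Icc_self hθ
    have hσ := hS (hθm s hs θ hθ)
    have hk := norm_vekuaKernel_le (Z := Z) (Z1 := Z1) (σ := θ * p s) (t := p s) (w := w s)
      (r := 2 * C ^ 2) (C := C) hl0 (by positivity) (hZ.norm_sub_le' hσ (hS (hpm s hs)))
      (by rw [hw]
          simp only [conjFun]
          rw [← map_sub, norm_conj]
          exact hZ.norm_sub_le' (conj_mem_symmRect hσ) (conj_mem_symmRect (hqm s hs)))
      (hZ.norm_le1 _ hσ) (hZ.norm_conjFun1_le hσ)
    rw [norm_mul, norm_mul]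
    calc _ ≤ C * (lam ^ 2 / 2 * C * (2 * C ^ 2) * Real.exp (lam * (2 * C ^ 2))) * g₀ := by
          gcongr
          · exact hZ.norm_le (hS (hpm s hs))
          · exact hgb _ (hθm s hs θ hθ)
      _ = _ := by ring
  · have hline : Tendsto (fun s : ℝ => p s) (𝓝 0) (𝓝 t) := by
      have : Continuous fun s : ℝ => p s := hpd.continuous.comp continuous_ofReal
      simpa [hp] using this.tendsto 0
    have htm : t ∈ openUpperRect l h :=
      ⟨ht.1.trans (by linarith), ht.2.1, ht.2.2.trans (by linarith)⟩
    filter_upwards [hline.eventually (isOpen_openUpperRect.mem_nhds htm)] with s hs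
    rw [re_boundary_representation hZ hv hgc hgd hgv hs]
    have : w s = (starRingEnd ℂ) (Z (p s)) := by
      rw [hw]
      simp only [conjFun]
      rw [hcs, conj_conj, conj_ofReal]
    rw [this]

theorem one_add_mul_exp_le (hlam : 0 ≤ lam) (hC : 1 ≤ C) :
    1 + lam ^ 2 * C ^ 4 * Real.exp (lam * (2 * C ^ 2)) ≤ Real.exp (7 * C ^ 3 * (1 + lam)) := by
  have h0 : 0 ≤ lam * C ^ 3 := by positivity
  have h1 := Real.quadratic_le_exp_of_nonneg (x := 2 * (lam * C ^ 3)) (by positivity)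
  have h2 : C ^ 4 ≤ C ^ 6 := pow_le_pow_right₀ hC (by norm_num)
  have h3 : C ^ 2 ≤ C ^ 3 := pow_le_pow_right₀ hC (by norm_num)
  have h4 : 1 ≤ Real.exp (lam * (2 * C ^ 2)) := Real.one_le_exp (by positivity)
  have h5 : lam ^ 2 * C ^ 4 ≤ lam ^ 2 * C ^ 6 := by gcongr
  calc 1 + lam ^ 2 * C ^ 4 * Real.exp (lam * (2 * C ^ 2))
      ≤ (1 + lam ^ 2 * C ^ 4) * Real.exp (lam * (2 * C ^ 2)) := by linarith
    _ ≤ Real.exp (2 * (lam * C ^ 3)) * Real.exp (lam * (2 * C ^ 2)) := by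
        gcongr
        nlinarith
    _ = Real.exp (2 * (lam * C ^ 3) + lam * (2 * C ^ 2)) := (Real.exp_add _ _).symm
    _ ≤ _ := by
        gcongr
        have : lam * C ^ 2 ≤ lam * C ^ 3 := by gcongr
        have : 0 ≤ C ^ 3 := by positivity
        nlinarith

/-- In the collar, `v` and its derivatives are controlled by the geometric mean of the boundary
values and the global bound. -/
theorem collar_bounds {m M : ℝ} (hZ : CollarMap Z Z1 Z2 l h C)
    (hv : WaveData Z1 v A B lam l h N) (hgc : ContinuousOn g (upperRect l h))
    (hgd : DifferentiableOn ℂ g (openSymmRect l h))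
    (hgM : ∀ z ∈ symmRect l h, ‖g z‖ ≤ M) (hgs : ∀ z, ‖g ((starRingEnd ℂ) z)‖ = ‖g z‖)
    (hgv : ∀ z ∈ upperRect l h, z.im = 0 → g z = v z) (hm : 0 < m) (hmM : m ≤ M)
    (hvm : ∀ z ∈ upperRect l h, z.im = 0 → ‖v z‖ ≤ m) {t : ℂ}
    (ht : t ∈ openUpperRect (l / 4) (h / 16)) :
    ‖v t‖ ≤ Real.exp (19 * C ^ 3 * (1 + lam)) * √(m * M) ∧
    ‖A t‖ ≤ Real.exp (19 * C ^ 3 * (1 + lam)) * √(m * M) ∧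
    ‖B t‖ ≤ Real.exp (19 * C ^ 3 * (1 + lam)) * √(m * M) := by
  have hC1 := hZ.one_le
  have hC := hZ.C_pos
  have hh := hZ.h_pos
  have hl0 := hv.lam_pos.le
  set g₀ := √(m * M) with hg₀
  have hg0 : 0 ≤ g₀ := Real.sqrt_nonneg _
  have hup : ∀ z ∈ upperRect (l / 2) (h / 8), ‖g z‖ ≤ g₀ := fun z hz =>
    Real.le_sqrt_of_sq_le (sq_norm_le_of_bottom hZ.h_pos hZ.h_le hm hmM hgc
      (hgd.mono fun z hz => ⟨hz.1, abs_lt.2 ⟨by linarith [hz.2.1, hz.2.2], hz.2.2⟩⟩)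
      (fun z hz => hgM z (upperRect_subset hz))
      (fun z hz h0 => by rw [hgv z hz h0]; exact hvm z hz h0) hz)
  have hgb : ∀ z ∈ symmRect (l / 2) (h / 8), ‖g z‖ ≤ g₀ := fun z hz => by
    rcases le_total 0 z.im with h0 | h0
    · exact hup z ⟨hz.1, h0, (abs_le.1 hz.2).2⟩
    · rw [← hgs]
      exact hup _ ⟨by simpa using hz.1, by simpa using h0, by
        rw [conj_im]; linarith [(abs_le.1 hz.2).1]⟩
  have htm : t ∈ openUpperRect l h :=
    ⟨ht.1.trans (by linarith [hZ.l_pos]), ht.2.1, ht.2.2.trans (by linarith)⟩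
  set G₀ := g₀ * Real.exp (7 * C ^ 3 * (1 + lam)) with hG₀
  have hG0 : 0 ≤ G₀ := by positivity
  have hbd : ∀ e : ℂ, ‖e‖ = 1 → ‖v t‖ ≤ G₀ ∧ (A t * e).re ≤ G₀ / (h / 32) ∧
      (B t * e ^ 2).re ≤ G₀ / (h / 32) ^ 2 + lam ^ 2 / 4 * C ^ 2 * ‖e‖ ^ 2 * G₀ := fun e he => by
    obtain ⟨G, hGd, hGb, hGv⟩ := exists_line_extension hZ hv hgc hgd hgb hgv ht he
    exact collar_bounds_of_line hZ hv htm (by positivity) hGd (fun s hs => (hGb s hs).trans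
      (mul_le_mul_of_nonneg_left (one_add_mul_exp_le hl0 hC1) hg0)) hGv
  have hinv : ∀ x : ℝ, 0 ≤ x → x / (h / 32) ≤ 32 * C * x := fun x hx => by
    have : x / (h / 32) = 32 * x * h⁻¹ := by field_simp
    rw [this]
    nlinarith [mul_le_mul_of_nonneg_left hZ.inv_le hx]
  have hK : 1024 * (1 + lam ^ 2) * C ^ 2 ≤ Real.exp (12 * C ^ 3 * (1 + lam)) := by
    have h1 : C ^ 2 ≤ C ^ 3 := pow_le_pow_right₀ hC1 (by norm_num)
    have h2 : 1 ≤ C ^ 3 := one_le_pow₀ hC1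
    have e1 : (1024 : ℝ) ≤ Real.exp 8 := by
      have := Real.exp_one_gt_d9
      have h8 : Real.exp 8 = Real.exp 1 ^ 8 := by rw [← Real.exp_nat_mul]; norm_num
      rw [h8]
      calc (1024 : ℝ) ≤ 2.7 ^ 8 := by norm_num
        _ ≤ _ := by gcongr; linarith
    have e2 : 1 + lam ^ 2 ≤ Real.exp (2 * lam) := by
      nlinarith [Real.quadratic_le_exp_of_nonneg (x := 2 * lam) (by positivity)]
    have e3 : C ^ 2 ≤ Real.exp (C ^ 3) := by linarith [Real.add_one_le_exp (C ^ 3)]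
    calc 1024 * (1 + lam ^ 2) * C ^ 2 ≤ Real.exp 8 * Real.exp (2 * lam) * Real.exp (C ^ 3) := by
          gcongr
      _ = Real.exp (8 + 2 * lam + C ^ 3) := by rw [← Real.exp_add, ← Real.exp_add]
      _ ≤ _ := by
          gcongr
          have : lam * 1 ≤ lam * C ^ 3 := by gcongr
          nlinarith
  have hfin : 1024 * (1 + lam ^ 2) * C ^ 2 * G₀ ≤ Real.exp (19 * C ^ 3 * (1 + lam)) * g₀ := by
    calc _ ≤ Real.exp (12 * C ^ 3 * (1 + lam)) * G₀ := by gcongr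
      _ = Real.exp (12 * C ^ 3 * (1 + lam)) * Real.exp (7 * C ^ 3 * (1 + lam)) * g₀ := by
          rw [hG₀]; ring
      _ = _ := by rw [← Real.exp_add]; ring_nf
  have hc2 : C ≤ C ^ 2 := by nlinarith
  have hlG : 0 ≤ lam ^ 2 * C ^ 2 * G₀ := by positivity
  have hCG : C * G₀ ≤ C ^ 2 * G₀ := by gcongr
  have h1G : G₀ ≤ C * G₀ := le_mul_of_one_le_left hG0 hC1
  refine ⟨(hbd 1 norm_one).1.trans (le_trans ?_ hfin), ?_, ?_⟩
  · nlinarith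
  · obtain ⟨e, he, hAe⟩ := exists_unit_mul_sq_eq_norm (A t)
    have h1 := (hbd (e ^ 2) (by rw [norm_pow, he, one_pow])).2.1
    rw [hAe, ofReal_re] at h1
    refine (h1.trans (hinv _ hG0)).trans (le_trans ?_ hfin)
    nlinarith
  · obtain ⟨e, he, hBe⟩ := exists_unit_mul_sq_eq_norm (B t)
    have h1 := (hbd e he).2.2
    rw [hBe, ofReal_re, he, one_pow, mul_one] at h1
    have h2 : G₀ / (h / 32) ^ 2 ≤ 1024 * C ^ 2 * G₀ := by
      have h3 := hinv _ (div_nonneg hG0 (by positivity : (0 : ℝ) ≤ h / 32))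
      rw [div_div, ← sq] at h3
      refine h3.trans ?_
      nlinarith [hinv _ hG0]
    refine (h1.trans ?_).trans hfin
    nlinarith

end

open scoped ContDiff Manifold

/-- The derivative of a real function on the complex plane in the direction `v`. -/
noncomputable def pd (v : ℂ) (f : ℂ → ℝ) (z : ℂ) : ℝ := fderiv ℝ f z v

/-- `f` is differentiable at `z`, with derivative `f'` in the direction `v`. -/
def HasPd (v : ℂ) (f : ℂ → ℝ) (f' : ℝ) (z : ℂ) : Prop := DifferentiableAt ℝ f z ∧ pd v f z = f'

namespace HasPd

variable {v z : ℂ} {f g : ℂ → ℝ} {f' g' : ℝ}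

theorem of_differentiableAt (hf : DifferentiableAt ℝ f z) : HasPd v f (pd v f z) z := ⟨hf, rfl⟩

theorem mul (hf : HasPd v f f' z) (hg : HasPd v g g' z) :
    HasPd v (fun z => f z * g z) (f' * g z + f z * g') z := by
  refine ⟨hf.1.mul hg.1, ?_⟩
  rw [pd, fderiv_fun_mul hf.1 hg.1, ← hf.2, ← hg.2]
  simp [pd]
  ring

theorem add (hf : HasPd v f f' z) (hg : HasPd v g g' z) :
    HasPd v (fun z => f z + g z) (f' + g') z := by
  refine ⟨hf.1.add hg.1, ?_⟩
  rw [pd, fderiv_fun_add hf.1 hg.1, ← hf.2, ← hg.2]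
  simp [pd]

theorem sub (hf : HasPd v f f' z) (hg : HasPd v g g' z) :
    HasPd v (fun z => f z - g z) (f' - g') z := by
  refine ⟨hf.1.sub hg.1, ?_⟩
  rw [pd, fderiv_fun_sub hf.1 hg.1, ← hf.2, ← hg.2]
  simp [pd]

theorem const (c : ℝ) : HasPd v (fun _ => c) 0 z := ⟨differentiableAt_const c, by simp [pd]⟩

theorem re : HasPd v Complex.re v.re z := by
  refine ⟨reCLM.differentiableAt, ?_⟩
  rw [pd, show (Complex.re : ℂ → ℝ) = reCLM from rfl, reCLM.fderiv]

theorem congr_of_eventuallyEq (hf : HasPd v f f' z) (h : g =ᶠ[𝓝 z] f) : HasPd v g f' z := by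
  refine ⟨hf.1.congr_of_eventuallyEq h, ?_⟩
  rw [pd, h.fderiv_eq]
  exact hf.2

end HasPd

theorem contDiffAt_pd {f : ℂ → ℝ} {z : ℂ} (v : ℂ) (hf : ContDiffAt ℝ ∞ f z) :
    ContDiffAt ℝ ∞ (pd v f) z := by
  have h1 : ContDiffAt ℝ ∞ (fderiv ℝ f) z := hf.fderiv_right (by simp)
  exact h1.clm_apply contDiffAt_const

theorem differentiableAt_of_contDiffAt {f : ℂ → ℝ} {z : ℂ} (hf : ContDiffAt ℝ ∞ f z) :
    DifferentiableAt ℝ f z := hf.differentiableAt (by simp)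

theorem ContDiffAt.hasPd {f : ℂ → ℝ} {v z : ℂ} (hf : ContDiffAt ℝ ∞ f z) : HasPd v f (pd v f z) z :=
  HasPd.of_differentiableAt (differentiableAt_of_contDiffAt hf)

theorem pd_comm {f : ℂ → ℝ} {z : ℂ} (v w : ℂ) (hf : ContDiffAt ℝ ∞ f z) :
    pd v (pd w f) z = pd w (pd v f) z := by
  have h1 : DifferentiableAt ℝ (fderiv ℝ f) z :=
    (hf.fderiv_right (m := ∞) (by simp)).differentiableAt (by simp)
  have h2 : ∀ a b : ℂ, pd a (pd b f) z = fderiv ℝ (fderiv ℝ f) z a b := fun a b => by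
    have : pd b f = fun y => fderiv ℝ f y b := rfl
    rw [pd, this, fderiv_clm_apply h1 (differentiableAt_const b)]
    simp
  have h3 : IsSymmSndFDerivAt ℝ f z := hf.isSymmSndFDerivAt (by
    rw [minSmoothness_of_isRCLikeNormedField]
    exact WithTop.coe_le_coe.2 (le_top : (2 : ℕ∞) ≤ ⊤))
  rw [h2, h2, h3.eq]

/-- Smooth compactly supported real functions on the plane. -/
structure TestFun (f : ℂ → ℝ) : Prop where
  smooth : ContDiff ℝ ∞ f
  compact : HasCompactSupport f

namespace TestFun

variable {f g : ℂ → ℝ}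

theorem hasPd (hf : TestFun f) (v z : ℂ) : HasPd v f (_root_.pd v f z) z :=
  hf.smooth.contDiffAt.hasPd

theorem pd (hf : TestFun f) (v : ℂ) : TestFun (pd v f) where
  smooth := contDiff_iff_contDiffAt.2 fun _ => contDiffAt_pd v hf.smooth.contDiffAt
  compact := hf.compact.fderiv_apply ℝ v

theorem add (hf : TestFun f) (hg : TestFun g) : TestFun fun z => f z + g z :=
  ⟨hf.smooth.add hg.smooth, hf.compact.add hg.compact⟩

theorem sub (hf : TestFun f) (hg : TestFun g) : TestFun fun z => f z - g z :=
  ⟨hf.smooth.sub hg.smooth, hf.compact.sub hg.compact⟩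

theorem smooth_mul (hf : ContDiff ℝ ∞ f) (hg : TestFun g) : TestFun fun z => f z * g z :=
  ⟨hf.mul hg.smooth, hg.compact.mul_left⟩

theorem mul (hf : TestFun f) (hg : TestFun g) : TestFun fun z => f z * g z :=
  smooth_mul hf.smooth hg

theorem re_mul (hg : TestFun g) : TestFun fun z => z.re * g z :=
  smooth_mul reCLM.contDiff hg

theorem const_mul (c : ℝ) (hg : TestFun g) : TestFun fun z => c * g z :=
  smooth_mul contDiff_const hg

theorem integrable (hf : TestFun f) : Integrable f :=
  hf.smooth.continuous.integrable_of_hasCompactSupport hf.compact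

theorem integral_pd (hf : TestFun f) (v : ℂ) : ∫ z, _root_.pd v f z = 0 := by
  have hI : Integrable fun z => fderiv ℝ f z v := (hf.pd v).integrable
  have := integral_mul_fderiv_eq_neg_fderiv_mul_of_integrable (μ := (volume : Measure ℂ))
    (f := fun _ : ℂ => (1 : ℝ)) (g := f) (v := v) (by simp)
    (by simpa using hI) (by simpa using hf.integrable)
    (fun _ _ => differentiableAt_const _) fun z _ => differentiableAt_of_contDiffAt
      hf.smooth.contDiffAt
  simpa [_root_.pd] using this

end TestFun

section Energy

variable {w f : ℂ → ℝ} {lam R : ℝ}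

theorem integral_rellich_eq_zero (hw : TestFun w)
    (hf : ∀ z, f z = pd 1 (pd 1 w) z + pd I (pd I w) z + lam ^ 2 * w z) :
    ∫ z, (f z * (2 * z.re * pd 1 w z + w z) + 2 * pd 1 w z ^ 2) = 0 := by
  have hw1 := hw.pd 1
  have hw2 := hw.pd I
  have hP : TestFun fun z => z.re * (pd 1 w z * pd 1 w z) + w z * pd 1 w z -
      z.re * (pd I w z * pd I w z) + lam ^ 2 * (z.re * (w z * w z)) :=
    ((((hw1.mul hw1).re_mul).add (hw.mul hw1)).sub (hw2.mul hw2).re_mul).add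
      ((hw.mul hw).re_mul.const_mul _)
  have hQ : TestFun fun z => 2 * (z.re * (pd 1 w z * pd I w z)) + w z * pd I w z :=
    ((hw1.mul hw2).re_mul.const_mul _).add (hw.mul hw2)
  have h1 : ∀ z, f z * (2 * z.re * pd 1 w z + w z) + 2 * pd 1 w z ^ 2 =
      pd 1 (fun z => z.re * (pd 1 w z * pd 1 w z) + w z * pd 1 w z -
        z.re * (pd I w z * pd I w z) + lam ^ 2 * (z.re * (w z * w z))) z +
      pd I (fun z => 2 * (z.re * (pd 1 w z * pd I w z)) + w z * pd I w z) z := fun z => by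
    have a1 := hw1.hasPd 1 z
    have a2 := hw2.hasPd 1 z
    have a := hw.hasPd 1 z
    have b1 := hw1.hasPd I z
    have b2 := hw2.hasPd I z
    have b := hw.hasPd I z
    rw [((((HasPd.re.mul (a1.mul a1)).add (a.mul a1)).sub (HasPd.re.mul (a2.mul a2))).add
      ((HasPd.const (lam ^ 2)).mul (HasPd.re.mul (a.mul a)))).2,
      (((HasPd.const 2).mul (HasPd.re.mul (b1.mul b2))).add (b.mul b2)).2, hf,
      pd_comm I 1 hw.smooth.contDiffAt]
    simp only [one_re, I_re]
    ring
  simp_rw [h1]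
  rw [integral_add (hP.pd 1).integrable (hQ.pd I).integrable, hP.integral_pd, hQ.integral_pd,
    add_zero]

theorem integral_sq_add_eq_zero (hw : TestFun w) :
    ∫ z, (w z ^ 2 + 2 * (z.re * (w z * pd 1 w z))) = 0 := by
  rw [← ((hw.mul hw).re_mul).integral_pd 1]
  congr 1 with z
  rw [(HasPd.re.mul ((hw.hasPd 1 z).mul (hw.hasPd 1 z))).2]
  simp only [one_re]
  ring

theorem integral_det_eq_zero (hw : TestFun w) :
    ∫ z, (pd 1 (pd 1 w) z * pd I (pd I w) z - pd 1 (pd I w) z ^ 2) = 0 := by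
  have hw1 := hw.pd 1
  have hw2 := hw.pd I
  have hP := hw1.mul (hw2.pd I)
  have hQ := hw1.mul (hw2.pd 1)
  have h1 : ∀ z, pd 1 (pd 1 w) z * pd I (pd I w) z - pd 1 (pd I w) z ^ 2 =
      pd 1 (fun z => pd 1 w z * pd I (pd I w) z) z -
      pd I (fun z => pd 1 w z * pd 1 (pd I w) z) z := fun z => by
    rw [((hw1.hasPd 1 z).mul ((hw2.pd I).hasPd 1 z)).2,
      ((hw1.hasPd I z).mul ((hw2.pd 1).hasPd I z)).2, pd_comm I 1 hw.smooth.contDiffAt,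
      pd_comm I 1 hw2.smooth.contDiffAt]
    ring
  simp_rw [h1]
  rw [integral_sub (hP.pd 1).integrable (hQ.pd I).integrable, hP.integral_pd, hQ.integral_pd,
    sub_zero]

theorem integral_sq_mixed_le (hw : TestFun w) (hR : 0 < R)
    (hs : ∀ z ∈ tsupport w, |z.re| ≤ R)
    (hf : ∀ z, f z = pd 1 (pd 1 w) z + pd I (pd I w) z + lam ^ 2 * w z) :
    ∫ z, pd 1 (pd I w) z ^ 2 ≤ (1 + 16 * R ^ 4 * lam ^ 4) * ∫ z, f z ^ 2 := by
  have hw1 := hw.pd 1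
  have hw2 := hw.pd I
  have hfT : TestFun f := by
    have : f = fun z => pd 1 (pd 1 w) z + pd I (pd I w) z + lam ^ 2 * w z := funext hf
    rw [this]
    exact ((hw1.pd 1).add (hw2.pd I)).add (hw.const_mul _)
  have iw : Integrable fun z => w z ^ 2 := by simpa [sq] using (hw.mul hw).integrable
  have iw1 : Integrable fun z => pd 1 w z ^ 2 := by simpa [sq] using (hw1.mul hw1).integrable
  have if2 : Integrable fun z => f z ^ 2 := by simpa [sq] using (hfT.mul hfT).integrable
  have i12 : Integrable fun z => pd 1 (pd I w) z ^ 2 := by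
    simpa [sq] using ((hw2.pd 1).mul (hw2.pd 1)).integrable
  have hdet := integral_det_eq_zero hw
  have idet : Integrable fun z => pd 1 (pd 1 w) z * pd I (pd I w) z - pd 1 (pd I w) z ^ 2 :=
    (((hw1.pd 1).mul (hw2.pd I)).integrable).sub i12
  have hre := integral_rellich_eq_zero hw hf
  have ire : Integrable fun z => f z * (2 * z.re * pd 1 w z + w z) + 2 * pd 1 w z ^ 2 := by
    have h1 : TestFun fun z => 2 * z.re * pd 1 w z + w z := by
      have := (hw1.re_mul.const_mul 2).add hw
      simpa only [← mul_assoc] using this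
    exact (hfT.mul h1).integrable.add (iw1.const_mul 2)
  have hpo := integral_sq_add_eq_zero hw
  have ipo : Integrable fun z => w z ^ 2 + 2 * (z.re * (w z * pd 1 w z)) :=
    iw.add ((hw.mul hw1).re_mul.integrable.const_mul 2)
  have hxw1 : ∀ z, z.re ^ 2 * pd 1 w z ^ 2 ≤ R ^ 2 * pd 1 w z ^ 2 := fun z => by
    by_cases hz : z ∈ tsupport w
    · have : z.re ^ 2 ≤ R ^ 2 := sq_le_sq.2 (by rw [abs_of_pos hR]; exact hs z hz)
      gcongr
    · have : pd 1 w z = 0 := by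
        rw [pd, Function.notMem_support.1 fun h => hz (support_fderiv_subset ℝ h)]
        simp
      simp [this]
  have e1 : ∫ z, w z ^ 2 ≤ 4 * R ^ 2 * ∫ z, pd 1 w z ^ 2 := by
    have h1 : ∫ z, (w z ^ 2 - 4 * R ^ 2 * pd 1 w z ^ 2) ≤
        ∫ z, 2 * (w z ^ 2 + 2 * (z.re * (w z * pd 1 w z))) := by
      refine integral_mono (iw.sub (iw1.const_mul _)) (ipo.const_mul _) fun z => ?_
      beta_reduce
      nlinarith [sq_nonneg (w z + 2 * z.re * pd 1 w z), hxw1 z]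
    rw [integral_const_mul, hpo, integral_sub iw (iw1.const_mul _), integral_const_mul] at h1
    linarith
  have e2 : ∫ z, pd 1 w z ^ 2 ≤ 4 * R ^ 2 * ∫ z, f z ^ 2 := by
    have iA : Integrable fun z => 1 / 2 * pd 1 w z ^ 2 + 4 * R ^ 2 * f z ^ 2 :=
      (iw1.const_mul _).add (if2.const_mul _)
    have iB : Integrable fun z => 1 / 2 * pd 1 w z ^ 2 + 4 * R ^ 2 * f z ^ 2 +
        1 / (8 * R ^ 2) * w z ^ 2 := iA.add (iw.const_mul _)
    have h1 : ∫ z, (2 * pd 1 w z ^ 2 - (1 / 2 * pd 1 w z ^ 2 + 4 * R ^ 2 * f z ^ 2 +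
        1 / (8 * R ^ 2) * w z ^ 2)) ≤
        ∫ z, (f z * (2 * z.re * pd 1 w z + w z) + 2 * pd 1 w z ^ 2) := by
      refine integral_mono ((iw1.const_mul _).sub iB) ire fun z => ?_
      beta_reduce
      have k1 : 0 ≤ 2 * R ^ 2 * f z ^ 2 + f z * w z + 1 / (8 * R ^ 2) * w z ^ 2 := by
        have : 2 * R ^ 2 * f z ^ 2 + f z * w z + 1 / (8 * R ^ 2) * w z ^ 2 =
          2 * (R * f z + 1 / (4 * R) * w z) ^ 2 := by field_simp; ring
        rw [this]; positivity
      have k2 : 0 ≤ 2 * R ^ 2 * f z ^ 2 + 2 * z.re * f z * pd 1 w z + 1 / 2 * pd 1 w z ^ 2 := by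
        by_cases h0 : pd 1 w z = 0
        · rw [h0, mul_zero, add_zero]; positivity
        · have : z.re ^ 2 ≤ R ^ 2 := by
            have h3 : 0 < pd 1 w z ^ 2 := by positivity
            exact le_of_mul_le_mul_right (hxw1 z) h3
          nlinarith [sq_nonneg (2 * z.re * f z + pd 1 w z), sq_nonneg (f z),
            mul_le_mul_of_nonneg_right this (sq_nonneg (f z))]
      linarith
    rw [hre, integral_sub (iw1.const_mul _) iB, integral_add iA (iw.const_mul _),
      integral_add (iw1.const_mul _) (if2.const_mul _), integral_const_mul, integral_const_mul,
      integral_const_mul, integral_const_mul] at h1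
    have h2 : 1 / (8 * R ^ 2) * ∫ z, w z ^ 2 ≤ 1 / 2 * ∫ z, pd 1 w z ^ 2 := by
      calc _ ≤ 1 / (8 * R ^ 2) * (4 * R ^ 2 * ∫ z, pd 1 w z ^ 2) := by gcongr
        _ = _ := by field_simp; ring
    linarith
  have e3 : ∫ z, (2 * pd 1 (pd I w) z ^ 2 +
      2 * (pd 1 (pd 1 w) z * pd I (pd I w) z - pd 1 (pd I w) z ^ 2)) ≤
      ∫ z, (2 * f z ^ 2 + 2 * lam ^ 4 * w z ^ 2) := by
    refine integral_mono ((i12.const_mul _).add (idet.const_mul _))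
      ((if2.const_mul _).add (iw.const_mul _)) fun z => ?_
    beta_reduce
    have : pd 1 (pd 1 w) z + pd I (pd I w) z = f z - lam ^ 2 * w z := by rw [hf]; ring
    nlinarith [sq_nonneg (pd 1 (pd 1 w) z), sq_nonneg (pd I (pd I w) z),
      sq_nonneg (f z + lam ^ 2 * w z), congrArg (· ^ 2) this]
  rw [integral_add (i12.const_mul _) (idet.const_mul _), integral_const_mul, integral_const_mul,
    hdet, integral_add (if2.const_mul _) (iw.const_mul _), integral_const_mul,
    integral_const_mul] at e3
  have e4 : ∫ z, w z ^ 2 ≤ 16 * R ^ 4 * ∫ z, f z ^ 2 := by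
    calc _ ≤ 4 * R ^ 2 * ∫ z, pd 1 w z ^ 2 := e1
      _ ≤ 4 * R ^ 2 * (4 * R ^ 2 * ∫ z, f z ^ 2) := by gcongr
      _ = _ := by ring
  have e5 := mul_le_mul_of_nonneg_left e4 (by positivity : 0 ≤ 2 * lam ^ 4)
  linarith

end Energy

namespace TestFun

variable {w f : ℂ → ℝ} {lam R F : ℝ}

theorem enorm_le_lintegral_line (hw : TestFun w) (c : ℂ) {u : ℂ} (hu : ‖u‖ = 1) (s : ℝ) :
    ‖w (c + s * u)‖ₑ ≤ ∫⁻ y : ℝ, ‖_root_.pd u w (c + y * u)‖ₑ := by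
  have hiso : Isometry fun s : ℝ => c + (s : ℂ) * u := by
    refine Isometry.of_dist_eq fun x y => ?_
    rw [dist_add_left, dist_eq_norm, ← sub_mul, norm_mul, hu, mul_one, ← ofReal_sub, norm_real,
      dist_eq_norm]
  have hcd : ContDiff ℝ 1 fun s : ℝ => w (c + (s : ℂ) * u) := by
    refine ContDiff.comp (g := w) (f := fun s : ℝ => c + (s : ℂ) * u)
      (hw.smooth.of_le (by exact mod_cast le_top)) ?_
    exact contDiff_const.add (ofRealCLM.contDiff.mul contDiff_const)
  have hcs : HasCompactSupport fun s : ℝ => w (c + (s : ℂ) * u) :=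
    hw.compact.comp_isClosedEmbedding hiso.isClosedEmbedding
  have hder : ∀ s : ℝ, deriv (fun s : ℝ => w (c + (s : ℂ) * u)) s =
      _root_.pd u w (c + (s : ℂ) * u) := fun s => by
    have h1 : HasDerivAt (fun s : ℝ => c + (s : ℂ) * u) u s := by
      simpa using ((hasDerivAt_id s).ofReal_comp.mul_const u).const_add c
    exact ((hw.hasPd u (c + (s : ℂ) * u)).1.hasFDerivAt.comp_hasDerivAt s h1).deriv
  refine (HasCompactSupport.enorm_le_lintegral_Ici_deriv hcd hcs s).trans ?_
  simp_rw [hder]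
  exact setLIntegral_le_lintegral _ _

theorem lintegral_eq_iterated {F : ℂ → ENNReal} (hF : Continuous F) :
    ∫⁻ y : ℝ, ∫⁻ x : ℝ, F (x + y * I) = ∫⁻ z, F z := by
  rw [← (volume_preserving_equiv_real_prod.symm).lintegral_comp hF.measurable,
    Measure.volume_eq_prod, lintegral_prod_symm']
  · congr 1 with y
    congr 1 with x
    congr 1
    apply Complex.ext <;> simp
  · exact hF.measurable.comp measurableEquivRealProd.symm.measurable

theorem abs_le_integral_mixed (hw : TestFun w) (z : ℂ) :
    |w z| ≤ ∫ z, |_root_.pd 1 (_root_.pd I w) z| := by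
  have hw2 := hw.pd I
  have h1 : ‖w z‖ₑ ≤ ∫⁻ z, ‖_root_.pd 1 (_root_.pd I w) z‖ₑ := by
    rw [← lintegral_eq_iterated (hw2.pd 1).smooth.continuous.enorm]
    have := hw.enorm_le_lintegral_line z.re (u := I) (by simp) z.im
    rw [re_add_im] at this
    refine this.trans (lintegral_mono fun y => ?_)
    have := hw2.enorm_le_lintegral_line (y * I) (u := 1) (by simp) z.re
    simp only [mul_one] at this
    rw [add_comm] at this
    refine this.trans_eq ?_
    simp_rw [add_comm]
  have h2 := ofReal_integral_norm_eq_lintegral_enorm (hw2.pd 1).integrable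
  rw [← h2, ← ofReal_norm] at h1
  exact (ENNReal.ofReal_le_ofReal_iff (integral_nonneg fun _ => norm_nonneg _)).1 h1

/-- A uniform bound for compactly supported solutions of the inhomogeneous Helmholtz equation. -/
theorem abs_le_of_helmholtz (hw : TestFun w) (hR : 0 < R) (hF : 0 < F)
    (hs : tsupport w ⊆ Metric.closedBall 0 R)
    (hf : ∀ z, f z = _root_.pd 1 (_root_.pd 1 w) z + _root_.pd I (_root_.pd I w) z + lam ^ 2 * w z)
    (hfF : ∀ z, |f z| ≤ F) (z : ℂ) :
    |w z| ≤ volume.real (Metric.closedBall (0 : ℂ) R) * F * (1 + 8 * R ^ 4 * lam ^ 4) := by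
  set S := Metric.closedBall (0 : ℂ) R with hS
  have hSm : MeasurableSet S := Metric.isClosed_closedBall.measurableSet
  have hSf : volume S ≠ ⊤ := (isCompact_closedBall (0 : ℂ) R).measure_ne_top
  have hw2 := hw.pd I
  have hw12 := hw2.pd 1
  have hout : ∀ z ∉ S, _root_.pd 1 (_root_.pd I w) z = 0 := fun z hz => by
    by_contra h0
    have h1 : z ∈ tsupport (_root_.pd I w) := support_fderiv_subset ℝ (fun h => h0 (by
      rw [_root_.pd, h]; simp))
    exact hz (hs (tsupport_fderiv_apply_subset ℝ I h1))
  have hfT : TestFun f := by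
    have : f = fun z => _root_.pd 1 (_root_.pd 1 w) z + _root_.pd I (_root_.pd I w) z +
      lam ^ 2 * w z := funext hf
    rw [this]
    exact (((hw.pd 1).pd 1).add (hw2.pd I)).add (hw.const_mul _)
  have hfout : ∀ z ∉ S, f z = 0 := fun z hz => by
    have hz' : z ∉ tsupport w := fun h => hz (hs h)
    have h0 : w =ᶠ[𝓝 z] fun _ => 0 := by
      filter_upwards [(isClosed_tsupport w).isOpen_compl.mem_nhds hz'] with y hy
      exact image_eq_zero_of_notMem_tsupport hy
    have h1 : ∀ v, _root_.pd v w =ᶠ[𝓝 z] fun _ => 0 := fun v => by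
      filter_upwards [h0.eventually_nhds] with y hy
      rw [_root_.pd, Filter.EventuallyEq.fderiv_eq hy]; simp
    have h2 : ∀ v, _root_.pd v (_root_.pd v w) z = 0 := fun v => by
      rw [_root_.pd, (h1 v).fderiv_eq]; simp
    rw [hf, h2, h2, h0.self_of_nhds]; simp
  have i12 : Integrable fun z => _root_.pd 1 (_root_.pd I w) z ^ 2 := by
    simpa [sq] using (hw12.mul hw12).integrable
  have if2 : Integrable fun z => f z ^ 2 := by simpa [sq] using (hfT.mul hfT).integrable
  have iS : ∀ c : ℝ, Integrable (S.indicator fun _ => c) := fun c =>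
    (integrable_indicator_iff hSm).2 (integrableOn_const hSf)
  have IS : ∀ c : ℝ, ∫ z, S.indicator (fun _ => c) z = volume.real S * c := fun c => by
    rw [integral_indicator hSm, setIntegral_const, smul_eq_mul]
  have hf2 : ∫ z, f z ^ 2 ≤ volume.real S * F ^ 2 := by
    rw [← IS]
    refine integral_mono if2 (iS _) fun z => ?_
    by_cases hz : z ∈ S
    · simp only [hz, indicator_of_mem]
      exact sq_le_sq.2 (by rw [abs_of_pos hF]; exact hfF z)
    · simp [hz, hfout z hz]
  have hmix := integral_sq_mixed_le (lam := lam) hw hR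
    (fun z hz => (abs_re_le_norm z).trans (mem_closedBall_zero_iff.1 (hs hz))) hf
  refine (hw.abs_le_integral_mixed z).trans ?_
  have h1 : ∫ z, |_root_.pd 1 (_root_.pd I w) z| ≤
      ∫ z, (1 / (2 * F) * _root_.pd 1 (_root_.pd I w) z ^ 2 + S.indicator (fun _ => F / 2) z) := by
    refine integral_mono hw12.integrable.abs ((i12.const_mul _).add (iS _)) fun z => ?_
    beta_reduce
    by_cases hz : z ∈ S
    · simp only [hz, indicator_of_mem]
      set a := _root_.pd 1 (_root_.pd I w) z
      have : 1 / (2 * F) * a ^ 2 + F / 2 - |a| = 1 / (2 * F) * (|a| - F) ^ 2 := by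
        rw [← sq_abs a]; field_simp; ring
      have h0 : 0 ≤ 1 / (2 * F) * (|a| - F) ^ 2 := by positivity
      linarith
    · simp [hz, hout z hz]
  rw [integral_add (i12.const_mul _) (iS _), integral_const_mul, IS] at h1
  refine h1.trans ?_
  calc _ ≤ 1 / (2 * F) * ((1 + 16 * R ^ 4 * lam ^ 4) * (volume.real S * F ^ 2)) +
        volume.real S * (F / 2) := by
        gcongr
        exact hmix.trans (by gcongr)
    _ = _ := by field_simp; ring

end TestFun

theorem exists_cutoff {Ω K : Set ℂ} (hΩ : IsOpen Ω) (hK : IsCompact K) (hKΩ : K ⊆ Ω) :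
    ∃ χ : ℂ → ℝ, TestFun χ ∧ tsupport χ ⊆ Ω ∧ (∀ z ∈ K, ∀ᶠ y in 𝓝 z, χ y = 1) ∧
      ∀ z, χ z ∈ Icc (0 : ℝ) 1 := by
  obtain ⟨K', hK', hKK', hK'Ω⟩ := exists_compact_between hK hΩ hKΩ
  obtain ⟨f, h1, h0, hI⟩ := exists_contMDiffMap_one_nhds_of_subset_interior (n := (⊤ : ℕ∞))
    𝓘(ℝ, ℂ) hK.isClosed hKK'
  have hsupp : tsupport f ⊆ K' := closure_minimal (fun z hz => by
    by_contra hz'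
    exact hz (h0 z hz')) hK'.isClosed
  refine ⟨f, ⟨f.contMDiff.contDiff, ?_⟩, hsupp.trans hK'Ω, fun z hz => ?_, hI⟩
  · exact hK'.of_isClosed_subset (isClosed_tsupport _) hsupp
  · exact h1.filter_mono (nhds_le_nhdsSet hz)

theorem hasPd_pd_mul {χ ψ : ℂ → ℝ} {z : ℂ} (v : ℂ) (hχ : ContDiff ℝ ∞ χ)
    (hψ : ContDiffAt ℝ ∞ ψ z) :
    HasPd v (pd v fun z => χ z * ψ z)
      (pd v (pd v χ) z * ψ z + 2 * (pd v χ z * pd v ψ z) + χ z * pd v (pd v ψ) z) z := by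
  have hev : pd v (fun z => χ z * ψ z) =ᶠ[𝓝 z] fun z => pd v χ z * ψ z + χ z * pd v ψ z := by
    filter_upwards [(hψ.of_le (m := 1) (by exact mod_cast le_top)).eventually (by simp)] with y hy
    exact ((hχ.contDiffAt.hasPd (v := v) (z := y)).mul
      (HasPd.of_differentiableAt (hy.differentiableAt one_ne_zero))).2
  have h1 := (contDiffAt_pd v (hχ.contDiffAt (x := z))).hasPd (v := v)
  have h2 := (contDiffAt_pd v hψ).hasPd (v := v)
  have h3 := ((h1.mul (hψ.hasPd (v := v))).add ((hχ.contDiffAt.hasPd (v := v)).mul h2))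
  have h4 := h3.congr_of_eventuallyEq hev
  refine ⟨h4.1, h4.2.trans ?_⟩
  ring

theorem pd_eq_zero_of_eventually_const {f : ℂ → ℝ} {z : ℂ} {c : ℝ} (v : ℂ)
    (h : ∀ᶠ y in 𝓝 z, f y = c) : ∀ᶠ y in 𝓝 z, pd v f y = 0 := by
  filter_upwards [h.eventually_nhds] with y hy
  have : f =ᶠ[𝓝 y] fun _ => c := hy
  rw [pd, this.fderiv_eq]; simp

/-- Solutions of the Helmholtz equation are controlled in the interior by their values and first
derivatives near the boundary. -/
theorem interior_bound {Ω W : Set ℂ} (hΩ : IsOpen Ω) (hb : Bornology.IsBounded Ω) (hW : IsOpen W)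
    (hfr : frontier Ω ⊆ W) :
    ∃ C : ℝ, 1 ≤ C ∧ ∀ (lam : ℝ) (ψ : ℂ → ℝ), (∀ z ∈ Ω, ContDiffAt ℝ ∞ ψ z) →
      (∀ z ∈ Ω, pd 1 (pd 1 ψ) z + pd I (pd I ψ) z + lam ^ 2 * ψ z = 0) →
      ∀ S : ℝ, 0 < S → (∀ z ∈ Ω ∩ W, |ψ z| ≤ S ∧ |pd 1 ψ z| ≤ S ∧ |pd I ψ z| ≤ S) →
      ∀ z ∈ Ω, |ψ z| ≤ C * (1 + lam ^ 4) * S := by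
  have hKc : IsCompact (closure Ω \ W) := hb.isCompact_closure.diff hW
  have hKΩ : closure Ω \ W ⊆ Ω := fun z hz => by
    by_contra h
    exact hz.2 (hfr ⟨hz.1, by rwa [hΩ.interior_eq]⟩)
  obtain ⟨χ, hχ, hχs, hχ1, hχI⟩ := exists_cutoff hΩ hKc hKΩ
  obtain ⟨R₀, hR₀⟩ := hb.subset_closedBall 0
  set R := max R₀ 1 with hR
  have hR0 : 0 < R := zero_lt_one.trans_le (le_max_right _ _)
  have hΩR : Ω ⊆ Metric.closedBall 0 R :=
    hR₀.trans (Metric.closedBall_subset_closedBall (le_max_left _ _))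
  have hbd : ∀ f : ℂ → ℝ, TestFun f → ∃ c, ∀ z, |f z| ≤ c := fun f hf =>
    hf.compact.exists_bound_of_continuous hf.smooth.continuous
  obtain ⟨c1, hc1⟩ := hbd _ (hχ.pd 1)
  obtain ⟨c2, hc2⟩ := hbd _ (hχ.pd I)
  obtain ⟨c3, hc3⟩ := hbd _ ((hχ.pd 1).pd 1)
  obtain ⟨c4, hc4⟩ := hbd _ ((hχ.pd I).pd I)
  have hc0 := And.intro (And.intro ((abs_nonneg _).trans (hc1 0)) ((abs_nonneg _).trans (hc2 0)))
    (And.intro ((abs_nonneg _).trans (hc3 0)) ((abs_nonneg _).trans (hc4 0)))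
  set c := 1 + c3 + c4 + 2 * c1 + 2 * c2 with hc
  have hcp : 0 < c := by linarith [hc0.1.1, hc0.1.2, hc0.2.1, hc0.2.2]
  set a := volume.real (Metric.closedBall (0 : ℂ) R) with ha
  have ha0 : 0 ≤ a := measureReal_nonneg
  refine ⟨1 + a * c * (1 + 8 * R ^ 4), le_add_of_nonneg_right (by positivity),
    fun lam ψ hψ hpde S hS hWS z hz => ?_⟩
  by_cases hzW : z ∈ W
  · refine (hWS z ⟨hz, hzW⟩).1.trans (le_mul_of_one_le_left hS.le ?_)
    have h1 : 1 ≤ 1 + a * c * (1 + 8 * R ^ 4) := le_add_of_nonneg_right (by positivity)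
    have h2 : 0 ≤ lam ^ 4 := by positivity
    nlinarith
  set w : ℂ → ℝ := fun z => χ z * ψ z with hw
  have hsupp : tsupport w ⊆ tsupport χ := tsupport_mul_subset_left
  have hwT : TestFun w := by
    refine ⟨contDiff_iff_contDiffAt.2 fun y => ?_, hχ.compact.mul_right⟩
    by_cases hy : y ∈ Ω
    · exact hχ.smooth.contDiffAt.mul (hψ y hy)
    · have : w =ᶠ[𝓝 y] fun _ => 0 := by
        filter_upwards [(isClosed_tsupport χ).isOpen_compl.mem_nhds fun h => hy (hχs h)] with x hx
        simp [hw, image_eq_zero_of_notMem_tsupport hx]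
      exact contDiffAt_const.congr_of_eventuallyEq this
  have hfF : ∀ y, |pd 1 (pd 1 w) y + pd I (pd I w) y + lam ^ 2 * w y| ≤ c * S := fun y => by
    have hcS : 0 ≤ c * S := by positivity
    by_cases hy : y ∈ Ω
    · rw [(hasPd_pd_mul 1 hχ.smooth (hψ y hy)).2, (hasPd_pd_mul I hχ.smooth (hψ y hy)).2]
      have hp := hpde y hy
      have hval : pd 1 (pd 1 χ) y * ψ y + 2 * (pd 1 χ y * pd 1 ψ y) + χ y * pd 1 (pd 1 ψ) y +
          (pd I (pd I χ) y * ψ y + 2 * (pd I χ y * pd I ψ y) + χ y * pd I (pd I ψ) y) +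
          lam ^ 2 * w y = pd 1 (pd 1 χ) y * ψ y + pd I (pd I χ) y * ψ y +
          2 * (pd 1 χ y * pd 1 ψ y) + 2 * (pd I χ y * pd I ψ y) := by
        rw [hw]
        linear_combination χ y * hp
      rw [hval]
      by_cases hyW : y ∈ W
      · obtain ⟨b0, b1, b2⟩ := hWS y ⟨hy, hyW⟩
        have hm : ∀ p q r : ℝ, |p| ≤ r → |q| ≤ S → |p * q| ≤ r * S := fun p q r h1 h2 => by
          rw [abs_mul]
          exact mul_le_mul h1 h2 (abs_nonneg _) ((abs_nonneg _).trans h1)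
        have k1 := abs_le.1 (hm _ _ _ (hc3 y) b0)
        have k2 := abs_le.1 (hm _ _ _ (hc4 y) b0)
        have k3 := abs_le.1 (hm _ _ _ (hc1 y) b1)
        have k4 := abs_le.1 (hm _ _ _ (hc2 y) b2)
        rw [hc, abs_le]
        constructor <;> nlinarith
      · have h1 := hχ1 y ⟨subset_closure hy, hyW⟩
        have h2 := fun v => pd_eq_zero_of_eventually_const v h1
        have h3 := fun v => (pd_eq_zero_of_eventually_const v (h2 v)).self_of_nhds
        rw [h3, h3, (h2 1).self_of_nhds, (h2 I).self_of_nhds]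
        simpa using hcS
    · have h1 : ∀ᶠ x in 𝓝 y, w x = 0 := by
        filter_upwards [(isClosed_tsupport χ).isOpen_compl.mem_nhds fun h => hy (hχs h)] with x hx
        simp [hw, image_eq_zero_of_notMem_tsupport hx]
      have h2 := fun v => pd_eq_zero_of_eventually_const v h1
      have h3 := fun v => (pd_eq_zero_of_eventually_const v (h2 v)).self_of_nhds
      rw [h3, h3, h1.self_of_nhds]
      simpa using hcS
  have hfin := hwT.abs_le_of_helmholtz (lam := lam) hR0 (by positivity : 0 < c * S)
    ((hsupp.trans hχs).trans hΩR) (fun _ => rfl) hfF z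
  have hwz : w z = ψ z := by
    rw [hw]
    simp [(hχ1 z ⟨subset_closure hz, hzW⟩).self_of_nhds]
  rw [hwz] at hfin
  refine hfin.trans ?_
  have hl4 : 0 ≤ lam ^ 4 := by positivity
  have h8 : 1 + 8 * R ^ 4 * lam ^ 4 ≤ (1 + 8 * R ^ 4) * (1 + lam ^ 4) := by
    have : 0 ≤ R ^ 4 := by positivity
    nlinarith
  calc a * (c * S) * (1 + 8 * R ^ 4 * lam ^ 4) ≤
      a * (c * S) * ((1 + 8 * R ^ 4) * (1 + lam ^ 4)) := by gcongr
    _ ≤ _ := by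
      have : 0 ≤ (1 + lam ^ 4) * S := by positivity
      nlinarith

/-- The Wirtinger derivative `∂φ` of a real function. -/
noncomputable def dz (φ : ℂ → ℝ) (z : ℂ) : ℂ := 1 / 2 * (pd 1 φ z - I * pd I φ z)

/-- The second Wirtinger derivative `∂²φ` of a real function. -/
noncomputable def dzz (φ : ℂ → ℝ) (z : ℂ) : ℂ :=
  1 / 4 * (pd 1 (pd 1 φ) z - pd I (pd I φ) z - 2 * I * pd 1 (pd I φ) z)

section

variable {φ : ℂ → ℝ} {z : ℂ} {lam : ℝ}

theorem pd_eq_add (φ : ℂ → ℝ) (z h : ℂ) : pd h φ z = h.re * pd 1 φ z + h.im * pd I φ z := by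
  have : h = h.re • (1 : ℂ) + h.im • I := by simp [re_add_im]
  conv_lhs => rw [pd, this, map_add, map_smul, map_smul]
  rfl

theorem HasWirt.of_real (hφ : ContDiffAt ℝ ∞ φ z) (s : Set ℂ) :
    HasWirt (fun z => (φ z : ℂ)) (dz φ z) ((starRingEnd ℂ) (dz φ z)) s z := by
  have h1 : HasFDerivAt (fun z => (φ z : ℂ)) (ofRealCLM.comp (fderiv ℝ φ z)) z :=
    ofRealCLM.hasFDerivAt.comp z (hφ.differentiableAt (by simp)).hasFDerivAt
  have h2 : ofRealCLM.comp (fderiv ℝ φ z) = wirt (dz φ z) ((starRingEnd ℂ) (dz φ z)) := by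
    ext1 h
    rw [wirt_apply]
    change ((pd h φ z : ℝ) : ℂ) = _
    rw [pd_eq_add]
    apply Complex.ext <;> simp [dz] <;> ring
  rw [h2] at h1
  exact h1.hasFDerivWithinAt

theorem HasWirt.dz_real (hφ : ContDiffAt ℝ ∞ φ z)
    (hpde : pd 1 (pd 1 φ) z + pd I (pd I φ) z + lam ^ 2 * φ z = 0) (s : Set ℂ) :
    HasWirt (dz φ) (dzz φ z) (-(lam ^ 2 / 4) * φ z) s z := by
  have h1 := HasWirt.of_real (contDiffAt_pd 1 hφ) s
  have h2 := HasWirt.of_real (contDiffAt_pd I hφ) s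
  have h3 : HasWirt (fun z => 1 / 2 * ((pd 1 φ z : ℂ) + -I * (pd I φ z : ℂ))) _ _ s z :=
    (h1.add (h2.const_mul (-I))).const_mul (1 / 2)
  have h4 : (fun z => 1 / 2 * ((pd 1 φ z : ℂ) + -I * (pd I φ z : ℂ))) = dz φ := by
    ext z; rw [dz]; ring
  rw [h4] at h3
  have hc := pd_comm I 1 hφ
  refine h3.congr_wirt ?_ ?_
  · apply Complex.ext <;> simp [dz, dzz, hc] <;> ring
  · have h5 : -(lam ^ 2 / 4) * φ z = 1 / 4 * (pd 1 (pd 1 φ) z + pd I (pd I φ) z) := by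
      linear_combination -(1 / 4) * hpde
    have h6 : -((lam : ℂ) ^ 2 / 4) * φ z =
        ((1 / 4 * (pd 1 (pd 1 φ) z + pd I (pd I φ) z) : ℝ) : ℂ) := by rw [← h5]; push_cast; ring
    rw [h6]
    apply Complex.ext <;> simp [dz, hc]
    ring

theorem HasWirt.comp_holomorphic {f Z : ℂ → ℂ} {p q Z' t : ℂ} (hf : HasWirt f p q univ (Z t))
    (hZ : HasDerivAt Z Z' t) (s : Set ℂ) :
    HasWirt (fun t => f (Z t)) (p * Z') (q * (starRingEnd ℂ) Z') s t := by
  have h1 : HasFDerivAt f (wirt p q) (Z t) := hasFDerivWithinAt_univ.1 hf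
  have h2 : HasFDerivWithinAt Z (wirt Z' 0) s t := HasWirt.of_hasDerivAt hZ
  have h3 := h1.comp_hasFDerivWithinAt t h2
  have h4 : (wirt p q).comp (wirt Z' 0) = wirt (p * Z') (q * (starRingEnd ℂ) Z') := by
    ext1 h
    simp
    ring
  rw [h4] at h3
  exact h3

theorem norm_dz_le {M : ℝ} (h1 : |pd 1 φ z| ≤ M) (h2 : |pd I φ z| ≤ M) : ‖dz φ z‖ ≤ M := by
  have h3 : ‖dz φ z‖ ≤ 1 / 2 * (|pd 1 φ z| + |pd I φ z|) := by
    rw [dz, norm_mul]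
    have := norm_sub_le (pd 1 φ z : ℂ) (I * pd I φ z)
    rw [norm_mul, norm_I, one_mul, norm_real, norm_real] at this
    simpa using this
  linarith

theorem abs_pd_le_norm_dz (φ : ℂ → ℝ) (z : ℂ) :
    |pd 1 φ z| ≤ 2 * ‖dz φ z‖ ∧ |pd I φ z| ≤ 2 * ‖dz φ z‖ := by
  have h1 : pd 1 φ z = 2 * (dz φ z).re := by simp [dz]
  have h2 : pd I φ z = -2 * (dz φ z).im := by simp [dz]
  rw [h1, h2, abs_mul, abs_mul, abs_neg, abs_two]
  exact ⟨by gcongr; exact abs_re_le_norm _, by gcongr; exact abs_im_le_norm _⟩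

theorem abs_pd_pd_le (hφ : ContDiffAt ℝ ∞ φ z)
    (hpde : pd 1 (pd 1 φ) z + pd I (pd I φ) z + lam ^ 2 * φ z = 0) :
    |pd 1 (pd 1 φ) z| ≤ 2 * ‖dzz φ z‖ + lam ^ 2 * |φ z| ∧
    |pd I (pd I φ) z| ≤ 2 * ‖dzz φ z‖ + lam ^ 2 * |φ z| ∧
    |pd 1 (pd I φ) z| ≤ 2 * ‖dzz φ z‖ + lam ^ 2 * |φ z| ∧
    |pd I (pd 1 φ) z| ≤ 2 * ‖dzz φ z‖ + lam ^ 2 * |φ z| := by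
  have h1 : pd 1 (pd 1 φ) z - pd I (pd I φ) z = 4 * (dzz φ z).re := by simp [dzz]
  have h2 : pd 1 (pd I φ) z = -2 * (dzz φ z).im := by simp [dzz]; ring
  have hre := abs_le.1 (abs_re_le_norm (dzz φ z))
  have him := abs_le.1 (abs_im_le_norm (dzz φ z))
  have h3 := abs_le.1 (le_of_eq (abs_mul (lam ^ 2) (φ z)))
  rw [abs_of_nonneg (sq_nonneg lam)] at h3
  have h4 : 0 ≤ lam ^ 2 * |φ z| := by positivity
  rw [pd_comm I 1 hφ, h2]
  refine ⟨?_, ?_, ?_, ?_⟩ <;> rw [abs_le] <;> constructor <;> linarith [h3.1, h3.2, hre.1, hre.2]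

end

section

variable {Ω W : Set ℂ} {φ : ℂ → ℝ} {lam : ℝ}

theorem le_exp_mul {a x : ℝ} (ha : 0 ≤ a) (hx : 1 ≤ x) : a ≤ Real.exp (a * x) := by
  have h1 := Real.add_one_le_exp (a * x)
  nlinarith

theorem ContDiffAt.continuousAt_pd {z : ℂ} (v : ℂ) (hφ : ContDiffAt ℝ ∞ φ z) :
    ContinuousAt (pd v φ) z :=
  (contDiffAt_pd v hφ).continuousAt

/-- The Helmholtz operator commutes with partial derivatives. -/
theorem helmholtz_pd (hΩ : IsOpen Ω) (v : ℂ) (hφ : ∀ z ∈ Ω, ContDiffAt ℝ ∞ φ z)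
    (hpde : ∀ z ∈ Ω, pd 1 (pd 1 φ) z + pd I (pd I φ) z + lam ^ 2 * φ z = 0) :
    ∀ z ∈ Ω, pd 1 (pd 1 (pd v φ)) z + pd I (pd I (pd v φ)) z + lam ^ 2 * pd v φ z = 0 := by
  intro z hz
  have hev : ∀ᶠ y in 𝓝 z, y ∈ Ω := hΩ.mem_nhds hz
  have hswap : ∀ w, pd w (pd w (pd v φ)) z = pd v (pd w (pd w φ)) z := fun w => by
    have h1 : pd w (pd v φ) =ᶠ[𝓝 z] pd v (pd w φ) := by
      filter_upwards [hev] with y hy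
      exact pd_comm w v (hφ y hy)
    rw [pd, h1.fderiv_eq]
    exact pd_comm w v (contDiffAt_pd w (hφ z hz))
  have h0 : (fun z => pd 1 (pd 1 φ) z + pd I (pd I φ) z + lam ^ 2 * φ z) =ᶠ[𝓝 z] fun _ => 0 := by
    filter_upwards [hev] with y hy
    exact hpde y hy
  have hd : ∀ w, DifferentiableAt ℝ (pd w (pd w φ)) z := fun w =>
    (contDiffAt_pd w (contDiffAt_pd w (hφ z hz))).differentiableAt (by simp)
  have h2 : HasFDerivAt (fun z => pd 1 (pd 1 φ) z + pd I (pd I φ) z + lam ^ 2 * φ z)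
      (fderiv ℝ (pd 1 (pd 1 φ)) z + fderiv ℝ (pd I (pd I φ)) z + lam ^ 2 • fderiv ℝ φ z) z :=
    ((hd 1).hasFDerivAt.add (hd I).hasFDerivAt).add
      (((hφ z hz).differentiableAt (by simp)).hasFDerivAt.const_mul (lam ^ 2))
  have h3 := h2.fderiv
  rw [h0.fderiv_eq, fderiv_fun_const] at h3
  have h4 := congrArg (fun T : ℂ →L[ℝ] ℝ => T v) h3
  rw [hswap, hswap]
  simpa [pd] using h4.symm

/-- The Helmholtz equation extends to the closure of the domain. -/
theorem helmholtz_closure (hφ : ∀ z ∈ closure Ω, ContDiffAt ℝ ∞ φ z)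
    (hpde : ∀ z ∈ Ω, pd 1 (pd 1 φ) z + pd I (pd I φ) z + lam ^ 2 * φ z = 0) :
    ∀ z ∈ closure Ω, pd 1 (pd 1 φ) z + pd I (pd I φ) z + lam ^ 2 * φ z = 0 := by
  have hc : ContinuousOn (fun z => pd 1 (pd 1 φ) z + pd I (pd I φ) z + lam ^ 2 * φ z)
      (closure Ω) := fun z hz => ContinuousAt.continuousWithinAt <|
    (((contDiffAt_pd 1 (hφ z hz)).continuousAt_pd 1).add
      ((contDiffAt_pd I (hφ z hz)).continuousAt_pd I)).add
      (continuousAt_const.mul (hφ z hz).continuousAt)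
  have h0 : EqOn (fun z => pd 1 (pd 1 φ) z + pd I (pd I φ) z + lam ^ 2 * φ z) (fun _ => 0) Ω :=
    hpde
  exact h0.of_subset_closure hc continuousOn_const subset_closure subset_rfl

theorem abs_le_closure {f : ℂ → ℝ} {M : ℝ} (hf : ∀ z ∈ closure Ω, ContinuousAt f z)
    (hM : ∀ z ∈ Ω, |f z| ≤ M) : ∀ z ∈ closure Ω, |f z| ≤ M := by
  intro z hz
  have := mem_closure_iff_nhdsWithin_neBot.1 hz
  exact le_of_tendsto ((hf z hz).abs.tendsto.mono_left nhdsWithin_le_nhds)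
    (eventually_nhdsWithin_of_forall hM)

variable {Z Z1 Z2 : ℂ → ℂ} {l h C M₁ : ℝ}

theorem CollarMap.waveData (hZ : CollarMap Z Z1 Z2 l h C) (hlam : 0 < lam)
    (hmap : ∀ t ∈ upperRect l h, Z t ∈ closure Ω) (hφ : ∀ z ∈ closure Ω, ContDiffAt ℝ ∞ φ z)
    (hpde : ∀ z ∈ closure Ω, pd 1 (pd 1 φ) z + pd I (pd I φ) z + lam ^ 2 * φ z = 0)
    (hneu : ∀ t ∈ upperRect l h, t.im = 0 → (dz φ (Z t) * Z1 t).im = 0)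
    (hM : ∀ z ∈ closure Ω, |φ z| ≤ M₁ ∧ |pd 1 φ z| ≤ M₁ ∧ |pd I φ z| ≤ M₁) :
    WaveData Z1 (fun t => (φ (Z t) : ℂ)) (fun t => dz φ (Z t) * Z1 t)
      (fun t => dzz φ (Z t) * Z1 t ^ 2 + dz φ (Z t) * Z2 t) lam l h (C * M₁) where
  lam_pos := hlam
  im_eq t _ := ofReal_im _
  wirt_v t ht := ((HasWirt.of_real (hφ _ (hmap t ht)) univ).comp_holomorphic
    (hZ.deriv1 t (upperRect_subset ht)) _).congr_wirt rfl (map_mul _ _ _).symm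
  wirt_A t ht := by
    have h1 := ((HasWirt.dz_real (hφ _ (hmap t ht)) (hpde _ (hmap t ht)) univ).comp_holomorphic
      (hZ.deriv1 t (upperRect_subset ht)) (upperRect l h)).mul
      (HasWirt.of_hasDerivAt (hZ.deriv2 t (upperRect_subset ht)))
    refine h1.congr_wirt ?_ ?_ <;> ring
  neumann := hneu
  norm_v t ht := by
    have h1 := (hM _ (hmap t ht)).1
    rw [norm_real, Real.norm_eq_abs]
    have := (abs_nonneg _).trans h1
    exact h1.trans (le_mul_of_one_le_left this hZ.one_le)
  norm_A t ht := by
    have h1 := hM _ (hmap t ht)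
    have := (abs_nonneg _).trans h1.1
    rw [norm_mul, mul_comm]
    have h2 := norm_dz_le h1.2.1 h1.2.2
    have h3 := hZ.norm_le1 t (upperRect_subset ht)
    have := hZ.C_pos
    gcongr

/-- Bounds in the collar for a function and its derivatives, in terms of bounds for the data in the
coordinate of the collar map. -/
theorem CollarMap.abs_pd_le (hZ : CollarMap Z Z1 Z2 l h C) {t : ℂ} {b : ℝ} (ht : t ∈ symmRect l h)
    (hφ : ContDiffAt ℝ ∞ φ (Z t))
    (hpde : pd 1 (pd 1 φ) (Z t) + pd I (pd I φ) (Z t) + lam ^ 2 * φ (Z t) = 0)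
    (hv : |φ (Z t)| ≤ b) (hA : ‖dz φ (Z t) * Z1 t‖ ≤ b)
    (hB : ‖dzz φ (Z t) * Z1 t ^ 2 + dz φ (Z t) * Z2 t‖ ≤ b) :
    let S := 4 * C ^ 4 * (1 + lam ^ 2) * b
    |φ (Z t)| ≤ S ∧ |pd 1 φ (Z t)| ≤ S ∧ |pd I φ (Z t)| ≤ S ∧
      |pd 1 (pd 1 φ) (Z t)| ≤ S ∧ |pd I (pd I φ) (Z t)| ≤ S ∧
      |pd 1 (pd I φ) (Z t)| ≤ S ∧ |pd I (pd 1 φ) (Z t)| ≤ S := by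
  intro S
  have hC := hZ.C_pos
  have hC1 := hZ.one_le
  have hb : 0 ≤ b := (abs_nonneg _).trans hv
  have h1 : 1 ≤ C * ‖Z1 t‖ := by
    have := hZ.le_norm1 t ht
    calc 1 = C * C⁻¹ := (mul_inv_cancel₀ hC.ne').symm
      _ ≤ _ := by gcongr
  have h2 : ‖dz φ (Z t)‖ ≤ C * b := by
    calc ‖dz φ (Z t)‖ ≤ ‖dz φ (Z t)‖ * (C * ‖Z1 t‖) := le_mul_of_one_le_right (norm_nonneg _) h1
      _ = C * ‖dz φ (Z t) * Z1 t‖ := by rw [norm_mul]; ring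
      _ ≤ C * b := by gcongr
  have h3 : ‖dzz φ (Z t)‖ ≤ 2 * C ^ 4 * b := by
    calc ‖dzz φ (Z t)‖ ≤ ‖dzz φ (Z t)‖ * (C * ‖Z1 t‖) ^ 2 :=
          le_mul_of_one_le_right (norm_nonneg _) (one_le_pow₀ h1)
      _ = C ^ 2 * ‖dzz φ (Z t) * Z1 t ^ 2‖ := by rw [norm_mul, norm_pow]; ring
      _ = C ^ 2 * ‖(dzz φ (Z t) * Z1 t ^ 2 + dz φ (Z t) * Z2 t) - dz φ (Z t) * Z2 t‖ := by
          rw [add_sub_cancel_right]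
      _ ≤ C ^ 2 * (b + C * b * C) := by
          gcongr
          refine (_root_.norm_sub_le _ _).trans (add_le_add hB ?_)
          rw [norm_mul]
          have := hZ.norm_le2 t ht
          gcongr
      _ = C ^ 2 * b * 1 + C ^ 4 * b := by ring
      _ ≤ C ^ 2 * b * C ^ 2 + C ^ 4 * b := by gcongr; exact one_le_pow₀ hC1
      _ = _ := by ring
  have h4 : 1 ≤ C ^ 4 := one_le_pow₀ hC1
  have h5 : C ≤ C ^ 4 := le_self_pow₀ hC1 (by norm_num)
  have hl : 0 ≤ lam ^ 2 := sq_nonneg _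
  have hS1 : b ≤ S := by
    have : 1 ≤ 4 * C ^ 4 * (1 + lam ^ 2) := by nlinarith
    exact le_mul_of_one_le_left hb this
  have hS2 : 2 * ‖dz φ (Z t)‖ ≤ S := by
    have : 2 * C ≤ 4 * C ^ 4 * (1 + lam ^ 2) := by nlinarith
    calc 2 * ‖dz φ (Z t)‖ ≤ 2 * (C * b) := by gcongr
      _ = 2 * C * b := by ring
      _ ≤ S := mul_le_mul_of_nonneg_right this hb
  have hS3 : 2 * ‖dzz φ (Z t)‖ + lam ^ 2 * |φ (Z t)| ≤ S := by
    have : 4 * C ^ 4 + lam ^ 2 ≤ 4 * C ^ 4 * (1 + lam ^ 2) := by nlinarith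
    calc 2 * ‖dzz φ (Z t)‖ + lam ^ 2 * |φ (Z t)| ≤ 2 * (2 * C ^ 4 * b) + lam ^ 2 * b := by gcongr
      _ = (4 * C ^ 4 + lam ^ 2) * b := by ring
      _ ≤ S := mul_le_mul_of_nonneg_right this hb
  obtain ⟨p1, p2⟩ := abs_pd_le_norm_dz φ (Z t)
  obtain ⟨q1, q2, q3, q4⟩ := abs_pd_pd_le hφ hpde
  exact ⟨hv.trans hS1, p1.trans hS2, p2.trans hS2, q1.trans hS3, q2.trans hS3, q3.trans hS3,
    q4.trans hS3⟩

theorem le_of_le_mul_sqrt {x P Q m : ℝ} (hx : 0 ≤ x) (hQ : 0 ≤ Q) (hm : 0 ≤ m)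
    (h : x ≤ P * √(m * (x * Q))) : x ≤ P ^ 2 * Q * m := by
  rcases hx.eq_or_lt with rfl | hx'
  · positivity
  · have h1 : x ^ 2 ≤ P ^ 2 * (m * (x * Q)) := by
      calc x ^ 2 ≤ (P * √(m * (x * Q))) ^ 2 := by gcongr
        _ = _ := by rw [mul_pow, Real.sq_sqrt (by positivity)]
    nlinarith

end

section

variable {Ω W : Set ℂ} {Z Z1 Z2 : ℂ → ℂ} {l h C : ℝ}

/-- The exponential bookkeeping in `CollarMap.control`. -/
theorem control_const_le {C D lam : ℝ} (hC : 1 ≤ C) (hD : 1 ≤ D) (hlam : 0 < lam) :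
    let P := D * (1 + lam ^ 4) * (4 * C ^ 4 * (1 + lam ^ 2)) *
      Real.exp (19 * C ^ 3 * (1 + lam))
    let Q := C * Real.exp (7 * C ^ 3 * (1 + lam))
    1 ≤ Q ∧ P ^ 2 * Q * Q ≤ Real.exp ((2 * (4 + D + 4 * C + 6 + 19 * C ^ 3) +
      2 * (C + 7 * C ^ 3)) * (1 + lam)) := by
  intro P Q
  have hx : 1 ≤ 1 + lam := by linarith
  have hC0 : 0 ≤ C := by linarith
  have hQ1 : 1 ≤ Q := by
    have := Real.one_le_exp (x := 7 * C ^ 3 * (1 + lam)) (by positivity)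
    nlinarith
  have hQ : Q ≤ Real.exp ((C + 7 * C ^ 3) * (1 + lam)) := by
    rw [add_mul, Real.exp_add]
    exact mul_le_mul_of_nonneg_right (le_exp_mul hC0 hx) (Real.exp_pos _).le
  have hP : P ≤ Real.exp ((4 + D + 4 * C + 6 + 19 * C ^ 3) * (1 + lam)) := by
    have h1 := le_exp_mul (by norm_num : (0 : ℝ) ≤ 4) hx
    have h2 := le_exp_mul (by linarith : 0 ≤ D) hx
    have h3 : C ^ 4 ≤ Real.exp (4 * C * (1 + lam)) := by
      calc C ^ 4 ≤ Real.exp (C * (1 + lam)) ^ 4 := by gcongr; exact le_exp_mul hC0 hx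
        _ = _ := by rw [← Real.exp_nat_mul]; congr 1; push_cast; ring
    have h4 : (1 + lam ^ 4) * (1 + lam ^ 2) ≤ Real.exp (6 * (1 + lam)) := by
      have h5 : 1 + lam ≤ Real.exp (1 * (1 + lam)) := by
        have := Real.add_one_le_exp (1 * (1 + lam)); linarith
      have h6 : 1 + lam ^ 4 ≤ (1 + lam) ^ 4 := by
        have : 0 ≤ 4 * lam + 6 * lam ^ 2 + 4 * lam ^ 3 := by positivity
        nlinarith
      have h7 : 1 + lam ^ 2 ≤ (1 + lam) ^ 2 := by nlinarith
      calc (1 + lam ^ 4) * (1 + lam ^ 2) ≤ (1 + lam) ^ 4 * (1 + lam) ^ 2 := by gcongr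
        _ = (1 + lam) ^ 6 := by ring
        _ ≤ Real.exp (1 * (1 + lam)) ^ 6 := by gcongr
        _ = _ := by rw [← Real.exp_nat_mul]; congr 1; push_cast; ring
    calc P = 4 * D * C ^ 4 * ((1 + lam ^ 4) * (1 + lam ^ 2)) *
          Real.exp (19 * C ^ 3 * (1 + lam)) := by simp only [P]; ring
      _ ≤ Real.exp (4 * (1 + lam)) * Real.exp (D * (1 + lam)) * Real.exp (4 * C * (1 + lam)) *
          Real.exp (6 * (1 + lam)) * Real.exp (19 * C ^ 3 * (1 + lam)) := by gcongr
      _ = _ := by simp only [← Real.exp_add]; congr 1; ring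
  refine ⟨hQ1, ?_⟩
  have hP0 : 0 ≤ P := by positivity
  calc P ^ 2 * Q * Q ≤ Real.exp ((4 + D + 4 * C + 6 + 19 * C ^ 3) * (1 + lam)) ^ 2 *
        Real.exp ((C + 7 * C ^ 3) * (1 + lam)) * Real.exp ((C + 7 * C ^ 3) * (1 + lam)) := by
        gcongr
    _ = _ := by
        rw [← Real.exp_nat_mul, ← Real.exp_add, ← Real.exp_add]
        congr 1
        push_cast
        ring

/-- A Neumann eigenfunction is controlled by its boundary values, with constants growing
exponentially in the frequency, both in the domain and on a complex neighbourhood of a piece of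
the boundary which covers the boundary. -/
theorem CollarMap.control (hZ : CollarMap Z Z1 Z2 l h C) (hΩ : IsOpen Ω)
    (hb : Bornology.IsBounded Ω) (hW : IsOpen W) (hfr : frontier Ω ⊆ W)
    (hmap : ∀ t ∈ upperRect l h, Z t ∈ closure Ω)
    (hcov : Ω ∩ W ⊆ Z '' openUpperRect (l / 4) (h / 16)) :
    ∃ K : ℝ, 0 < K ∧ ∀ (lam : ℝ) (φ : ℂ → ℝ), 0 < lam → (∀ z ∈ closure Ω, ContDiffAt ℝ ∞ φ z) →
      (∀ z ∈ Ω, pd 1 (pd 1 φ) z + pd I (pd I φ) z + lam ^ 2 * φ z = 0) →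
      (∀ t ∈ upperRect l h, t.im = 0 → (dz φ (Z t) * Z1 t).im = 0) →
      ∃ g : ℂ → ℂ, DifferentiableOn ℂ g (openSymmRect l h) ∧
        (∀ z ∈ upperRect l h, z.im = 0 → g z = φ (Z z)) ∧
        ∀ m : ℝ, 0 < m → (∀ z ∈ upperRect l h, z.im = 0 → |φ (Z z)| ≤ m) →
          (∀ z ∈ closure Ω, |φ z| ≤ Real.exp (K * (1 + lam)) * m) ∧
          ∀ z ∈ symmRect l h, ‖g z‖ ≤ Real.exp (K * (1 + lam)) * m := by
  have hC := hZ.C_pos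
  have hC1 := hZ.one_le
  obtain ⟨D, hD, hint⟩ := interior_bound hΩ hb hW hfr
  refine ⟨2 * (4 + D + 4 * C + 6 + 19 * C ^ 3) + 2 * (C + 7 * C ^ 3), by positivity, ?_⟩
  intro lam φ hlam hφ hpde hneu
  have hpde' := helmholtz_closure hφ hpde
  have hφΩ : ∀ z ∈ Ω, ContDiffAt ℝ ∞ φ z := fun z hz => hφ z (subset_closure hz)
  have hcont : ContinuousOn (fun z => max |φ z| (max |pd 1 φ z| |pd I φ z|)) (closure Ω) :=
    fun z hz => ContinuousAt.continuousWithinAt <| (hφ z hz).continuousAt.abs.max <|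
      ((hφ z hz).continuousAt_pd 1).abs.max ((hφ z hz).continuousAt_pd I).abs
  obtain ⟨z₀, hz₀, hmax⟩ := hb.isCompact_closure.exists_isMaxOn
    ⟨Z 0, hmap 0 hZ.zero_mem⟩ hcont
  set M₁ := max |φ z₀| (max |pd 1 φ z₀| |pd I φ z₀|) with hM₁
  have hM : ∀ z ∈ closure Ω, |φ z| ≤ M₁ ∧ |pd 1 φ z| ≤ M₁ ∧ |pd I φ z| ≤ M₁ := fun z hz => by
    have h1 : max |φ z| (max |pd 1 φ z| |pd I φ z|) ≤ M₁ := hmax hz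
    exact ⟨(le_max_left _ _).trans h1, ((le_max_left _ _).trans (le_max_right _ _)).trans h1,
      ((le_max_right _ _).trans (le_max_right _ _)).trans h1⟩
  have hM0 : 0 ≤ M₁ := (abs_nonneg _).trans (le_max_left _ _)
  have hv := hZ.waveData hlam hmap hφ hpde' hneu hM
  obtain ⟨g, hgc, hgd, hgM, hgs, hgv⟩ := exists_boundary_extension hZ hv
  refine ⟨g, hgd, hgv, fun m hm hvm => ?_⟩
  obtain ⟨hQ1, hPQ⟩ := control_const_le hC1 hD hlam
  set P := D * (1 + lam ^ 4) * (4 * C ^ 4 * (1 + lam ^ 2)) *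
    Real.exp (19 * C ^ 3 * (1 + lam)) with hP
  set Q := C * Real.exp (7 * C ^ 3 * (1 + lam)) with hQ
  set E := Real.exp ((2 * (4 + D + 4 * C + 6 + 19 * C ^ 3) + 2 * (C + 7 * C ^ 3)) * (1 + lam))
    with hE
  have hE1 : 1 ≤ E := Real.one_le_exp (by positivity)
  have hMQ : C * M₁ * Real.exp (7 * C ^ 3 * (1 + lam)) = M₁ * Q := by rw [hQ]; ring
  rw [hMQ] at hgM
  suffices hkey : M₁ * Q ≤ E * m by
    refine ⟨fun z hz => (hM z hz).1.trans ((le_mul_of_one_le_right hM0 hQ1).trans hkey),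
      fun z hz => (hgM z hz).trans hkey⟩
  rcases lt_or_ge (M₁ * Q) m with hlt | hmM
  · exact hlt.le.trans (le_mul_of_one_le_left hm.le hE1)
  have hpos : 0 < M₁ * Q := hm.trans_le hmM
  set b := Real.exp (19 * C ^ 3 * (1 + lam)) * √(m * (M₁ * Q)) with hbdef
  have hb0 : 0 < b := by positivity
  set S := 4 * C ^ 4 * (1 + lam ^ 2) * b with hS
  have hS0 : 0 < S := by positivity
  have hnear : ∀ z ∈ Ω ∩ W, |φ z| ≤ S ∧ |pd 1 φ z| ≤ S ∧ |pd I φ z| ≤ S ∧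
      |pd 1 (pd 1 φ) z| ≤ S ∧ |pd I (pd I φ) z| ≤ S ∧
      |pd 1 (pd I φ) z| ≤ S ∧ |pd I (pd 1 φ) z| ≤ S := by
    intro z hz
    obtain ⟨t, ht, rfl⟩ := hcov hz
    obtain ⟨b1, b2, b3⟩ := collar_bounds hZ hv hgc hgd hgM hgs hgv hm hmM
      (fun z hz hz0 => by rw [norm_real]; exact hvm z hz hz0) ht
    have ht' : t ∈ symmRect l h :=
      symmRect_mono (by linarith [hZ.l_pos]) (by linarith [hZ.h_pos])
        (upperRect_subset (openUpperRect_subset ht))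
    rw [norm_real] at b1
    exact hZ.abs_pd_le ht' (hφΩ _ hz.1) (hpde _ hz.1) b1 b2 b3
  have hin : ∀ ψ : ℂ → ℝ, (∀ z ∈ closure Ω, ContinuousAt ψ z) →
      (∀ z ∈ Ω, |ψ z| ≤ D * (1 + lam ^ 4) * S) →
      ∀ z ∈ closure Ω, |ψ z| ≤ D * (1 + lam ^ 4) * S := fun ψ h1 h2 => abs_le_closure h1 h2
  have e0 := hin φ (fun z hz => (hφ z hz).continuousAt)
    (hint lam φ hφΩ hpde S hS0 fun z hz =>
      ⟨(hnear z hz).1, (hnear z hz).2.1, (hnear z hz).2.2.1⟩)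
  have e1 := hin (pd 1 φ) (fun z hz => (hφ z hz).continuousAt_pd 1)
    (hint lam (pd 1 φ) (fun z hz => contDiffAt_pd 1 (hφΩ z hz)) (helmholtz_pd hΩ 1 hφΩ hpde) S hS0
      fun z hz => ⟨(hnear z hz).2.1, (hnear z hz).2.2.2.1, (hnear z hz).2.2.2.2.2.2⟩)
  have e2 := hin (pd I φ) (fun z hz => (hφ z hz).continuousAt_pd I)
    (hint lam (pd I φ) (fun z hz => contDiffAt_pd I (hφΩ z hz)) (helmholtz_pd hΩ I hφΩ hpde) S hS0
      fun z hz => ⟨(hnear z hz).2.2.1, (hnear z hz).2.2.2.2.2.1, (hnear z hz).2.2.2.2.1⟩)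
  have hM₁le : M₁ ≤ P * √(m * (M₁ * Q)) := by
    have h1 : M₁ ≤ D * (1 + lam ^ 4) * S :=
      max_le (e0 z₀ hz₀) (max_le (e1 z₀ hz₀) (e2 z₀ hz₀))
    refine h1.trans_eq ?_
    rw [hS, hbdef, hP]
    ring
  have hQ0 : 0 ≤ Q := by linarith
  calc M₁ * Q ≤ P ^ 2 * Q * m * Q := by
        gcongr; exact le_of_le_mul_sqrt hM0 hQ0 hm.le hM₁le
    _ = P ^ 2 * Q * Q * m := by ring
    _ ≤ E * m := by gcongr

end

/-- Zeros of a function holomorphic on the unit disc force decay at the centre. -/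
theorem norm_le_mul_pow_card {M r : ℝ} {U : Set ℂ} (hU : IsOpen U)
    (hsub : Metric.closedBall 0 1 ⊆ U) (hr : r < 1) (S : Finset ℂ) :
    ∀ F : ℂ → ℂ, DifferentiableOn ℂ F U → (∀ z ∈ Metric.sphere (0 : ℂ) 1, ‖F z‖ ≤ M) →
      (∀ a ∈ S, ‖a‖ ≤ r ∧ F a = 0) → ‖F 0‖ ≤ M * r ^ S.card := by
  induction S using Finset.induction_on with
  | empty =>
    intro F hF hM _
    have h1 : DiffContOnCl ℂ F (Metric.ball 0 1) := by
      refine ⟨hF.mono (Metric.ball_subset_closedBall.trans hsub), hF.continuousOn.mono ?_⟩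
      rw [closure_ball _ one_ne_zero]
      exact hsub
    have h2 := norm_le_of_forall_mem_frontier_norm_le Metric.isBounded_ball h1
      (fun z hz => hM z (by rwa [frontier_ball _ one_ne_zero] at hz))
      (subset_closure (Metric.mem_ball_self one_pos))
    simpa using h2
  | insert a S ha ih =>
    intro F hF hM hS
    obtain ⟨har, hFa⟩ := hS a (Finset.mem_insert_self a S)
    have haU : U ∈ 𝓝 a := hU.mem_nhds (hsub (by simpa using har.trans hr.le))
    have hmul : ∀ z, F z = (z - a) * dslope F a z := fun z => by
      have := sub_smul_dslope F a z
      rw [hFa, sub_zero, smul_eq_mul] at this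
      exact this.symm
    have hr0 : 0 ≤ r := (norm_nonneg a).trans har
    have key := ih (fun z => dslope F a z * (1 - (starRingEnd ℂ) a * z))
      (((differentiableOn_dslope haU).2 hF).mul
        ((differentiableOn_const _).sub (differentiableOn_id.const_mul _))) (fun z hz => by
        have hz1 : ‖z‖ = 1 := by simpa using hz
        have h1 : ‖1 - (starRingEnd ℂ) a * z‖ = ‖z - a‖ := by
          have h2 : z * (starRingEnd ℂ) z = 1 := by rw [mul_conj, normSq_eq_norm_sq, hz1]; simp
          have h3 : 1 - (starRingEnd ℂ) a * z = z * (starRingEnd ℂ) (z - a) := by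
            rw [map_sub, mul_sub, h2]; ring
          rw [h3, norm_mul, hz1, one_mul, norm_conj]
        rw [norm_mul, h1, mul_comm, ← norm_mul, ← hmul]
        exact hM z hz) (fun b hb => by
        refine ⟨(hS b (Finset.mem_insert_of_mem hb)).1, ?_⟩
        have h1 := (hS b (Finset.mem_insert_of_mem hb)).2
        rw [hmul b] at h1
        have h2 : b - a ≠ 0 := sub_ne_zero.2 fun h => ha (h ▸ hb)
        rw [(mul_eq_zero.1 h1).resolve_left h2, zero_mul])
    rw [Finset.card_insert_of_notMem ha, hmul 0, norm_mul, zero_sub, norm_neg]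
    simp only [mul_zero, sub_zero, mul_one] at key
    calc ‖a‖ * ‖dslope F a 0‖ ≤ r * (M * r ^ S.card) := by gcongr
      _ = _ := by ring

/-- The conformal map of the unit disc onto a strip. -/
theorem strip_map {ρ : ℝ} (hρ : ρ < 1) {w : ℂ} (hw : ‖w‖ ≤ ρ) :
    0 < ((1 + w) / (1 - w)).re ∧
      |(log ((1 + w) / (1 - w))).re| ≤ Real.log ((1 + ρ) / (1 - ρ)) ∧
      |(log ((1 + w) / (1 - w))).im| < Real.pi / 2 := by
  have hρ0 : 0 ≤ ρ := (norm_nonneg w).trans hw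
  have hw1 : ‖w‖ < 1 := hw.trans_lt hρ
  have ha : ‖1 + w‖ ≤ 1 + ρ := (norm_add_le _ _).trans (by rw [norm_one]; linarith)
  have hb : ‖1 - w‖ ≤ 1 + ρ := (norm_sub_le _ _).trans (by rw [norm_one]; linarith)
  have hc : 1 - ρ ≤ ‖1 - w‖ := by
    have := norm_sub_norm_le 1 w
    rw [norm_one] at this; linarith
  have hd : 1 - ρ ≤ ‖1 + w‖ := by
    have := norm_sub_norm_le 1 (-w)
    rw [norm_one, norm_neg, sub_neg_eq_add] at this; linarith
  have hρ1 : 0 < 1 - ρ := by linarith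
  have hre : 0 < ((1 + w) / (1 - w)).re := by
    have h1 : ((1 + w) / (1 - w)).re = (1 - ‖w‖ ^ 2) / normSq (1 - w) := by
      rw [div_re, ← add_div, ← normSq_eq_norm_sq, normSq_apply w]
      congr 1
      simp
      ring
    rw [h1]
    have h2 : 0 < normSq (1 - w) := normSq_pos.2 fun h => by rw [h, norm_zero] at hc; linarith
    have h3 : ‖w‖ ^ 2 < 1 := by nlinarith [norm_nonneg w]
    exact div_pos (by linarith) h2
  refine ⟨hre, ?_, ?_⟩
  · have h1 : 0 < ‖1 + w‖ := by linarith
    have h2 : 0 < ‖1 - w‖ := by linarith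
    rw [log_re, norm_div, abs_le, ← Real.log_inv, inv_div]
    constructor
    · exact Real.log_le_log (by positivity) (by gcongr)
    · exact Real.log_le_log (by positivity) (by gcongr)
  · rw [log_im]
    exact abs_arg_lt_pi_div_two_iff.2 (Or.inl hre)

/-- A bound for the number of real zeros of a holomorphic function on a rectangle. -/
theorem exists_card_zeros_le {h R : ℝ} (hh : 0 < h) (hR : 0 < R) :
    ∃ c : ℝ, 0 < c ∧ ∀ (l s₀ M m : ℝ) (g : ℂ → ℂ), |s₀| + 2 * R < l →
      DifferentiableOn ℂ g (openSymmRect l h) → (∀ z ∈ openSymmRect l h, ‖g z‖ ≤ M) →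
      0 < m → m ≤ ‖g s₀‖ → ∀ S : Finset ℝ, (∀ s ∈ S, |s - s₀| ≤ R ∧ g s = 0) →
      S.card * c ≤ Real.log (M / m) := by
  set κ := Real.pi / (2 * h) with hκ
  have hκ0 : 0 < κ := by positivity
  have hE : ∀ x : ℝ, 0 < x → 0 < (Real.exp (κ * x) - 1) / (Real.exp (κ * x) + 1) ∧
      (Real.exp (κ * x) - 1) / (Real.exp (κ * x) + 1) < 1 := fun x hx => by
    have h1 : 1 < Real.exp (κ * x) := Real.one_lt_exp_iff.2 (by positivity)
    exact ⟨div_pos (by linarith) (by linarith), (div_lt_one (by linarith)).2 (by linarith)⟩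
  have hmono : ∀ x y : ℝ, x ≤ y → (Real.exp (κ * x) - 1) / (Real.exp (κ * x) + 1) ≤
      (Real.exp (κ * y) - 1) / (Real.exp (κ * y) + 1) := fun x y hxy => by
    have h1 : Real.exp (κ * x) ≤ Real.exp (κ * y) := Real.exp_le_exp.2 (by gcongr)
    rw [div_le_div_iff₀ (by positivity) (by positivity)]
    nlinarith
  set ρ := (Real.exp (κ * (2 * R)) - 1) / (Real.exp (κ * (2 * R)) + 1) with hρ
  set r := (Real.exp (κ * R) - 1) / (Real.exp (κ * R) + 1) with hr
  obtain ⟨hρ0, hρ1⟩ := hE (2 * R) (by positivity)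
  obtain ⟨hr0, hr1⟩ := hE R hR
  have hrρ : r < ρ := by
    have h1 : Real.exp (κ * R) < Real.exp (κ * (2 * R)) := Real.exp_lt_exp.2 (by nlinarith)
    rw [hρ, hr, div_lt_div_iff₀ (by positivity) (by positivity)]
    nlinarith
  have hq : r / ρ < 1 := (div_lt_one hρ0).2 hrρ
  have hlogρ : Real.log ((1 + ρ) / (1 - ρ)) = κ * (2 * R) := by
    have h1 : (1 + ρ) / (1 - ρ) = Real.exp (κ * (2 * R)) := by
      rw [hρ]
      field_simp
      ring
    rw [h1, Real.log_exp]
  refine ⟨Real.log (ρ / r), Real.log_pos ((one_lt_div hr0).2 hrρ), ?_⟩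
  intro l s₀ M m g hl hg hM hm hms S hS
  set T : ℂ → ℂ := fun u => s₀ + κ⁻¹ * log ((1 + ρ * u) / (1 - ρ * u)) with hT
  have hρu : ∀ u : ℂ, ‖u‖ < ρ⁻¹ → ‖ρ * u‖ < 1 := fun u hu => by
    rw [norm_mul, norm_real, Real.norm_of_nonneg hρ0.le]
    calc ρ * ‖u‖ < ρ * ρ⁻¹ := by gcongr
      _ = 1 := mul_inv_cancel₀ hρ0.ne'
  have hTd : DifferentiableOn ℂ T (Metric.ball 0 ρ⁻¹) := fun u hu => by
    have hu' := hρu u (by simpa using hu)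
    have hne : 1 - ρ * u ≠ 0 := fun h => by
      rw [sub_eq_zero] at h
      rw [← h, norm_one] at hu'
      exact lt_irrefl _ hu'
    have h1 : DifferentiableAt ℂ (fun u : ℂ => (1 + ρ * u) / (1 - ρ * u)) u :=
      DifferentiableAt.div (by fun_prop) (by fun_prop) hne
    have h2 := (strip_map hu' le_rfl).1
    exact (((h1.clog (Or.inl h2)).const_mul _).const_add _).differentiableWithinAt
  have hTm : ∀ u ∈ Metric.closedBall (0 : ℂ) 1, T u ∈ openSymmRect l h := fun u hu => by
    have hu' : ‖ρ * u‖ ≤ ρ := by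
      rw [norm_mul, norm_real, Real.norm_of_nonneg hρ0.le]
      exact mul_le_of_le_one_right hρ0.le (by simpa using hu)
    obtain ⟨-, h1, h2⟩ := strip_map hρ1 hu'
    rw [hlogρ] at h1
    constructor
    · have h3 : (T u).re = s₀ + κ⁻¹ * (log ((1 + ρ * u) / (1 - ρ * u))).re := by
        simp [hT]
      rw [h3]
      calc _ ≤ |s₀| + κ⁻¹ * |(log ((1 + ρ * u) / (1 - ρ * u))).re| := by
            refine (abs_add_le _ _).trans_eq ?_
            rw [abs_mul, abs_of_pos (inv_pos.2 hκ0)]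
        _ ≤ |s₀| + κ⁻¹ * (κ * (2 * R)) := by gcongr
        _ = |s₀| + 2 * R := by rw [inv_mul_cancel_left₀ hκ0.ne']
        _ < l := hl
    · have h3 : (T u).im = κ⁻¹ * (log ((1 + ρ * u) / (1 - ρ * u))).im := by
        simp [hT]
      rw [h3, abs_mul, abs_of_pos (inv_pos.2 hκ0)]
      calc κ⁻¹ * |(log ((1 + ρ * u) / (1 - ρ * u))).im| < κ⁻¹ * (Real.pi / 2) := by gcongr
        _ = h := by rw [hκ]; field_simp
  have hT0 : T 0 = s₀ := by simp [hT]
  set U := Metric.ball (0 : ℂ) ρ⁻¹ ∩ T ⁻¹' openSymmRect l h with hU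
  have hUo : IsOpen U := hTd.continuousOn.isOpen_inter_preimage Metric.isOpen_ball
    (isOpen_openSymmRect)
  have hsub : Metric.closedBall (0 : ℂ) 1 ⊆ U := fun u hu =>
    ⟨Metric.closedBall_subset_ball ((one_lt_inv₀ hρ0).2 hρ1) hu, hTm u hu⟩
  set w : ℝ → ℝ := fun s => (Real.exp (κ * (s - s₀)) - 1) / (Real.exp (κ * (s - s₀)) + 1) with hw
  have hTw : ∀ s : ℝ, T (w s / ρ) = s := fun s => by
    have h1 : (1 + w s) / (1 - w s) = Real.exp (κ * (s - s₀)) := by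
      simp only [hw]
      field_simp
      ring
    have h2 : (1 + ρ * (w s / ρ : ℂ)) / (1 - ρ * (w s / ρ : ℂ)) =
        ((Real.exp (κ * (s - s₀)) : ℝ) : ℂ) := by
      rw [mul_div_cancel₀ _ (ofReal_ne_zero.2 hρ0.ne'), ← h1]
      push_cast
      rfl
    simp only [hT]
    rw [h2, ← ofReal_log (Real.exp_pos _).le, Real.log_exp, ← ofReal_mul,
      inv_mul_cancel_left₀ hκ0.ne', ← ofReal_add]
    congr 1
    ring
  have hwi : Function.Injective (fun s : ℝ => (w s / ρ : ℂ)) := fun s s' hss => by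
    have := congrArg T hss
    simp only [hTw] at this
    exact ofReal_injective this
  have hodd : ∀ s, |s - s₀| ≤ R → |w s| ≤ r := fun s hs => by
    rw [abs_le] at hs ⊢
    refine ⟨?_, hmono _ _ hs.2⟩
    have h1 := hmono _ _ hs.1
    refine le_trans (le_of_eq ?_) h1
    rw [mul_neg, Real.exp_neg, hr]
    have := Real.exp_pos (κ * R)
    field_simp
    ring
  have key := norm_le_mul_pow_card hUo hsub hq (S.map ⟨_, hwi⟩) (fun u => g (T u))
    (DifferentiableOn.comp (g := g) (f := T) hg (hTd.mono inter_subset_left) fun u hu => hu.2)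
    (fun u hu => hM _ (hTm u (Metric.sphere_subset_closedBall hu))) (fun a ha => by
      obtain ⟨s, hs, rfl⟩ := Finset.mem_map.1 ha
      change ‖(w s / ρ : ℂ)‖ ≤ _ ∧ g (T (w s / ρ)) = 0
      rw [hTw, norm_div, norm_real, norm_real, Real.norm_eq_abs, Real.norm_of_nonneg hρ0.le]
      exact ⟨by gcongr; exact hodd s (hS s hs).1, (hS s hs).2⟩)
  beta_reduce at key
  rw [hT0, Finset.card_map] at key
  have hMm := hms.trans key
  have hpow : 0 < (r / ρ) ^ S.card := by positivity
  have h1 : (ρ / r) ^ S.card ≤ M / m := by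
    rw [le_div_iff₀ hm, ← inv_div r ρ, inv_pow, inv_mul_le_iff₀ hpow, mul_comm]
    exact hMm
  calc S.card * Real.log (ρ / r) = Real.log ((ρ / r) ^ S.card) := (Real.log_pow _ _).symm
    _ ≤ _ := Real.log_le_log (by positivity) h1

/-- A real-analytic function of a real variable extends holomorphically near each point. -/
theorem exists_local_extension {γ : ℝ → ℂ} {x₀ : ℝ} (hγ : AnalyticAt ℝ γ x₀) :
    ∃ r > 0, ∃ f : ℂ → ℂ, DifferentiableOn ℂ f (Metric.ball (x₀ : ℂ) r) ∧
      ∀ x : ℝ, |x - x₀| < r → f x = γ x := by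
  obtain ⟨p, R, hp⟩ := hγ
  obtain ⟨r, hr0, hrR⟩ := ENNReal.lt_iff_exists_nnreal_btwn.1 hp.r_pos
  have hr : 0 < (r : ℝ) := by exact_mod_cast hr0
  refine ⟨r, hr, fun z => ∑' n, (z - x₀) ^ n * p.coeff n, ?_, fun x hx => ?_⟩
  · refine differentiableOn_tsum_of_summable_norm
      (p.summable_norm_mul_pow (hrR.trans_le hp.r_le)) (fun n => by fun_prop)
      Metric.isOpen_ball fun n z hz => ?_
    rw [norm_mul, norm_pow, p.norm_apply_eq_norm_coef, mul_comm]
    have : ‖z - x₀‖ ≤ r := (mem_ball_iff_norm.1 hz).le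
    gcongr
  · have h1 : x - x₀ ∈ Metric.eball (0 : ℝ) R := by
      rw [mem_eball_zero_iff]
      refine lt_trans ?_ hrR
      rw [← ofReal_norm, ← ENNReal.ofReal_coe_nnreal]
      exact (ENNReal.ofReal_lt_ofReal_iff hr).2 hx
    have h2 := hp.hasSum h1
    rw [add_sub_cancel] at h2
    rw [← h2.tsum_eq]
    refine tsum_congr fun n => ?_
    rw [p.apply_eq_pow_smul_coeff, real_smul]
    push_cast
    rfl

theorem ofReal_image_Icc_isCompact (a : ℝ) : IsCompact (ofReal '' Icc (-a) a) :=
  isCompact_Icc.image continuous_ofReal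

/-- A property valid near each point of a real segment is valid on a thin rectangle. -/
theorem exists_symmRect_of_eventually {a : ℝ} {P : ℂ → Prop}
    (hP : ∀ x : ℝ, |x| ≤ a → ∀ᶠ z in 𝓝 (x : ℂ), P z) :
    ∃ h > 0, ∀ z ∈ symmRect a h, P z := by
  obtain ⟨h, hh, hsub⟩ := (ofReal_image_Icc_isCompact a).exists_cthickening_subset_open
    (isOpen_interior (s := {z | P z})) (by
      rintro _ ⟨x, hx, rfl⟩
      exact mem_interior_iff_mem_nhds.2 (hP x (abs_le.2 hx)))
  refine ⟨h, hh, fun z hz => interior_subset (hsub ?_)⟩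
  refine Metric.mem_cthickening_of_dist_le z (z.re : ℂ) _ _ ⟨z.re, abs_le.1 hz.1, rfl⟩ ?_
  rw [dist_of_re_eq (ofReal_re _).symm, ofReal_im, Real.dist_eq, sub_zero]
  exact hz.2

theorem eqOn_of_eq_real {f g : ℂ → ℂ} {x r : ℝ} {U : Set ℂ} (hU : IsOpen U) (hc : IsPreconnected U)
    (hf : DifferentiableOn ℂ f U) (hg : DifferentiableOn ℂ g U) (hx : (x : ℂ) ∈ U)
    (hr : 0 < r) (hfg : ∀ y : ℝ, |y - x| < r → f y = g y) : EqOn f g U := by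
  refine (hf.analyticOnNhd hU).eqOn_of_preconnected_of_frequently_eq (hg.analyticOnNhd hU) hc hx ?_
  have h1 : Tendsto (fun y : ℝ => (y : ℂ)) (𝓝[≠] x) (𝓝[≠] (x : ℂ)) :=
    continuous_ofReal.continuousAt.tendsto.inf <| tendsto_principal_principal.2 fun y hy h =>
      hy (ofReal_injective h)
  refine h1.frequently (Eventually.frequently ?_)
  filter_upwards [nhdsWithin_le_nhds (Metric.ball_mem_nhds x hr)] with y hy
  exact hfg y hy

/-- A real-analytic function of a real variable extends holomorphically to a neighbourhood of each
compact segment. -/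
theorem exists_complexification {γ : ℝ → ℂ} (hγ : AnalyticOnNhd ℝ γ univ) (a : ℝ) :
    ∃ δ > 0, ∃ Z : ℂ → ℂ, DifferentiableOn ℂ Z (openSymmRect a δ) ∧
      ∀ x : ℝ, |x| ≤ a → Z x = γ x := by
  choose r hr f hf hfγ using fun x : ℝ => exists_local_extension (hγ x (mem_univ x))
  obtain ⟨δ, hδ, hball⟩ := lebesgue_number_lemma_of_metric (ofReal_image_Icc_isCompact a)
    (c := fun x : ℝ => Metric.ball (x : ℂ) (r x)) (fun x => Metric.isOpen_ball) (by
      rintro _ ⟨x, -, rfl⟩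
      exact mem_iUnion.2 ⟨x, Metric.mem_ball_self (hr x)⟩)
  have hloc : ∀ x : ℝ, |x| ≤ a → ∃ f : ℂ → ℂ, DifferentiableOn ℂ f (Metric.ball (x : ℂ) δ) ∧
      ∀ y : ℝ, |y - x| < δ → f y = γ y := by
    intro x hx
    obtain ⟨x', hx'⟩ := hball x ⟨x, abs_le.1 hx, rfl⟩
    refine ⟨f x', (hf x').mono hx', fun y hy => hfγ x' y ?_⟩
    have h1 : (y : ℂ) ∈ Metric.ball (x : ℂ) δ := by
      rw [mem_ball_iff_norm, ← ofReal_sub, norm_real]; exact hy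
    have h2 := mem_ball_iff_norm.1 (hx' h1)
    rwa [← ofReal_sub, norm_real] at h2
  choose! F hF hFγ using hloc
  refine ⟨δ, hδ, fun z => F z.re z, fun z hz => ?_, fun x hx => ?_⟩
  · have hz1 : |z.re| ≤ a := hz.1.le
    have hzb : z ∈ Metric.ball (z.re : ℂ) δ := by
      rw [Metric.mem_ball, dist_of_re_eq (ofReal_re _).symm, ofReal_im, Real.dist_eq, sub_zero]
      exact hz.2
    have hd : DifferentiableAt ℂ (F z.re) z :=
      (hF z.re hz1).differentiableAt (Metric.isOpen_ball.mem_nhds hzb)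
    refine (hd.congr_of_eventuallyEq ?_).differentiableWithinAt
    filter_upwards [isOpen_openSymmRect.mem_nhds hz, Metric.isOpen_ball.mem_nhds hzb,
      continuous_re.continuousAt.eventually (Metric.ball_mem_nhds z.re hδ)] with w hw hwb hwr
    have hw1 : |w.re| ≤ a := hw.1.le
    have hwb' : w ∈ Metric.ball (w.re : ℂ) δ := by
      rw [Metric.mem_ball, dist_of_re_eq (ofReal_re _).symm, ofReal_im, Real.dist_eq, sub_zero]
      exact hw.2
    have hwr' : |w.re - z.re| < δ := hwr
    have key := eqOn_of_eq_real (f := F w.re) (g := F z.re) (x := w.re) (r := δ - |w.re - z.re|)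
      (Metric.isOpen_ball.inter Metric.isOpen_ball)
      ((convex_ball (w.re : ℂ) δ).inter (convex_ball (z.re : ℂ) δ)).isPreconnected
      ((hF _ hw1).mono inter_subset_left) ((hF _ hz1).mono inter_subset_right)
      ⟨Metric.mem_ball_self hδ, by
        rw [mem_ball_iff_norm, ← ofReal_sub, norm_real]; exact hwr'⟩ (by linarith) (fun y hy => by
        have h1 : |y - z.re| ≤ |y - w.re| + |w.re - z.re| := abs_sub_le _ _ _
        rw [hFγ _ hw1 y (by linarith [abs_nonneg (w.re - z.re)]),
          hFγ _ hz1 y (by linarith)])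
    exact key ⟨hwb', hwb⟩
  · exact hFγ x hx x (by simpa using hδ)

theorem Function.Periodic.exists_int_of_injOn {α : Type*} {γ : ℝ → α} {L : ℝ}
    (hper : Function.Periodic γ L) (hL : 0 < L) (hinj : InjOn γ (Ico 0 L)) {u v : ℝ}
    (h : γ u = γ v) : ∃ k : ℤ, u + k * L = v := by
  have h1 : ∀ x, γ (toIcoMod hL 0 x) = γ x := fun x => by
    rw [toIcoMod, hper.sub_zsmul_eq]
  have hmem : ∀ x, toIcoMod hL 0 x ∈ Ico 0 L := fun x => by
    simpa using toIcoMod_mem_Ico hL 0 x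
  have h2 := hinj (hmem u) (hmem v) (by rw [h1, h1, h])
  refine ⟨toIcoDiv hL 0 v - toIcoDiv hL 0 u, ?_⟩
  have hu := toIcoMod_add_toIcoDiv_zsmul hL 0 u
  have hv := toIcoMod_add_toIcoDiv_zsmul hL 0 v
  rw [zsmul_eq_mul] at hu hv
  push_cast
  linarith

/-- Near a real point, the complexification of a simple closed curve meets the curve only at real
parameters. -/
theorem eventually_im_eq_zero {γ : ℝ → ℂ} {L x r₀ : ℝ} {Z : ℂ → ℂ} {Z' : ℂ} (hγ : Continuous γ)
    (hper : Function.Periodic γ L) (hL : 0 < L) (hinj : InjOn γ (Ico 0 L)) (hr₀ : 0 < r₀)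
    (hZγ : ∀ y : ℝ, |y - x| < r₀ → Z y = γ y) (hZ : HasStrictDerivAt Z Z' x) (hZ' : Z' ≠ 0) :
    ∀ᶠ t in 𝓝 (x : ℂ), Z t ∈ γ '' Ico 0 L → t.im = 0 := by
  set e := hZ.hasStrictFDerivAt_equiv hZ' with he
  obtain ⟨r, hr, hinv⟩ := Metric.eventually_nhds_iff_ball.1 e.eventually_left_inverse
  set ρ := min r r₀ with hρ
  have hρ0 : 0 < ρ := lt_min hr hr₀
  set T := {u : ℝ | u ∈ Icc 0 L ∧ ∀ k : ℤ, ρ ≤ |u + k * L - x|} with hT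
  have hTc : IsCompact T := by
    refine isCompact_Icc.inter_right (t := {u : ℝ | ∀ k : ℤ, ρ ≤ |u + k * L - x|}) ?_
    rw [ofPred_forall]
    exact isClosed_iInter fun k => isClosed_le continuous_const (by fun_prop)
  have hx : Z x ∉ γ '' T := by
    rintro ⟨u, hu, hux⟩
    rw [hZγ x (by simpa using hr₀)] at hux
    obtain ⟨k, hk⟩ := hper.exists_int_of_injOn hL hinj hux
    have := hu.2 k
    rw [hk, sub_self, abs_zero] at this
    linarith
  have hnot : ∀ᶠ t in 𝓝 (x : ℂ), Z t ∉ γ '' T :=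
    hZ.hasDerivAt.continuousAt.eventually
      ((hTc.image hγ).isClosed.isOpen_compl.mem_nhds hx)
  filter_upwards [hnot, Metric.ball_mem_nhds (x : ℂ) hr] with t ht htr ⟨u, hu, hut⟩
  have : ∃ k : ℤ, |u + k * L - x| < ρ := by
    by_contra! hcon
    exact ht ⟨u, ⟨Ico_subset_Icc_self hu, hcon⟩, hut⟩
  obtain ⟨k, hk⟩ := this
  have h1 : Z ((u + k * L : ℝ) : ℂ) = Z t := by
    rw [hZγ _ (hk.trans_le (min_le_right _ _)), ← hut]
    exact hper.int_mul k u
  have h2 : ((u + k * L : ℝ) : ℂ) ∈ Metric.ball (x : ℂ) r := by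
    rw [mem_ball_iff_norm, ← ofReal_sub, norm_real]
    exact hk.trans_le (min_le_left _ _)
  have h3 := hinv _ h2
  rw [h1, hinv t htr] at h3
  rw [h3, ofReal_im]

/-- A complexified boundary parametrization on a thin rectangle. -/
theorem exists_boundary_complexification {γ : ℝ → ℂ} {L l : ℝ} (hγ : AnalyticOnNhd ℝ γ univ)
    (hper : Function.Periodic γ L) (hL : 0 < L) (hinj : InjOn γ (Ico 0 L))
    (hunit : ∀ t, ‖deriv γ t‖ = 1) (hl : 0 < l) :
    ∃ (Z Z1 Z2 : ℂ → ℂ) (h C : ℝ), CollarMap Z Z1 Z2 l h C ∧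
      (∀ x : ℝ, |x| ≤ l → Z x = γ x ∧ Z1 x = deriv γ x) ∧
      (∀ t ∈ symmRect l h, HasStrictDerivAt Z (Z1 t) t) ∧
      ∀ t ∈ symmRect l h, Z t ∈ γ '' Ico 0 L → t.im = 0 := by
  obtain ⟨δ, hδ, Z, hZ, hZγ⟩ := exists_complexification hγ (l + 1)
  have han : AnalyticOnNhd ℂ Z (openSymmRect (l + 1) δ) := hZ.analyticOnNhd isOpen_openSymmRect
  have han1 := han.deriv
  have han2 := han1.deriv
  have hreal : ∀ x : ℝ, |x| ≤ l → (x : ℂ) ∈ openSymmRect (l + 1) δ := fun x hx =>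
    ⟨by rw [ofReal_re]; linarith, by simpa using hδ⟩
  have hZ1 : ∀ x : ℝ, |x| ≤ l → deriv Z x = deriv γ x := fun x hx => by
    have h1 : HasDerivAt (fun y : ℝ => Z y) (deriv Z x) x :=
      ((han x (hreal x hx)).differentiableAt.hasDerivAt).comp_ofReal
    have h2 : (fun y : ℝ => Z y) =ᶠ[𝓝 x] γ := by
      filter_upwards [continuous_abs.continuousAt.eventually
        (Iio_mem_nhds (show |x| < l + 1 by linarith))] with y hy
      exact hZγ y (le_of_lt hy)
    rw [← h2.deriv_eq, h1.deriv]
  obtain ⟨C₀, hC₀⟩ := (ofReal_image_Icc_isCompact l).exists_bound_of_continuousOn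
    (f := deriv (deriv Z)) (han2.continuousOn.mono (by
      rintro _ ⟨x, hx, rfl⟩
      exact hreal x (abs_le.2 hx)))
  obtain ⟨h, hh, hP⟩ := exists_symmRect_of_eventually (a := l)
    (P := fun t => t ∈ openSymmRect (l + 1) δ ∧ 1 / 2 < ‖deriv Z t‖ ∧ ‖deriv Z t‖ < 2 ∧
      ‖deriv (deriv Z) t‖ < |C₀| + 1 ∧ (Z t ∈ γ '' Ico 0 L → t.im = 0)) (fun x hx => by
      have hx' := hreal x hx
      have hn : ‖deriv Z x‖ = 1 := by rw [hZ1 x hx, hunit]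
      have hc1 := (han1 x hx').continuousAt.norm
      have hc2 := (han2 x hx').continuousAt.norm
      have hC₀x : ‖deriv (deriv Z) x‖ < |C₀| + 1 := by
        have := hC₀ x ⟨x, abs_le.1 hx, rfl⟩
        linarith [le_abs_self C₀]
      have hm : ∀ᶠ t in 𝓝 (x : ℂ), t ∈ openSymmRect (l + 1) δ := isOpen_openSymmRect.mem_nhds hx'
      have h1 : ∀ᶠ t in 𝓝 (x : ℂ), 1 / 2 < ‖deriv Z t‖ :=
        hc1.eventually (Ioi_mem_nhds (by beta_reduce; rw [hn]; norm_num))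
      have h2 : ∀ᶠ t in 𝓝 (x : ℂ), ‖deriv Z t‖ < 2 :=
        hc1.eventually (Iio_mem_nhds (by beta_reduce; rw [hn]; norm_num))
      have h3 : ∀ᶠ t in 𝓝 (x : ℂ), ‖deriv (deriv Z) t‖ < |C₀| + 1 :=
        hc2.eventually (Iio_mem_nhds hC₀x)
      refine hm.and (h1.and (h2.and (h3.and ?_)))
      refine eventually_im_eq_zero (r₀ := 1)
        (continuous_iff_continuousAt.2 fun y => (hγ y (mem_univ y)).continuousAt)
        hper hL hinj one_pos (fun y hy => hZγ y ?_) (han x hx').hasStrictDerivAt ?_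
      · have := abs_sub_abs_le_abs_sub y x
        linarith
      · rw [← norm_ne_zero_iff, hn]
        exact one_ne_zero)
  set h' := min h l with hh'
  have hh'0 : 0 < h' := lt_min hh hl
  have hP' : ∀ t ∈ symmRect l h', _ := fun t ht => hP t (symmRect_mono le_rfl (min_le_left _ _) ht)
  have hinv : 0 < h'⁻¹ := inv_pos.2 hh'0
  refine ⟨Z, deriv Z, deriv (deriv Z), h', 2 + |C₀| + (l + h') + h'⁻¹, ?_,
    fun x hx => ⟨hZγ x (by linarith), hZ1 x hx⟩,
    fun t ht => (han t (hP' t ht).1).hasStrictDerivAt, fun t ht => (hP' t ht).2.2.2.2⟩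
  have hC₀0 := abs_nonneg C₀
  exact
    { h_pos := hh'0
      h_le := min_le_right _ _
      one_le := by linarith
      size_le := by linarith
      inv_le := by linarith
      deriv1 := fun t ht => (han t (hP' t ht).1).differentiableAt.hasDerivAt
      deriv2 := fun t ht => (han1 t (hP' t ht).1).differentiableAt.hasDerivAt
      norm_le1 := fun t ht => by linarith [(hP' t ht).2.2.1]
      le_norm1 := fun t ht => by
        refine le_trans ?_ (hP' t ht).2.1.le
        rw [one_div]
        exact inv_anti₀ two_pos (by linarith)
      norm_le2 := fun t ht => by linarith [(hP' t ht).2.2.2.1] }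

section

variable {Ω : Set ℂ} {Z Z1 Z2 : ℂ → ℂ} {l h C : ℝ}

theorem neg_mem_symmRect {t : ℂ} (ht : t ∈ symmRect l h) : -t ∈ symmRect l h := by
  simpa [symmRect] using ht

theorem CollarMap.comp_neg (hZ : CollarMap Z Z1 Z2 l h C) :
    CollarMap (fun t => Z (-t)) (fun t => -Z1 (-t)) (fun t => Z2 (-t)) l h C where
  h_pos := hZ.h_pos
  h_le := hZ.h_le
  one_le := hZ.one_le
  size_le := hZ.size_le
  inv_le := hZ.inv_le
  deriv1 t ht := by
    have h1 := (hZ.deriv1 (-t) (neg_mem_symmRect ht)).comp t (hasDerivAt_neg t)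
    exact h1.congr_deriv (by ring)
  deriv2 t ht := by
    have h1 := ((hZ.deriv2 (-t) (neg_mem_symmRect ht)).comp t (hasDerivAt_neg t)).neg
    exact h1.congr_deriv (by ring)
  norm_le1 t ht := by rw [norm_neg]; exact hZ.norm_le1 _ (neg_mem_symmRect ht)
  le_norm1 t ht := by rw [norm_neg]; exact hZ.le_norm1 _ (neg_mem_symmRect ht)
  norm_le2 t ht := hZ.norm_le2 _ (neg_mem_symmRect ht)

theorem CollarMap.isOpen_image (hZ : CollarMap Z Z1 Z2 l h C)
    (hs : ∀ t ∈ symmRect l h, HasStrictDerivAt Z (Z1 t) t) {s : Set ℂ} (hso : IsOpen s)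
    (hsub : s ⊆ symmRect l h) : IsOpen (Z '' s) := by
  rw [isOpen_iff_mem_nhds]
  rintro _ ⟨t, ht, rfl⟩
  have hne : Z1 t ≠ 0 := norm_pos_iff.1
    ((inv_pos.2 hZ.C_pos).trans_le (hZ.le_norm1 t (hsub ht)))
  rw [← (hs t (hsub ht)).map_nhds_eq hne]
  exact image_mem_map (hso.mem_nhds ht)

theorem openSymmRect_cases {t : ℂ} (ht : t ∈ openSymmRect l h) :
    t.im = 0 ∨ t ∈ openUpperRect l h ∨ -t ∈ openUpperRect l h := by
  obtain ⟨h1, h2⟩ := ht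
  rw [abs_lt] at h2
  rcases lt_trichotomy t.im 0 with h3 | h3 | h3
  · exact Or.inr (Or.inr ⟨by simpa using h1, by simpa using h3, by
      rw [neg_im]; linarith [h2.1]⟩)
  · exact Or.inl h3
  · exact Or.inr (Or.inl ⟨h1, h3, h2.2⟩)

/-- The collar map sends the upper rectangle to one side of the boundary. -/
theorem CollarMap.side (hZ : CollarMap Z Z1 Z2 l h C) (hΩ : IsOpen Ω)
    (hfr : ∀ t ∈ symmRect l h, Z t ∈ frontier Ω → t.im = 0) :
    (∀ t ∈ openUpperRect l h, Z t ∈ Ω) ∨ ∀ t ∈ openUpperRect l h, Z t ∉ closure Ω := by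
  have hsub : openUpperRect l h ⊆ symmRect l h := openUpperRect_subset.trans upperRect_subset
  have hc : IsPreconnected (Z '' openUpperRect l h) :=
    (convex_openUpperRect).isPreconnected.image Z (hZ.continuousOn.mono hsub)
  have hcov : Z '' openUpperRect l h ⊆ Ω ∪ (closure Ω)ᶜ := by
    rintro _ ⟨t, ht, rfl⟩
    by_contra hcon
    rw [mem_union, not_or, mem_compl_iff, not_not] at hcon
    have := hfr t (hsub ht) ⟨hcon.2, by rw [hΩ.interior_eq]; exact hcon.1⟩
    exact ht.2.1.ne' this
  rcases isPreconnected_iff_subset_of_disjoint.1 hc _ _ hΩ isClosed_closure.isOpen_compl hcov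
    (by
      rw [eq_empty_iff_forall_notMem]
      rintro z ⟨-, h1, h2⟩
      exact h2 (subset_closure h1)) with h1 | h1
  · exact Or.inl fun t ht => h1 ⟨t, ht, rfl⟩
  · exact Or.inr fun t ht => h1 ⟨t, ht, rfl⟩

theorem CollarMap.mapsTo_closure (hZ : CollarMap Z Z1 Z2 l h C)
    (hup : ∀ t ∈ openUpperRect l h, Z t ∈ Ω) : ∀ t ∈ upperRect l h, Z t ∈ closure Ω := by
  intro t ht
  have hcl : t ∈ closure (openUpperRect l h) := by
    rwa [closure_openUpperRect hZ.l_pos hZ.h_pos]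
  exact closure_mono (image_subset_iff.2 hup)
    ((((hZ.continuousOn.mono upperRect_subset).mono
      (closure_openUpperRect hZ.l_pos hZ.h_pos).subset).image_closure) ⟨t, hcl, rfl⟩)

/-- A complexified boundary parametrization maps exactly one of the two half rectangles into the
domain. -/
theorem CollarMap.exactly_one_side (hZ : CollarMap Z Z1 Z2 l h C) (hΩ : IsOpen Ω)
    (hb : Bornology.IsBounded Ω) (hs : ∀ t ∈ symmRect l h, HasStrictDerivAt Z (Z1 t) t)
    (hfr : ∀ t ∈ symmRect l h, Z t ∈ frontier Ω → t.im = 0)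
    (hreal : ∀ t ∈ symmRect l h, t.im = 0 → Z t ∈ frontier Ω)
    (hcov : frontier Ω ⊆ Z '' openSymmRect l h) :
    ((∀ t ∈ openUpperRect l h, Z t ∈ Ω) ∧ ∀ t ∈ openUpperRect l h, Z (-t) ∉ closure Ω) ∨
    ((∀ t ∈ openUpperRect l h, Z (-t) ∈ Ω) ∧ ∀ t ∈ openUpperRect l h, Z t ∉ closure Ω) := by
  have hsub : openSymmRect l h ⊆ symmRect l h := openSymmRect_subset
  have h0 : (0 : ℂ) ∈ openSymmRect l h := by simp [openSymmRect, hZ.l_pos, hZ.h_pos]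
  have hopen := hZ.isOpen_image hs isOpen_openSymmRect hsub
  have hneg := hZ.comp_neg.side hΩ fun t ht h1 => by
    simpa using hfr _ (neg_mem_symmRect ht) h1
  have hZ0 : Z 0 ∈ closure Ω := frontier_subset_closure (hreal 0 (hsub h0) (by simp))
  obtain ⟨_, ⟨t, ht, rfl⟩, htΩ⟩ := mem_closure_iff.1 hZ0 _ hopen ⟨0, h0, rfl⟩
  rcases hZ.side hΩ hfr with h1 | h1 <;> rcases hneg with h2 | h2
  · exfalso
    have hcl : closure Ω = Ω ∪ Z '' openSymmRect l h := by
      apply Subset.antisymm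
      · intro z hz
        by_cases hzΩ : z ∈ Ω
        · exact Or.inl hzΩ
        · exact Or.inr (hcov ⟨hz, by rwa [hΩ.interior_eq]⟩)
      · rintro z (hz | ⟨t, ht, rfl⟩)
        · exact subset_closure hz
        · rcases openSymmRect_cases ht with h3 | h3 | h3
          · exact frontier_subset_closure (hreal t (hsub ht) h3)
          · exact subset_closure (h1 t h3)
          · have := h2 _ h3
            rw [neg_neg] at this
            exact subset_closure this
    have hclopen : IsClopen (closure Ω) := ⟨isClosed_closure, hcl ▸ hΩ.union hopen⟩
    have huniv := hclopen.eq_univ ⟨Z 0, hZ0⟩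
    exact NormedSpace.unbounded_univ ℝ ℂ (huniv ▸ hb.closure)
  · exact Or.inl ⟨h1, h2⟩
  · exact Or.inr ⟨h2, h1⟩
  · exfalso
    rcases openSymmRect_cases ht with h3 | h3 | h3
    · exact (hreal t (hsub ht) h3).2 (by rwa [hΩ.interior_eq])
    · exact h1 t h3 (subset_closure htΩ)
    · exact h2 _ h3 (by rw [neg_neg]; exact subset_closure htΩ)

/-- Points of the domain close to the boundary lie in the image of the upper rectangle. -/
theorem CollarMap.cover {a b : ℝ} (ha : a ≤ l) (hb : b ≤ h) (hΩ : IsOpen Ω)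
    (hreal : ∀ t ∈ symmRect l h, t.im = 0 → Z t ∈ frontier Ω)
    (hlow : ∀ t ∈ openUpperRect l h, Z (-t) ∉ closure Ω) :
    Ω ∩ Z '' openSymmRect a b ⊆ Z '' openUpperRect a b := by
  rintro _ ⟨hz, t, ht, rfl⟩
  rcases openSymmRect_cases ht with h3 | h3 | h3
  · exact absurd (by rwa [hΩ.interior_eq])
      (hreal t (symmRect_mono ha hb (openSymmRect_subset ht)) h3).2
  · exact ⟨t, h3, rfl⟩
  · refine absurd (subset_closure hz) ?_
    have := hlow (-t) ⟨h3.1.trans_le ha, h3.2.1, h3.2.2.trans_le hb⟩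
    rwa [neg_neg] at this

end

/-- A collar of a bounded domain with real-analytic boundary curve. -/
theorem exists_collar {Ω : Set ℂ} {γ : ℝ → ℂ} {L : ℝ} (hΩ : IsOpen Ω) (hb : Bornology.IsBounded Ω)
    (hL : 0 < L) (hγ : AnalyticOnNhd ℝ γ univ) (hper : Function.Periodic γ L)
    (hunit : ∀ t, ‖deriv γ t‖ = 1) (hinj : InjOn γ (Ico 0 L)) (himg : γ '' Ico 0 L = frontier Ω) :
    ∃ (Z Z1 Z2 : ℂ → ℂ) (h C σ : ℝ) (W : Set ℂ), CollarMap Z Z1 Z2 (12 * L) h C ∧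
      |σ| = 1 ∧ (∀ x : ℝ, |x| ≤ 12 * L → Z x = γ (σ * x) ∧ Z1 x = σ * deriv γ (σ * x)) ∧
      IsOpen W ∧ frontier Ω ⊆ W ∧ (∀ t ∈ upperRect (12 * L) h, Z t ∈ closure Ω) ∧
      Ω ∩ W ⊆ Z '' openUpperRect (12 * L / 4) (h / 16) := by
  obtain ⟨Z, Z1, Z2, h, C, hZ, hZγ, hs, hfr⟩ := exists_boundary_complexification hγ hper hL hinj
    hunit (l := 12 * L) (by linarith)
  rw [himg] at hfr
  have hh := hZ.h_pos
  have hall : ∀ x, γ x ∈ frontier Ω := fun x => by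
    obtain ⟨y, hy, hxy⟩ := hper.exists_mem_Ico₀ hL x
    rw [hxy, ← himg]
    exact ⟨y, hy, rfl⟩
  have hreal : ∀ t ∈ symmRect (12 * L) h, t.im = 0 → Z t ∈ frontier Ω := fun t ht h0 => by
    have h1 : t = (t.re : ℂ) := Complex.ext rfl (by simpa using h0)
    rw [h1, (hZγ _ ht.1).1]
    exact hall _
  have hcov : ∀ {b : ℝ}, 0 < b → frontier Ω ⊆ Z '' openSymmRect (12 * L / 4) b := by
    intro b hb' z hz
    rw [← himg] at hz
    obtain ⟨x, hx, rfl⟩ := hz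
    have hx' : |x| = x := abs_of_nonneg hx.1
    exact ⟨x, ⟨by rw [ofReal_re, hx']; linarith [hx.2], by simpa using hb'⟩,
      (hZγ x (by rw [hx']; linarith [hx.2])).1⟩
  have hle : 12 * L / 4 ≤ 12 * L := by linarith
  have hle' : h / 16 ≤ h := by linarith
  have hmono : openSymmRect (12 * L / 4) h ⊆ openSymmRect (12 * L) h :=
    fun t ht => ⟨ht.1.trans_le hle, ht.2⟩
  have hWsub : openSymmRect (12 * L / 4) (h / 16) ⊆ symmRect (12 * L) h :=
    openSymmRect_subset.trans (symmRect_mono hle hle')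
  rcases hZ.exactly_one_side hΩ hb hs hfr hreal ((hcov hh).trans (image_mono hmono)) with
    ⟨h1, h2⟩ | ⟨h1, h2⟩
  · refine ⟨Z, Z1, Z2, h, C, 1, Z '' openSymmRect (12 * L / 4) (h / 16), hZ, abs_one,
      fun x hx => ?_, hZ.isOpen_image hs isOpen_openSymmRect hWsub, hcov (by linarith),
      hZ.mapsTo_closure h1, CollarMap.cover hle hle' hΩ hreal h2⟩
    simpa using hZγ x hx
  · refine ⟨fun t => Z (-t), fun t => -Z1 (-t), fun t => Z2 (-t), h, C, -1,
      Z '' openSymmRect (12 * L / 4) (h / 16), hZ.comp_neg, by simp,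
      fun x hx => ?_, hZ.isOpen_image hs isOpen_openSymmRect hWsub, hcov (by linarith),
      hZ.comp_neg.mapsTo_closure h1, ?_⟩
    · have := hZγ (-x) (by rwa [abs_neg])
      rw [ofReal_neg] at this
      exact ⟨by beta_reduce; rw [this.1]; simp, by beta_reduce; rw [this.2]; simp⟩
    · have himage : Z '' openSymmRect (12 * L / 4) (h / 16) =
          (fun t => Z (-t)) '' openSymmRect (12 * L / 4) (h / 16) := by
        have hneg : ∀ t ∈ openSymmRect (12 * L / 4) (h / 16),
            -t ∈ openSymmRect (12 * L / 4) (h / 16) := fun t ht => by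
          simpa [openSymmRect] using ht
        ext z
        constructor
        · rintro ⟨t, ht, rfl⟩
          exact ⟨-t, hneg t ht, by simp⟩
        · rintro ⟨t, ht, rfl⟩
          exact ⟨-t, hneg t ht, rfl⟩
      rw [himage]
      refine CollarMap.cover hle hle' hΩ (fun t ht h0 => ?_) (fun t ht => ?_)
      · exact hreal _ (neg_mem_symmRect ht) (by simpa using h0)
      · rw [neg_neg]
        exact h2 t ht

section

variable {Ω : Set ℂ} {γ : ℝ → ℂ} {L : ℝ}

lemma im_dz_mul_eq_zero {φ : ℂ → ℝ} {z w : ℂ} {c σ : ℝ}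
    (h1 : pd 1 φ z = c * w.re) (hI : pd I φ z = c * w.im) :
    (dz φ z * (σ * w)).im = 0 := by
  rw [dz, h1, hI]
  simp
  ring

/-- The counting bound for domains in the complex plane. -/
theorem exists_card_boundary_zeros_le (hΩ : IsOpen Ω) (hb : Bornology.IsBounded Ω)
    (hL : 0 < L) (hγ : AnalyticOnNhd ℝ γ univ) (hper : Function.Periodic γ L)
    (hunit : ∀ t, ‖deriv γ t‖ = 1) (hinj : InjOn γ (Ico 0 L))
    (himg : γ '' Ico 0 L = frontier Ω) :
    ∃ K, 0 < K ∧ ∀ (lam : ℝ) (φ : ℂ → ℝ), 0 < lam →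
      (∀ z ∈ closure Ω, ContDiffAt ℝ ∞ φ z) → (¬ ∀ z ∈ closure Ω, φ z = 0) →
      (∀ z ∈ Ω, pd 1 (pd 1 φ) z + pd I (pd I φ) z + lam ^ 2 * φ z = 0) →
      (∀ t, ∃ c : ℝ, pd 1 φ (γ t) = c * (deriv γ t).re ∧ pd I φ (γ t) = c * (deriv γ t).im) →
      ∀ S : Finset ℝ, (∀ t ∈ S, t ∈ Ico 0 L ∧ φ (γ t) = 0) → (S.card : ℝ) ≤ K * (1 + lam) := by
  obtain ⟨Z, Z1, Z2, h, C, σ, W, hZ, hσ, hZγ, hW, hfr, hmap, hcov⟩ :=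
    exists_collar hΩ hb hL hγ hper hunit hinj himg
  obtain ⟨K, hK, hcontrol⟩ := hZ.control hΩ hb hW hfr hmap hcov
  obtain ⟨c, hc, hcard⟩ := exists_card_zeros_le hZ.h_pos hL
  refine ⟨K / c, div_pos hK hc, fun lam φ hlam hφ hne heq hN S hS => ?_⟩
  have hσσ : σ * σ = 1 := by rw [← abs_mul_abs_self, hσ, one_mul]
  have habs : ∀ x : ℝ, |σ * x| = |x| := fun x => by rw [abs_mul, hσ, one_mul]
  have hγΩ : ∀ t, γ t ∈ closure Ω := fun t => by
    obtain ⟨t', ht', h'⟩ := hper.exists_mem_Ico₀ hL t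
    rw [h']
    exact frontier_subset_closure (himg ▸ mem_image_of_mem γ ht')
  have hreal : ∀ z ∈ upperRect (12 * L) h, z.im = 0 → |z.re| ≤ 12 * L ∧ z = (z.re : ℂ) :=
    fun z hz h0 => ⟨hz.1, Complex.ext (by simp) (by simp [h0])⟩
  have hbd : ∀ z ∈ upperRect (12 * L) h, z.im = 0 → (dz φ (Z z) * Z1 z).im = 0 := by
    intro z hz h0
    obtain ⟨h1, h2⟩ := hreal z hz h0
    rw [h2, (hZγ _ h1).1, (hZγ _ h1).2]
    obtain ⟨a, ha1, haI⟩ := hN (σ * z.re)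
    exact im_dz_mul_eq_zero ha1 haI
  obtain ⟨g, hg, hgφ, hgm⟩ := hcontrol lam φ hlam hφ heq hbd
  have hcont : Continuous fun t => |φ (γ t)| := continuous_iff_continuousAt.2 fun t =>
    ((hφ _ (hγΩ t)).continuousAt.comp (f := γ) (hγ t (mem_univ t)).continuousAt).abs
  obtain ⟨s, hs, hmax⟩ := (isCompact_Icc (a := (0 : ℝ)) (b := L)).exists_isMaxOn
    (nonempty_Icc.2 hL.le) hcont.continuousOn
  have hle : ∀ t, |φ (γ t)| ≤ |φ (γ s)| := fun t => by
    obtain ⟨t', ht', h'⟩ := hper.exists_mem_Ico₀ hL t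
    rw [h']
    exact hmax (Ico_subset_Icc_self ht')
  have hleZ : ∀ z ∈ upperRect (12 * L) h, z.im = 0 → |φ (Z z)| ≤ |φ (γ s)| := by
    intro z hz h0
    obtain ⟨h1, h2⟩ := hreal z hz h0
    rw [h2, (hZγ _ h1).1]
    exact hle _
  have hpos : 0 < |φ (γ s)| := by
    refine lt_of_le_of_ne (abs_nonneg _) fun h0 => hne fun z hz => ?_
    have hlim : Tendsto (fun m : ℝ => Real.exp (K * (1 + lam)) * m) (𝓝[>] 0) (𝓝 0) := by
      have : Continuous fun m : ℝ => Real.exp (K * (1 + lam)) * m := by fun_prop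
      simpa using (this.tendsto 0).mono_left nhdsWithin_le_nhds
    have : |φ z| ≤ 0 := ge_of_tendsto hlim <| by
      filter_upwards [self_mem_nhdsWithin] with m hm
      exact (hgm m hm fun z hz h0' => (hleZ z hz h0').trans (h0 ▸ le_of_lt hm)).1 z hz
    exact abs_eq_zero.1 (le_antisymm this (abs_nonneg _))
  have hgx : ∀ x : ℝ, |x| ≤ L → g ((σ * x : ℝ) : ℂ) = φ (γ x) := fun x hx => by
    have hx' : |σ * x| ≤ 12 * L := by rw [habs]; linarith
    rw [hgφ _ ⟨by simpa using hx', by simp, by simpa using hZ.h_pos.le⟩ (by simp),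
      (hZγ _ hx').1, ← mul_assoc, hσσ, one_mul]
  have hs' : |s| ≤ L := abs_le.2 ⟨by linarith [hs.1], hs.2⟩
  have hinjσ : Function.Injective fun x : ℝ => σ * x :=
    mul_right_injective₀ fun h0 => by simp [h0] at hσ
  have := hcard (12 * L) (σ * s) (Real.exp (K * (1 + lam)) * |φ (γ s)|) |φ (γ s)| g
    (by rw [habs]; linarith) hg
    (fun z hz => (hgm _ hpos hleZ).2 z (openSymmRect_subset hz)) hpos
    (by rw [hgx s hs', Complex.norm_real, Real.norm_eq_abs]) (S.image fun x => σ * x) (by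
      intro y hy
      obtain ⟨x, hx, rfl⟩ := Finset.mem_image.1 hy
      obtain ⟨hxL, hx0⟩ := hS x hx
      refine ⟨?_, ?_⟩
      · rw [← mul_sub, habs, abs_le]
        constructor <;> linarith [hxL.1, hxL.2, hs.1, hs.2]
      · rw [hgx x (abs_le.2 ⟨by linarith [hxL.1], hxL.2.le⟩), hx0, ofReal_zero])
  rw [Finset.card_image_of_injective _ hinjσ, mul_div_cancel_right₀ _ hpos.ne',
    Real.log_exp] at this
  rw [div_mul_eq_mul_div, le_div_iff₀ hc]
  exact this

end

/-- The identification of `ℂ` with the Euclidean plane. -/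
noncomputable def complexPlaneIso : ℂ ≃ₗᵢ[ℝ] EuclideanSpace ℝ (Fin 2) :=
  Complex.orthonormalBasisOneI.repr

lemma complexPlaneIso_one : complexPlaneIso 1 = EuclideanSpace.single 0 1 := by
  have := Complex.orthonormalBasisOneI.repr_self 0
  simpa [complexPlaneIso] using this

lemma complexPlaneIso_I : complexPlaneIso I = EuclideanSpace.single 1 1 := by
  have := Complex.orthonormalBasisOneI.repr_self 1
  simpa [complexPlaneIso] using this

lemma pd_comp_complexPlaneIso (f : EuclideanSpace ℝ (Fin 2) → ℝ) (v z : ℂ) :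
    pd v (fun w => f (complexPlaneIso w)) z =
      fderiv ℝ f (complexPlaneIso z) (complexPlaneIso v) := by
  have := complexPlaneIso.toContinuousLinearEquiv.comp_right_fderiv (f := f) (x := z)
  exact congrArg (fun A : ℂ →L[ℝ] ℝ => A v) this

lemma lap2_complexPlaneIso (f : EuclideanSpace ℝ (Fin 2) → ℝ) (z : ℂ) :
    pd 1 (pd 1 fun w => f (complexPlaneIso w)) z + pd I (pd I fun w => f (complexPlaneIso w)) z =
      lap2 f (complexPlaneIso z) := by
  have h (v : ℂ) : pd v (fun w => f (complexPlaneIso w)) =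
      fun w => (fun y => fderiv ℝ f y (complexPlaneIso v)) (complexPlaneIso w) :=
    funext fun w => pd_comp_complexPlaneIso f v w
  rw [h 1, h I, pd_comp_complexPlaneIso fun y => fderiv ℝ f y (complexPlaneIso 1),
    pd_comp_complexPlaneIso fun y => fderiv ℝ f y (complexPlaneIso I), lap2, Fin.sum_univ_two,
    complexPlaneIso_one, complexPlaneIso_I]

lemma pd_of_gradient_eq {f : EuclideanSpace ℝ (Fin 2) → ℝ} {z w : ℂ} {c : ℝ}
    (h : gradient f (complexPlaneIso z) = c • complexPlaneIso w) :
    pd 1 (fun y => f (complexPlaneIso y)) z = c * w.re ∧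
      pd I (fun y => f (complexPlaneIso y)) z = c * w.im := by
  have key (v : ℂ) : pd v (fun y => f (complexPlaneIso y)) z = c * inner ℝ w v := by
    rw [pd_comp_complexPlaneIso, ← complexPlaneIso.inner_map_map, ← real_inner_smul_left, ← h,
      gradient, InnerProductSpace.toDual_symm_apply]
  constructor <;> rw [key] <;> simp [Complex.inner]

end

/-- **Counting boundary nodal points of Neumann eigenfunctions** (Toth–Zelditch).
For a bounded plane domain Ω with connected real-analytic boundary, there is a
constant C = C(Ω) > 0 such that every Neumann eigenfunction with eigenvalue λ²
has at most C(1 + λ) zeros on the boundary. -/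
theorem boundary_nodal_points_bound
    (Ω : Set (EuclideanSpace ℝ (Fin 2))) (hΩo : IsOpen Ω)
    (hΩb : Bornology.IsBounded Ω)
    (L : ℝ) (hL : 0 < L) (γ : ℝ → EuclideanSpace ℝ (Fin 2))
    (hγa : AnalyticOnNhd ℝ γ Set.univ)
    (hper : ∀ t, γ (t + L) = γ t)
    (hunit : ∀ t, ‖deriv γ t‖ = 1)
    (hinj : Set.InjOn γ (Set.Ico 0 L))
    (himg : γ '' Set.Ico 0 L = frontier Ω) :
    ∃ C > (0 : ℝ), ∀ lam : ℝ, 0 < lam →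
      ∀ φ : EuclideanSpace ℝ (Fin 2) → ℝ,
        IsNeumannEigenfunction Ω γ lam φ →
        {t ∈ Set.Ico 0 L | φ (γ t) = 0}.Finite ∧
          ({t ∈ Set.Ico 0 L | φ (γ t) = 0}.ncard : ℝ) ≤ C * (1 + lam) := by
  let e := complexPlaneIso
  let Ωc : Set ℂ := e ⁻¹' Ω
  let δ : ℝ → ℂ := fun t => e.symm (γ t)
  have hcl : closure Ωc = e ⁻¹' closure Ω := (e.toHomeomorph.preimage_closure Ω).symm
  have hfr : frontier Ωc = e ⁻¹' frontier Ω := (e.toHomeomorph.preimage_frontier Ω).symm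
  have hderiv : ∀ t, deriv δ t = e.symm (deriv γ t) := fun t =>
    (e.symm.toContinuousLinearEquiv.hasFDerivAt.comp_hasDerivAt t
      (hγa t (Set.mem_univ t)).differentiableAt.hasDerivAt).deriv
  have hδ : AnalyticOnNhd ℝ δ Set.univ := fun t ht =>
    (e.symm.toContinuousLinearEquiv.toContinuousLinearMap.analyticAt _).comp (hγa t ht)
  obtain ⟨K, hK, hcard⟩ := exists_card_boundary_zeros_le (Ω := Ωc) (γ := δ)
    (hΩo.preimage e.continuous)
    (e.isometry.antilipschitz.isBounded_preimage hΩb) hL hδ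
    (fun t => congrArg e.symm (hper t))
    (fun t => by rw [hderiv, e.symm.norm_map, hunit])
    (fun a ha b hb hab => hinj ha hb (e.symm.injective hab))
    (by
      rw [hfr, ← himg]
      ext z
      simp only [Set.mem_image, Set.mem_preimage]
      exact exists_congr fun t => and_congr_right fun _ => e.symm_apply_eq)
  refine ⟨K, hK, ?_⟩
  rintro lam hlam φ ⟨⟨U, hU, hclU, hφ⟩, hne, heq, hN⟩
  have hbound := hcard lam (fun z => φ (e z)) hlam
    (fun z hz => (hφ.contDiffAt (hU.mem_nhds (hclU (hcl.subset hz)))).comp z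
      e.toContinuousLinearEquiv.contDiff.contDiffAt)
    (fun h => hne fun x hx => by
      have := h (e.symm x) (by rw [hcl]; simpa using hx)
      simpa using this)
    (fun z hz => by
      rw [lap2_complexPlaneIso, heq _ hz]
      ring)
    (fun t => by
      obtain ⟨c, hc⟩ := hN t
      refine ⟨c, pd_of_gradient_eq ?_⟩
      rw [hderiv]
      simpa [δ, e] using hc)
  have hzero : ∀ S : Finset ℝ, (S : Set ℝ) ⊆ {t ∈ Set.Ico 0 L | φ (γ t) = 0} →
      (S.card : ℝ) ≤ K * (1 + lam) := fun S hS => hbound S fun t ht =>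
    ⟨(hS ht).1, by simpa [δ] using (hS ht).2⟩
  have hfin : {t ∈ Set.Ico 0 L | φ (γ t) = 0}.Finite := by
    by_contra hinf
    obtain ⟨n, hn⟩ := exists_nat_gt (K * (1 + lam))
    obtain ⟨S, hS, hSn⟩ := Set.Infinite.exists_subset_card_eq hinf n
    exact absurd (hzero S hS) (by rw [hSn]; exact not_le.2 hn)
  refine ⟨hfin, ?_⟩
  rw [Set.ncard_eq_toFinset_card _ hfin]
  exact hzero _ (by simp)
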